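/- There exists an absolute constant C > 0 with the following property: let R > 4 and let u be a real-valued weak solution of Δu + Vu = 0 on the disk B(0, 2R) ⊂ ℝ², where V is real-valued, measurable, and |V| ≤ 1 almost everywhere. If |u(0)| = sup_{B(0,2R)} |u| = 1, then for every x₀ with |x₀| = R/2 one has sup_{B(x₀,1)} |u| ≥ exp(−C·R·(log R)^{3/2}). -/

import Mathlib

noncomputable section

open MeasureTheory Metric Filter Set
open scoped Topology ENNReal RealInnerProductSpace

/-- The Euclidean plane. -/
abbrev E2 : Type := EuclideanSpace ℝ (Fin 2)

/-- The Laplacian of a function on `ℝⁿ`, computed via iterated Fréchet derivatives in the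
coordinate directions. -/
def lap {n : ℕ} (f : EuclideanSpace ℝ (Fin n) → ℝ) (x : EuclideanSpace ℝ (Fin n)) : ℝ :=
  ∑ i : Fin n, fderiv ℝ (fun y => fderiv ℝ f y (EuclideanSpace.single i 1)) x
    (EuclideanSpace.single i 1)

/-- A test function on a set `Ω`: smooth, compactly supported, with support inside `Ω`. -/
def IsTestFun {n : ℕ} (Ω : Set (EuclideanSpace ℝ (Fin n)))
    (h : EuclideanSpace ℝ (Fin n) → ℝ) : Prop :=
  ContDiff ℝ (⊤ : ℕ∞) h ∧ HasCompactSupport h ∧ tsupport h ⊆ Ω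

/-- `u` is a weak solution of `Δu + Vu = 0` on `Ω`:
`∫_Ω u Δh + ∫_Ω V u h = 0` for every test function `h` on `Ω`. -/
def IsWeakSol {n : ℕ} (Ω : Set (EuclideanSpace ℝ (Fin n)))
    (V u : EuclideanSpace ℝ (Fin n) → ℝ) : Prop :=
  ∀ h, IsTestFun Ω h →
    (∫ x in Ω, u x * lap h x) + (∫ x in Ω, V x * u x * h x) = 0

/-- The supremum of `|u|` over a set `s`. -/
def supAbs {n : ℕ} (u : EuclideanSpace ℝ (Fin n) → ℝ) (s : Set (EuclideanSpace ℝ (Fin n))) : ℝ :=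
  sSup ((fun z => |u z|) '' s)

namespace Landis

open Complex
open scoped ContDiff Convolution Laplacian

/-- The Wirtinger derivative `∂f/∂z`. -/
def dz (f : ℂ → ℂ) (z : ℂ) : ℂ := (fderiv ℝ f z 1 - I * fderiv ℝ f z I) / 2

/-- The Wirtinger derivative `∂f/∂(conj z)`. -/
def db (f : ℂ → ℂ) (z : ℂ) : ℂ := (fderiv ℝ f z 1 + I * fderiv ℝ f z I) / 2

lemma fderiv_apply_eq (f : ℂ → ℂ) (z v : ℂ) :
    fderiv ℝ f z v = dz f z * v + db f z * (starRingEnd ℂ) v := by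
  have hv : v = v.re • (1 : ℂ) + v.im • I := by
    apply Complex.ext <;> simp
  have h : fderiv ℝ f z v = v.re * fderiv ℝ f z 1 + v.im * fderiv ℝ f z I := by
    conv_lhs => rw [hv]
    rw [map_add, map_smul, map_smul]; simp
  rw [h, dz, db]
  have h1 : (v : ℂ) = v.re + v.im * I := by simp
  have h2 : (starRingEnd ℂ) v = v.re - v.im * I := by
    apply Complex.ext <;> simp
  rw [h2]; nth_rewrite 3 [h1]
  ring_nf
  simp [I_sq]

variable {f g : ℂ → ℂ} {z : ℂ}

lemma dz_mul (hf : DifferentiableAt ℝ f z) (hg : DifferentiableAt ℝ g z) :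
    dz (fun w => f w * g w) z = f z * dz g z + dz f z * g z := by
  simp only [dz]; rw [fderiv_fun_mul hf hg]; simp; ring

lemma db_mul (hf : DifferentiableAt ℝ f z) (hg : DifferentiableAt ℝ g z) :
    db (fun w => f w * g w) z = f z * db g z + db f z * g z := by
  simp only [db]; rw [fderiv_fun_mul hf hg]; simp; ring

lemma db_sub (hf : DifferentiableAt ℝ f z) (hg : DifferentiableAt ℝ g z) :
    db (fun w => f w - g w) z = db f z - db g z := by
  simp only [db]; rw [fderiv_fun_sub hf hg]; simp; ring

lemma db_cexp_neg (hf : DifferentiableAt ℝ f z) :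
    db (fun w => Complex.exp (-(f w))) z = -(Complex.exp (-(f z)) * db f z) := by
  have h : HasFDerivAt (fun w => Complex.exp (-(f w)))
      (Complex.exp (-(f z)) • (-fderiv ℝ f z)) z := hf.hasFDerivAt.neg.cexp
  simp only [db]; rw [h.fderiv]; simp; ring

lemma db_const_mul (c : ℂ) (hf : DifferentiableAt ℝ f z) :
    db (fun w => c * f w) z = c * db f z := by
  simp only [db]; rw [fderiv_const_mul hf]; simp; ring

/-- A real differentiable function with vanishing `∂/∂(conj z)` is complex differentiable. -/
lemma differentiableAt_of_db_eq_zero (hf : DifferentiableAt ℝ f z) (h : db f z = 0) :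
    DifferentiableAt ℂ f z := by
  have : HasDerivAt f (dz f z) z := by
    rw [hasDerivAt_iff_hasFDerivAt]
    refine hasFDerivAt_of_restrictScalars ℝ hf.hasFDerivAt ?_
    ext v
    simp [fderiv_apply_eq, h, mul_comm]
  exact this.differentiableAt

lemma contDiff_dz (hf : ContDiff ℝ ∞ f) : ContDiff ℝ ∞ (dz f) := by
  have h : ContDiff ℝ ∞ (fderiv ℝ f) := hf.fderiv_right (by norm_cast)
  unfold dz
  exact ((h.clm_apply contDiff_const).sub (contDiff_const.mul (h.clm_apply contDiff_const))).div_const _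

lemma contDiff_db (hf : ContDiff ℝ ∞ f) : ContDiff ℝ ∞ (db f) := by
  have h : ContDiff ℝ ∞ (fderiv ℝ f) := hf.fderiv_right (by norm_cast)
  unfold db
  exact ((h.clm_apply contDiff_const).add (contDiff_const.mul (h.clm_apply contDiff_const))).div_const _

/-- The Wirtinger derivative of a real function. -/
def dr (u : ℂ → ℝ) (z : ℂ) : ℂ := dz (fun w => (u w : ℂ)) z

lemma fderiv_ofReal_comp {u : ℂ → ℝ} (hu : DifferentiableAt ℝ u z) (v : ℂ) :
    fderiv ℝ (fun w => (u w : ℂ)) z v = (fderiv ℝ u z v : ℂ) := by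
  have : HasFDerivAt (fun w => (u w : ℂ)) (Complex.ofRealCLM.comp (fderiv ℝ u z)) z :=
    Complex.ofRealCLM.hasFDerivAt.comp z hu.hasFDerivAt
  rw [this.fderiv]; simp

lemma dr_eq {u : ℂ → ℝ} (hu : DifferentiableAt ℝ u z) :
    dr u z = ((fderiv ℝ u z 1 : ℝ) - I * (fderiv ℝ u z I : ℝ)) / 2 := by
  rw [dr, dz, fderiv_ofReal_comp hu, fderiv_ofReal_comp hu]

lemma db_ofReal {u : ℂ → ℝ} (hu : DifferentiableAt ℝ u z) :
    db (fun w => (u w : ℂ)) z = (starRingEnd ℂ) (dr u z) := by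
  rw [dr_eq hu, db, fderiv_ofReal_comp hu, fderiv_ofReal_comp hu]
  simp [map_ofNat]

lemma fderiv_eq_re_dr {u : ℂ → ℝ} (hu : DifferentiableAt ℝ u z) (v : ℂ) :
    fderiv ℝ u z v = 2 * (dr u z * v).re := by
  have h := fderiv_apply_eq (fun w => (u w : ℂ)) z v
  rw [fderiv_ofReal_comp hu, db_ofReal hu, ← map_mul] at h
  have := congrArg Complex.re h
  simp only [Complex.ofReal_re, Complex.add_re, Complex.conj_re] at this
  rw [this, dr]; ring

lemma abs_fderiv_le {u : ℂ → ℝ} (hu : DifferentiableAt ℝ u z) (v : ℂ) :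
    |fderiv ℝ u z v| ≤ 2 * ‖dr u z‖ * ‖v‖ := by
  rw [fderiv_eq_re_dr hu, abs_mul, abs_two, mul_assoc, ← norm_mul]
  gcongr; exact Complex.abs_re_le_norm _

lemma norm_fderiv_le {u : ℂ → ℝ} (hu : DifferentiableAt ℝ u z) :
    ‖fderiv ℝ u z‖ ≤ 2 * ‖dr u z‖ :=
  ContinuousLinearMap.opNorm_le_bound _ (by positivity) (fun v => abs_fderiv_le hu v)

/-- The Laplacian on `ℂ`. -/
def lp (u : ℂ → ℝ) (z : ℂ) : ℝ :=
  fderiv ℝ (fun w => fderiv ℝ u w 1) z 1 + fderiv ℝ (fun w => fderiv ℝ u w I) z I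

lemma contDiff_lp {u : ℂ → ℝ} (hu : ContDiff ℝ ∞ u) : ContDiff ℝ ∞ (lp u) := by
  have h (v : ℂ) : ContDiff ℝ ∞ (fun w => fderiv ℝ u w v) :=
    (hu.fderiv_right (m := ∞) (by norm_cast)).clm_apply contDiff_const
  have h' (v : ℂ) : ContDiff ℝ ∞ (fun z => fderiv ℝ (fun w => fderiv ℝ u w v) z v) :=
    ((h v).fderiv_right (m := ∞) (by norm_cast)).clm_apply contDiff_const
  exact (h' 1).add (h' I)

lemma contDiff_ofReal {u : ℂ → ℝ} (hu : ContDiff ℝ ∞ u) : ContDiff ℝ ∞ (fun w => (u w : ℂ)) :=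
  Complex.ofRealCLM.contDiff.comp hu

lemma contDiff_dr {u : ℂ → ℝ} (hu : ContDiff ℝ ∞ u) : ContDiff ℝ ∞ (dr u) :=
  contDiff_dz (contDiff_ofReal hu)

lemma db_dr {u : ℂ → ℝ} (hu : ContDiff ℝ ∞ u) (z : ℂ) : db (dr u) z = (lp u z : ℂ) / 4 := by
  have h (v : ℂ) : ContDiff ℝ ∞ (fun w => fderiv ℝ u w v) :=
    (hu.fderiv_right (m := ∞) (by norm_cast)).clm_apply contDiff_const
  have hd (v : ℂ) : DifferentiableAt ℝ (fun w => fderiv ℝ u w v) z :=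
    ((h v).differentiable (by simp)).differentiableAt
  have e : dr u = fun w => ((fderiv ℝ u w 1 : ℝ) - I * (fderiv ℝ u w I : ℝ)) / 2 := by
    ext w; exact dr_eq ((hu.differentiable (by simp)).differentiableAt)
  have hF : HasFDerivAt (dr u) ((1/2 : ℂ) • (Complex.ofRealCLM.comp (fderiv ℝ (fun w => fderiv ℝ u w 1) z)
      - I • (Complex.ofRealCLM.comp (fderiv ℝ (fun w => fderiv ℝ u w I) z)))) z := by
    have h1 := (Complex.ofRealCLM.hasFDerivAt.comp z (hd 1).hasFDerivAt)
    have h2 := (Complex.ofRealCLM.hasFDerivAt.comp z (hd I).hasFDerivAt)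
    have h3 := (h1.sub (h2.const_smul I)).const_smul (1/2 : ℂ)
    refine h3.congr_of_eventuallyEq (Eventually.of_forall fun w => ?_)
    rw [e]; simp; ring
  have sym : fderiv ℝ (fun w => fderiv ℝ u w 1) z I = fderiv ℝ (fun w => fderiv ℝ u w I) z 1 := by
    have hs : IsSymmSndFDerivAt ℝ u z :=
      (hu.contDiffAt).isSymmSndFDerivAt (by simp; exact WithTop.coe_le_coe.2 le_top)
    have hdd : DifferentiableAt ℝ (fderiv ℝ u) z :=
      ((hu.fderiv_right (m := ∞) (by norm_cast)).differentiable (by simp)).differentiableAt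
    rw [fderiv_clm_apply hdd (by fun_prop), fderiv_clm_apply hdd (by fun_prop)]
    simpa using hs I 1
  rw [db, hF.fderiv]
  simp [sym, lp]
  ring_nf
  simp [I_sq]
  ring

lemma lintegral_norm_complex {f : ℝ → ℝ≥0∞} (hf : Measurable f) :
    ∫⁻ z : ℂ, f ‖z‖ = ENNReal.ofReal (2 * Real.pi) * ∫⁻ r in Ioi (0:ℝ), ENNReal.ofReal r * f r := by
  rw [← Complex.lintegral_comp_polarCoord_symm]
  rw [show polarCoord.target = Ioi (0:ℝ) ×ˢ Ioo (-Real.pi) Real.pi from rfl]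
  have h1 : ∀ p ∈ Ioi (0:ℝ) ×ˢ Ioo (-Real.pi) Real.pi,
      ENNReal.ofReal p.1 • f ‖Complex.polarCoord.symm p‖ = ENNReal.ofReal p.1 * f p.1 := by
    rintro ⟨r, θ⟩ ⟨hr, -⟩
    simp only [Complex.norm_polarCoord_symm, smul_eq_mul, abs_of_pos (show (0:ℝ) < r from hr)]
  rw [setLIntegral_congr_fun (measurableSet_Ioi.prod measurableSet_Ioo) h1, Measure.volume_eq_prod,
    ← Measure.prod_restrict, lintegral_prod]
  · simp only [lintegral_const, Measure.restrict_apply_univ, Real.volume_Ioo]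
    rw [lintegral_mul_const _ (by fun_prop), mul_comm]
    congr 2; ring
  · exact (by fun_prop : Measurable fun p : ℝ × ℝ => ENNReal.ofReal p.1 * f p.1).aemeasurable

lemma lintegral_ball_norm_rpow {a s : ℝ} (ha : a < 2) (hs : 0 ≤ s) :
    ∫⁻ z in ball (0:ℂ) s, ENNReal.ofReal (‖z‖ ^ (-a)) =
      ENNReal.ofReal (2 * Real.pi / (2 - a) * s ^ (2 - a)) := by
  have h0 : ∫⁻ z in ball (0:ℂ) s, ENNReal.ofReal (‖z‖ ^ (-a)) =
      ∫⁻ z : ℂ, (Iio s).indicator (fun r => ENNReal.ofReal (r ^ (-a))) ‖z‖ := by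
    rw [← lintegral_indicator measurableSet_ball]
    congr 1; ext z
    simp [indicator]
  have hm : Measurable fun r : ℝ => ENNReal.ofReal (r ^ (-a)) := by fun_prop
  rw [h0, lintegral_norm_complex (hm.indicator measurableSet_Iio)]
  have h1 : ∫⁻ r in Ioi (0:ℝ), ENNReal.ofReal r * (Iio s).indicator (fun r => ENNReal.ofReal (r ^ (-a))) r
      = ∫⁻ r in Ioc (0:ℝ) s, ENNReal.ofReal (r ^ (1 - a)) := by
    rw [restrict_Ioo_eq_restrict_Ioc.symm, ← Ioi_inter_Iio, inter_comm, ← Measure.restrict_restrict measurableSet_Iio,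
      ← lintegral_indicator measurableSet_Iio]
    refine setLIntegral_congr_fun measurableSet_Ioi fun r hr => ?_
    have hr' : 0 < r := hr
    by_cases h : r ∈ Iio s
    · simp only [indicator_of_mem h]
      rw [← ENNReal.ofReal_mul hr'.le]
      congr 1
      rw [sub_eq_add_neg, Real.rpow_add hr', Real.rpow_one]
    · simp [indicator_of_notMem h]
  rw [h1, ← ofReal_integral_eq_lintegral_ofReal, ← intervalIntegral.integral_of_le hs,
    integral_rpow (Or.inl (by linarith)), ← ENNReal.ofReal_mul (by positivity)]
  · congr 1
    rw [Real.zero_rpow (by linarith)]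
    rw [show (1 - a + 1) = 2 - a by ring]
    have : (2 - a) ≠ 0 := by linarith
    field_simp; ring
  · exact (intervalIntegral.intervalIntegrable_rpow' (by linarith)).1
  · filter_upwards [ae_restrict_mem measurableSet_Ioc] with r hr
    exact Real.rpow_nonneg hr.1.le _

lemma integrableOn_ball_norm_rpow {a s : ℝ} (ha : a < 2) (c : ℂ) :
    IntegrableOn (fun z : ℂ => ‖z - c‖ ^ (-a)) (ball c s) := by
  have h0 : ∀ t : ℝ, 0 ≤ t → IntegrableOn (fun z : ℂ => ‖z‖ ^ (-a)) (ball (0:ℂ) t) := by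
    intro t ht
    refine ⟨(by fun_prop : Measurable fun z : ℂ => ‖z‖ ^ (-a)).aestronglyMeasurable, ?_⟩
    rw [HasFiniteIntegral]
    have : ∫⁻ z in ball (0:ℂ) t, ‖‖z‖ ^ (-a)‖ₑ = ∫⁻ z in ball (0:ℂ) t, ENNReal.ofReal (‖z‖ ^ (-a)) := by
      congr 1; ext z
      rw [← ofReal_norm_eq_enorm, Real.norm_of_nonneg (by positivity)]
    rw [this, lintegral_ball_norm_rpow ha ht]
    exact ENNReal.ofReal_lt_top
  rcases le_or_gt 0 s with hs | hs
  · have h1 := h0 s hs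
    have hmp := measurePreserving_sub_right (volume : Measure ℂ) c
    have := (hmp.integrableOn_comp_preimage (MeasurableEquiv.subRight c).measurableEmbedding
      (f := fun z : ℂ => ‖z‖ ^ (-a)) (s := ball 0 s)).2 h1
    have hset : ball c s = (fun x => x - c) ⁻¹' ball 0 s := by
      ext z; rw [mem_preimage, mem_ball, mem_ball, dist_eq_norm, dist_zero_right]
    rw [hset]; exact this
  · rw [ball_eq_empty.2 hs.le]; exact integrableOn_empty

lemma locallyIntegrable_norm_rpow {a : ℝ} (ha : a < 2) (c : ℂ) :
    LocallyIntegrable (fun z : ℂ => ‖z - c‖ ^ (-a)) := by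
  rw [locallyIntegrable_iff]
  intro k hk
  obtain ⟨r, hr⟩ := hk.isBounded.subset_ball c
  exact (integrableOn_ball_norm_rpow ha c).mono_set hr

lemma locallyIntegrable_inv : LocallyIntegrable (fun z : ℂ => z⁻¹) := by
  rw [locallyIntegrable_iff]
  intro k hk
  have := (locallyIntegrable_iff.1 (locallyIntegrable_norm_rpow (a := 1) (by norm_num) 0)) k hk
  refine Integrable.mono this (by measurability) (Eventually.of_forall fun z => ?_)
  rw [norm_inv, Real.norm_of_nonneg (by positivity), sub_zero, Real.rpow_neg_one]

lemma integral_db_div {g : ℂ → ℂ} (hg : ContDiff ℝ 1 g) (hc : HasCompactSupport g) :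
    ∫ z, z⁻¹ * db g z = -Real.pi * g 0 := by
  obtain ⟨R, hR0, hR⟩ : ∃ R : ℝ, 0 < R ∧ tsupport g ⊆ ball 0 R := by
    obtain ⟨r, hr⟩ := hc.isCompact.isBounded.subset_ball 0
    exact ⟨max r 1, by positivity, hr.trans (ball_subset_ball (le_max_left _ _))⟩
  have hz : ∀ z : ℂ, R ≤ ‖z‖ → g z = 0 := fun z h => by
    refine image_eq_zero_of_notMem_tsupport fun h' => ?_
    have := hR h'; simp at this; linarith
  have hz' : ∀ z : ℂ, R ≤ ‖z‖ → fderiv ℝ g z = 0 := fun z h => by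
    refine image_eq_zero_of_notMem_tsupport (f := fderiv ℝ g) fun h' => ?_
    have := hR (tsupport_fderiv_subset ℝ h'); simp at this; linarith
  have hdc : Continuous (fderiv ℝ g) := hg.continuous_fderiv (by norm_num)
  have hdiff : Differentiable ℝ g := hg.differentiable (by norm_num)
  let e : ℝ → ℂ := fun θ => Complex.exp (θ * I)
  have he : Continuous e := by unfold e; fun_prop
  have hen : ∀ θ, ‖e θ‖ = 1 := fun θ => Complex.norm_exp_ofReal_mul_I θ
  let A : ℝ × ℝ → ℂ := fun p => fderiv ℝ g (p.1 * e p.2) (e p.2)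
  let B : ℝ × ℝ → ℂ := fun p => I * fderiv ℝ g (p.1 * e p.2) (I * e p.2)
  have hA : Continuous A := by unfold A; fun_prop
  have hB : Continuous B := by unfold B; fun_prop
  have hinteg : ∀ f : ℝ × ℝ → ℂ, Continuous f →
      IntegrableOn f (Ioc 0 R ×ˢ Ioo (-Real.pi) Real.pi) := fun f hf =>
    (hf.continuousOn.integrableOn_compact (isCompact_Icc.prod isCompact_Icc)).mono_set
      (prod_mono Ioc_subset_Icc_self Ioo_subset_Icc_self)
  have key : ∀ p ∈ Ioi (0:ℝ) ×ˢ Ioo (-Real.pi) Real.pi,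
      p.1 • ((Complex.polarCoord.symm p)⁻¹ * db g (Complex.polarCoord.symm p)) =
        (1/2 : ℂ) * (A p + B p) := by
    rintro ⟨r, θ⟩ ⟨hr, -⟩
    have hr' : (0:ℝ) < r := hr
    have hpe : Complex.polarCoord.symm (r, θ) = r * e θ := by
      simp [e, Complex.polarCoord_symm_apply, Complex.exp_mul_I]
    have hce : (starRingEnd ℂ) (e θ) = (e θ)⁻¹ := (Complex.inv_eq_conj (hen θ)).symm
    have hne : e θ ≠ 0 := Complex.exp_ne_zero _
    rw [hpe]; simp only [A, B]
    rw [fderiv_apply_eq, fderiv_apply_eq g _ (I * e θ), map_mul, hce, Complex.conj_I]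
    have hr'' : (r : ℂ) ≠ 0 := by exact_mod_cast hr'.ne'
    rw [real_smul]
    field_simp
    ring_nf
    simp [I_sq]; ring
  rw [← Complex.integral_comp_polarCoord_symm, show polarCoord.target = Ioi (0:ℝ) ×ˢ Ioo (-Real.pi) Real.pi from rfl,
    setIntegral_congr_fun (measurableSet_Ioi.prod measurableSet_Ioo) key]
  have hsub : Ioc 0 R ×ˢ Ioo (-Real.pi) Real.pi ⊆ Ioi (0:ℝ) ×ˢ Ioo (-Real.pi) Real.pi :=
    prod_mono Ioc_subset_Ioi_self subset_rfl
  rw [setIntegral_eq_of_subset_of_forall_diff_eq_zero (s := Ioc 0 R ×ˢ Ioo (-Real.pi) Real.pi)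
    (measurableSet_Ioi.prod measurableSet_Ioo) hsub]
  swap
  · rintro ⟨r, θ⟩ ⟨⟨h1, h2⟩, h3⟩
    have hr : R < r := by
      by_contra h; exact h3 ⟨⟨h1, not_lt.1 h⟩, h2⟩
    have hr0 : (0:ℝ) < r := h1
    have : fderiv ℝ g (r * e θ) = 0 := hz' _ (by
      rw [norm_mul, hen, Complex.norm_real, Real.norm_of_nonneg hr0.le, mul_one]; exact hr.le)
    simp [A, B, this]
  rw [integral_const_mul, integral_add (hinteg A hA) (hinteg B hB)]
  have hdline : ∀ θ r : ℝ, HasDerivAt (fun r : ℝ => g (r * e θ)) (A (r, θ)) r := by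
    intro θ r
    have h1 : HasDerivAt (fun r : ℝ => (r : ℂ) * e θ) (e θ) r := by
      simpa using (Complex.ofRealCLM.hasDerivAt (x := r)).mul_const (e θ)
    exact ((hdiff _).hasFDerivAt.comp_hasDerivAt r h1)
  have hdcirc : ∀ r θ : ℝ, HasDerivAt (fun θ : ℝ => g (r * e θ)) (r * (-I * B (r, θ))) θ := by
    intro r θ
    have h1 : HasDerivAt (fun θ : ℝ => (r : ℂ) * e θ) (r * (I * e θ)) θ := by
      have : HasDerivAt (fun θ : ℝ => (θ : ℂ) * I) I θ := by
        simpa using (Complex.ofRealCLM.hasDerivAt (x := θ)).mul_const I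
      have := this.cexp.const_mul (r:ℂ)
      refine this.congr_deriv ?_
      show (r:ℂ) * (e θ * I) = _
      ring
    have h2 := ((hdiff _).hasFDerivAt.comp_hasDerivAt θ h1)
    refine h2.congr_deriv ?_
    have : (r : ℂ) * (I * e θ) = r • (I * e θ) := by rw [real_smul]
    simp only [B]; rw [this, map_smul, real_smul]
    linear_combination ((r:ℂ) * (fderiv ℝ g (r * e θ)) (I * e θ)) * I_sq
  have iA : ∫ p in Ioc 0 R ×ˢ Ioo (-Real.pi) Real.pi, A p = -(2 * Real.pi) * g 0 := by
    rw [Measure.volume_eq_prod, ← setIntegral_prod_swap, setIntegral_prod _ (by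
      have := hinteg A hA
      rw [Measure.volume_eq_prod] at this
      exact this.swap)]
    have : ∀ θ ∈ Ioo (-Real.pi) Real.pi, ∫ r in Ioc 0 R, A (Prod.swap (θ, r)) = - g 0 := by
      intro θ _
      rw [← intervalIntegral.integral_of_le hR0.le]
      have h3 := intervalIntegral.integral_eq_sub_of_hasDerivAt (a := 0) (b := R)
        (fun r _ => hdline θ r)
        ((by fun_prop : Continuous fun r => A (r, θ)).intervalIntegrable _ _)
      have h5 : g ((R : ℝ) * e θ) = 0 := by
        refine hz _ ?_
        rw [norm_mul, hen, Complex.norm_real, Real.norm_of_nonneg hR0.le, mul_one]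
      refine h3.trans ?_
      rw [h5]; simp
    rw [setIntegral_congr_fun measurableSet_Ioo this, setIntegral_const]
    simp only [Measure.real, Real.volume_Ioo]
    rw [ENNReal.toReal_ofReal (by linarith [Real.pi_pos]), real_smul]
    push_cast; ring
  have iB : ∫ p in Ioc 0 R ×ˢ Ioo (-Real.pi) Real.pi, B p = 0 := by
    rw [Measure.volume_eq_prod, setIntegral_prod _ (hinteg B hB)]
    refine setIntegral_eq_zero_of_forall_eq_zero fun r hr => ?_
    have hpi : -Real.pi ≤ Real.pi := by linarith [Real.pi_pos]
    rw [← integral_Ioc_eq_integral_Ioo, ← intervalIntegral.integral_of_le hpi]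
    have h3 := intervalIntegral.integral_eq_sub_of_hasDerivAt (a := -Real.pi) (b := Real.pi)
      (fun θ _ => hdcirc r θ) ((by fun_prop : Continuous fun θ => (r:ℂ) * (-I * B (r, θ))).intervalIntegrable _ _)
    have h4 : e (-Real.pi) = e Real.pi := by
      simp [e, Complex.exp_pi_mul_I, Complex.exp_neg]
    rw [h4, sub_self, intervalIntegral.integral_const_mul, intervalIntegral.integral_const_mul] at h3
    have hr0 : (r:ℂ) ≠ 0 := by exact_mod_cast hr.1.ne'
    have h5 := (mul_eq_zero.1 h3).resolve_left hr0
    exact (mul_eq_zero.1 h5).resolve_left (neg_ne_zero.2 I_ne_zero)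
  rw [iA, iB]; ring


section convolution
variable {𝕜 : Type*} [RCLike 𝕜] {f g : ℂ → 𝕜}

/-- Convolution of scalar functions on the plane. -/
def cv (f g : ℂ → 𝕜) (x : ℂ) : 𝕜 := ∫ t, f t * g (x - t)

lemma cv_eq (f g : ℂ → 𝕜) : cv f g = f ⋆[ContinuousLinearMap.mul ℝ 𝕜, volume] g := by
  ext x; simp [cv, convolution]

lemma contDiff_cv (hf : LocallyIntegrable f) (hg : ContDiff ℝ ∞ g) (hc : HasCompactSupport g) :
    ContDiff ℝ ∞ (cv f g) := by
  rw [cv_eq]; exact hc.contDiff_convolution_right _ hf hg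

lemma fderiv_cv (hf : LocallyIntegrable f) (hg : ContDiff ℝ ∞ g) (hc : HasCompactSupport g)
    (x v : ℂ) : fderiv ℝ (cv f g) x v = cv f (fun y => fderiv ℝ g y v) x := by
  have hg1 : ContDiff ℝ 1 g := hg.of_le (by exact_mod_cast le_top)
  rw [cv_eq, (hc.hasFDerivAt_convolution_right _ hf hg1 x).fderiv, cv_eq,
    convolution_precompR_apply _ hf (hc.fderiv ℝ) (hg1.continuous_fderiv (by norm_num))]

lemma integrable_cv (hf : LocallyIntegrable f) (hg : Continuous g) (hc : HasCompactSupport g) (x : ℂ) :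
    Integrable (fun t => f t * g (x - t)) := by
  have := hc.convolutionExists_right (ContinuousLinearMap.mul ℝ 𝕜) hf hg x
  simpa [ConvolutionExistsAt] using this

lemma cv_comm (f g : ℂ → 𝕜) (x : ℂ) : cv f g x = ∫ t, f (x - t) * g t := by
  rw [cv, ← integral_sub_left_eq_self _ _ x]; simp

end convolution

/-- The solid Cauchy transform, a right inverse of `∂/∂(conj z)`. -/
def cauchyT (β : ℂ → ℂ) (w : ℂ) : ℂ := (Real.pi : ℂ)⁻¹ * cv (fun z => z⁻¹) β w

lemma contDiff_cauchyT {β : ℂ → ℂ} (hβ : ContDiff ℝ ∞ β) (hc : HasCompactSupport β) :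
    ContDiff ℝ ∞ (cauchyT β) :=
  contDiff_const.mul (contDiff_cv locallyIntegrable_inv hβ hc)

lemma cauchyT_eq (β : ℂ → ℂ) (w : ℂ) :
    cauchyT β w = (Real.pi : ℂ)⁻¹ * ∫ z, (w - z)⁻¹ * β z := by
  rw [cauchyT, cv_comm]

lemma integrable_cauchyT {β : ℂ → ℂ} (hβ : Continuous β) (hc : HasCompactSupport β) (w : ℂ) :
    Integrable (fun z => (w - z)⁻¹ * β z) := by
  have := (integrable_cv locallyIntegrable_inv hβ hc w).comp_sub_left w
  simpa using this

lemma cv_inv_db {g : ℂ → ℂ} (hg : ContDiff ℝ ∞ g) (hc : HasCompactSupport g) (w : ℂ) :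
    cv (fun z => z⁻¹) (db g) w = Real.pi * g w := by
  have hd : Differentiable ℝ g := hg.differentiable (by simp)
  have h1 : ContDiff ℝ ∞ (fun z => g (w - z)) := hg.comp (contDiff_const.sub contDiff_id)
  have h2 : HasCompactSupport (fun z => g (w - z)) :=
    hc.comp_homeomorph (Homeomorph.subLeft w)
  have h3 := integral_db_div (h1.of_le (by exact_mod_cast le_top)) h2
  have h4 : ∀ z, db (fun z => g (w - z)) z = - db g (w - z) := by
    intro z
    have : HasFDerivAt (fun z => g (w - z)) (-(fderiv ℝ g (w - z))) z := by
      have h5 : HasFDerivAt (fun z : ℂ => w - z) (-(ContinuousLinearMap.id ℝ ℂ)) z := by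
        exact (hasFDerivAt_id z).const_sub w
      have h6 := (hd (w - z)).hasFDerivAt.comp z h5
      refine h6.congr_fderiv ?_
      ext <;> simp
    rw [db, this.fderiv, db]; simp; ring
  simp only [h4, mul_neg, integral_neg, sub_zero] at h3
  rw [cv]; linear_combination -h3

lemma cauchyT_db {g : ℂ → ℂ} (hg : ContDiff ℝ ∞ g) (hc : HasCompactSupport g) (w : ℂ) :
    cauchyT (db g) w = g w := by
  rw [cauchyT, cv_inv_db hg hc, ← mul_assoc, inv_mul_cancel₀, one_mul]
  exact_mod_cast Real.pi_ne_zero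

lemma db_cauchyT {β : ℂ → ℂ} (hβ : ContDiff ℝ ∞ β) (hc : HasCompactSupport β) (w : ℂ) :
    db (cauchyT β) w = β w := by
  have h1 := fderiv_cv locallyIntegrable_inv hβ hc w
  have hd : DifferentiableAt ℝ (cv (fun z : ℂ => z⁻¹) β) w :=
    (contDiff_cv locallyIntegrable_inv hβ hc).differentiable (by simp) w
  have hi (v : ℂ) : Integrable (fun t : ℂ => t⁻¹ * fderiv ℝ β (w - t) v) :=
    integrable_cv (g := fun y => fderiv ℝ β y v) locallyIntegrable_inv
      ((hβ.continuous_fderiv (by simp)).clm_apply continuous_const)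
      (hc.fderiv_apply ℝ v) w
  unfold cauchyT
  rw [db_const_mul _ hd, db, h1, h1]
  have : (cv (fun z : ℂ => z⁻¹) (fun y => fderiv ℝ β y 1) w + I * cv (fun z : ℂ => z⁻¹) (fun y => fderiv ℝ β y I) w) / 2
      = cv (fun z : ℂ => z⁻¹) (db β) w := by
    simp only [cv]
    rw [← integral_const_mul, ← integral_add (hi 1) ((hi I).const_mul I), ← integral_div]
    congr 1; ext t; rw [db]; ring
  rw [this, cv_inv_db hβ hc, ← mul_assoc, inv_mul_cancel₀, one_mul]
  exact_mod_cast Real.pi_ne_zero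

lemma fderiv_comp_affine {E : Type*} [NormedAddCommGroup E] [NormedSpace ℝ E] {u : ℂ → E}
    (c : ℂ) (s : ℝ) (x : ℂ) (hu : DifferentiableAt ℝ u (c + s * x)) (v : ℂ) :
    fderiv ℝ (fun x : ℂ => u (c + s * x)) x v = s • fderiv ℝ u (c + s * x) v := by
  have h5 : HasFDerivAt (fun x : ℂ => c + s * x) (s • (ContinuousLinearMap.id ℝ ℂ)) x := by
    have := ((hasFDerivAt_id (𝕜 := ℝ) x).const_smul s).const_add c
    simpa [real_smul] using this
  have h6 : HasFDerivAt (fun x : ℂ => u (c + s * x)) _ x := hu.hasFDerivAt.comp x h5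
  rw [h6.fderiv]
  simp

lemma contDiff_affine (c : ℂ) (s : ℝ) : ContDiff ℝ ∞ (fun x : ℂ => c + s * x) := by fun_prop

lemma dr_comp_affine {u : ℂ → ℝ} (hu : ContDiff ℝ ∞ u) (c : ℂ) (s : ℝ) (x : ℂ) :
    dr (fun x : ℂ => u (c + s * x)) x = s * dr u (c + s * x) := by
  have hd : Differentiable ℝ u := hu.differentiable (by simp)
  have hd' : Differentiable ℝ (fun x : ℂ => u (c + s * x)) :=
    (hu.comp (contDiff_affine c s)).differentiable (by simp)
  rw [dr_eq (hd' x), dr_eq (hd _), fderiv_comp_affine c s x (hd _), fderiv_comp_affine c s x (hd _)]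
  simp; ring

lemma lp_comp_affine {u : ℂ → ℝ} (hu : ContDiff ℝ ∞ u) (c : ℂ) (s : ℝ) (x : ℂ) :
    lp (fun x : ℂ => u (c + s * x)) x = s ^ 2 * lp u (c + s * x) := by
  have hd : Differentiable ℝ u := hu.differentiable (by simp)
  have h (v : ℂ) : Differentiable ℝ (fun w => fderiv ℝ u w v) :=
    ((hu.fderiv_right (m := ∞) (by norm_cast)).clm_apply contDiff_const).differentiable (by simp)
  have h' (v : ℂ) : Differentiable ℝ (fun x : ℂ => fderiv ℝ u (c + s * x) v) :=
    (h v).comp ((contDiff_affine c s).differentiable (by simp))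
  unfold lp
  simp only [fderiv_comp_affine c s _ (hd _)]
  have e (v w : ℂ) : fderiv ℝ (fun x : ℂ => s • fderiv ℝ u (c + s * x) v) x w
      = s * (s * fderiv ℝ (fun w => fderiv ℝ u w v) (c + s * x) w) := by
    rw [fderiv_fun_const_smul (h' v x)]
    have := fderiv_comp_affine (u := fun w => fderiv ℝ u w v) c s x (h v _) w
    simp [this]
  rw [e, e]; ring

lemma integral_fderiv_eq_zero {G : ℂ → ℂ} (hG : ContDiff ℝ 1 G) (hc : HasCompactSupport G) (v : ℂ) :
    ∫ z, fderiv ℝ G z v = 0 := by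
  have hi : Integrable (fun z => fderiv ℝ G z v) :=
    ((hG.continuous_fderiv (by norm_num)).clm_apply continuous_const).integrable_of_hasCompactSupport
      (hc.fderiv_apply ℝ v)
  have := integral_smul_fderiv_eq_neg_fderiv_smul_of_integrable (f := fun _ : ℂ => (1:ℝ)) (g := G)
    (μ := volume) (𝕜 := ℝ) (v := v) (by simp) (by simpa using hi)
    (by simpa using hG.continuous.integrable_of_hasCompactSupport hc) (by fun_prop)
    (fun x _ => hG.differentiable (by norm_num) x)
  simpa using this

lemma integral_dz_eq_zero {G : ℂ → ℂ} (hG : ContDiff ℝ 1 G) (hc : HasCompactSupport G) :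
    ∫ z, dz G z = 0 := by
  have hi (v : ℂ) : Integrable (fun z => fderiv ℝ G z v) :=
    ((hG.continuous_fderiv (by norm_num)).clm_apply continuous_const).integrable_of_hasCompactSupport
      (hc.fderiv_apply ℝ v)
  unfold dz
  rw [integral_div, integral_sub (hi 1) ((hi I).const_mul I), integral_const_mul,
    integral_fderiv_eq_zero hG hc, integral_fderiv_eq_zero hG hc]
  simp

lemma norm_dr_zero_le : ∃ C : ℝ, 0 < C ∧ ∀ u : ℂ → ℝ, ContDiff ℝ ∞ u →
    ‖dr u 0‖ ≤ C * ((∫ z in ball (0:ℂ) (1/2), |u z|) + ∫ z in ball (0:ℂ) (1/2), |lp u z| * ‖z‖⁻¹) := by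
  let χ : ContDiffBump (0:ℂ) := ⟨1/4, 1/3, by norm_num, by norm_num⟩
  let X : ℂ → ℂ := fun z => (χ z : ℂ)
  have hX : ContDiff ℝ ∞ X := contDiff_ofReal χ.contDiff
  have hXc : HasCompactSupport X := χ.hasCompactSupport.comp_left (g := ((↑) : ℝ → ℂ)) (by simp)
  have hXd := hX.differentiable (by simp)
  let k : ℂ → ℂ := fun z => z⁻¹ * db X z
  have hdbc : HasCompactSupport (db X) := by
    refine (hXc.fderiv ℝ).mono' ?_
    refine (Function.support_subset_iff'.2 fun z hz => ?_)
    have : fderiv ℝ X z = 0 := image_eq_zero_of_notMem_tsupport hz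
    simp [db, this]
  have hkc : HasCompactSupport k := hdbc.mul_left
  have hk : ContDiff ℝ ∞ k := by
    rw [contDiff_iff_contDiffAt]
    intro z
    by_cases hz : z ∈ ball (0:ℂ) (1/4)
    · have : k =ᶠ[𝓝 z] fun _ => 0 := by
        filter_upwards [isOpen_ball.mem_nhds hz] with w hw
        have h1 : X =ᶠ[𝓝 w] fun _ => 1 := by
          filter_upwards [isOpen_ball.mem_nhds hw] with y hy
          have : χ y = 1 := χ.one_of_mem_closedBall (ball_subset_closedBall hy)
          simp [X, this]
        simp only [k, db]; rw [h1.fderiv_eq]; simp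
      exact contDiffAt_const.congr_of_eventuallyEq this
    · have hz0 : z ≠ 0 := by rintro rfl; exact hz (mem_ball_self (by norm_num))
      exact ((contDiffAt_inv ℂ hz0).restrict_scalars ℝ).mul (contDiff_db hX).contDiffAt
  have hkz : Continuous (dz k) := (contDiff_dz hk).continuous
  have hkzc : HasCompactSupport (dz k) := by
    refine (hkc.fderiv ℝ).mono' ?_
    refine (Function.support_subset_iff'.2 fun z hz => ?_)
    have : fderiv ℝ k z = 0 := image_eq_zero_of_notMem_tsupport hz
    simp [dz, this]
  obtain ⟨C, hC⟩ := hkzc.exists_bound_of_continuous hkz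
  have hC0 : 0 ≤ C := (norm_nonneg _).trans (hC 0)
  refine ⟨C + 1, by linarith, fun u hu => ?_⟩
  have hud : Differentiable ℝ (fun w => (u w : ℂ)) := (contDiff_ofReal hu).differentiable (by simp)
  have hrd : Differentiable ℝ (dr u) := (contDiff_dr hu).differentiable (by simp)
  have hzero : ∀ z, z ∉ ball (0:ℂ) (1/2) → X z = 0 := by
    intro z hz
    have : χ z = 0 := by
      by_contra h
      have : z ∈ Function.support χ := h
      rw [χ.support_eq] at this; exact hz (ball_subset_ball (by norm_num) this)
    simp [X, this]
  have hg : ContDiff ℝ ∞ (fun z => X z * dr u z) := hX.mul (contDiff_dr hu)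
  have hgc : HasCompactSupport (fun z => X z * dr u z) := hXc.mul_right
  have h1 := cauchyT_db hg hgc 0
  rw [cauchyT_eq] at h1
  have hX0 : X 0 = 1 := by simp [X, χ.one_of_mem_closedBall (mem_closedBall_self χ.rIn_pos.le)]
  have h2 : ∀ z, (0 - z)⁻¹ * db (fun z => X z * dr u z) z =
      -(X z * (z⁻¹ * (lp u z / 4))) - (k z * dr u z) := by
    intro z; rw [db_mul (hXd z) (hrd z), db_dr hu]; simp only [k]
    rw [zero_sub, inv_neg]; ring
  simp only [h2, hX0, one_mul] at h1
  have i1 : Integrable (fun z => X z * (z⁻¹ * ((lp u z:ℂ) / 4))) := by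
    have := integrable_cauchyT (β := fun z => X z * ((lp u z : ℂ) / 4))
      (hX.continuous.mul ((contDiff_ofReal (contDiff_lp hu)).continuous.div_const _)) hXc.mul_right 0
    refine this.neg.congr (Eventually.of_forall fun z => ?_)
    simp [inv_neg]; ring
  have i2 : Integrable (fun z => k z * dr u z) :=
    (hk.continuous.mul (contDiff_dr hu).continuous).integrable_of_hasCompactSupport hkc.mul_right
  have i3 : Integrable (fun z => dz k z * u z) :=
    (hkz.mul (contDiff_ofReal hu).continuous).integrable_of_hasCompactSupport hkzc.mul_right
  have h3 : ∫ z, k z * dr u z = - ∫ z, dz k z * u z := by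
    have h4 := integral_dz_eq_zero (G := fun z => k z * u z)
      ((hk.mul (contDiff_ofReal hu)).of_le (by exact_mod_cast le_top)) hkc.mul_right
    simp only [dz_mul (hk.differentiable (by simp) _) (hud _)] at h4
    have h5 := integral_add i2 i3
    have h6 := h5.symm.trans h4
    linear_combination h6
  have h7 := integral_sub i1.neg i2
  simp only [Pi.neg_apply] at h7
  rw [h7, h3, integral_neg] at h1
  have hsupp3 : ∀ z, z ∉ ball (0:ℂ) (1/2) → dz k z = 0 := by
    intro z hz
    have h8 : ∀ w ∈ (closedBall (0:ℂ) (1/3))ᶜ, X =ᶠ[𝓝 w] fun _ => 0 := by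
      intro w hw
      filter_upwards [isClosed_closedBall.isOpen_compl.mem_nhds hw] with y hy
      have : χ y = 0 := by
        by_contra h
        have : y ∈ Function.support χ := h
        rw [χ.support_eq] at this; exact hy (ball_subset_closedBall this)
      simp [X, this]
    have h9 : k =ᶠ[𝓝 z] fun _ => 0 := by
      have : z ∈ (closedBall (0:ℂ) (1/3))ᶜ := fun h => hz (closedBall_subset_ball (by norm_num) h)
      filter_upwards [isClosed_closedBall.isOpen_compl.mem_nhds this] with w hw
      simp only [k, db, (h8 w hw).fderiv_eq]; simp
    simp [dz, h9.fderiv_eq]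
  have b1 : ‖∫ z, X z * (z⁻¹ * ((lp u z:ℂ) / 4))‖ ≤ ∫ z in ball (0:ℂ) (1/2), |lp u z| * ‖z‖⁻¹ := by
    rw [← setIntegral_eq_integral_of_forall_compl_eq_zero (s := ball 0 (1/2))
      (fun z hz => by rw [hzero z hz, zero_mul])]
    refine norm_integral_le_of_norm_le ?_ (Eventually.of_forall fun z => ?_)
    · have h10 := (integrableOn_ball_norm_rpow (a := 1) (s := 1/2) (by norm_num) 0)
      obtain ⟨D, hD⟩ := (isCompact_closedBall (0:ℂ) (1/2)).exists_bound_of_continuousOn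
        (contDiff_lp hu).continuous.continuousOn
      have h11 : Integrable (fun z => D * ‖z - 0‖ ^ (-1:ℝ)) (volume.restrict (ball (0:ℂ) (1/2))) :=
        Integrable.const_mul h10 D
      refine h11.mono' (((contDiff_lp hu).continuous.abs.measurable.mul
        (by measurability)).aestronglyMeasurable) ?_
      filter_upwards [ae_restrict_mem measurableSet_ball] with z hz
      rw [sub_zero, Real.rpow_neg_one, norm_mul, norm_inv, norm_norm, norm_abs_eq_norm]
      gcongr
      exact hD z (ball_subset_closedBall hz)
    · have : ‖X z‖ ≤ 1 := by
        simp only [X, Complex.norm_real, Real.norm_of_nonneg χ.nonneg]; exact χ.le_one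
      have e4 : ‖(4:ℂ)‖ = 4 := by norm_num
      rw [norm_mul, norm_mul, norm_div, norm_inv, Complex.norm_real (lp u z), Real.norm_eq_abs, e4]
      calc _ ≤ 1 * (‖z‖⁻¹ * (|lp u z| / 1)) := by
            gcongr
            norm_num
        _ = _ := by ring
  have b2 : ‖∫ z, dz k z * u z‖ ≤ C * ∫ z in ball (0:ℂ) (1/2), |u z| := by
    rw [← setIntegral_eq_integral_of_forall_compl_eq_zero (s := ball 0 (1/2))
      (fun z hz => by rw [hsupp3 z hz, zero_mul]), ← integral_const_mul]
    refine norm_integral_le_of_norm_le ?_ (Eventually.of_forall fun z => ?_)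
    · exact ((continuous_const.mul hu.continuous.abs).continuousOn.integrableOn_compact
        (isCompact_closedBall 0 (1/2))).mono_set ball_subset_closedBall
    · rw [norm_mul, Complex.norm_real, Real.norm_eq_abs]; gcongr; exact hC z
  rw [← h1, norm_mul, norm_inv, Complex.norm_real, Real.norm_of_nonneg Real.pi_pos.le]
  have hpi : Real.pi⁻¹ ≤ 1 := inv_le_one_of_one_le₀ (by linarith [Real.pi_gt_three])
  have p1 : 0 ≤ ∫ z in ball (0:ℂ) (1/2), |lp u z| * ‖z‖⁻¹ := by positivity
  have p2 : 0 ≤ ∫ z in ball (0:ℂ) (1/2), |u z| := by positivity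
  calc _ ≤ 1 * (‖∫ z, X z * (z⁻¹ * ((lp u z:ℂ) / 4))‖ + ‖∫ z, dz k z * u z‖) := by
        gcongr
        refine (norm_sub_le _ _).trans ?_
        simp
    _ ≤ _ := by nlinarith


lemma norm_dr_le_of_bound : ∃ C : ℝ, 0 < C ∧ ∀ (u : ℂ → ℝ) (B : ℝ), ContDiff ℝ ∞ u → 0 ≤ B →
    (∀ z ∈ ball (0:ℂ) (1/2), |lp u z| ≤ B) →
    ‖dr u 0‖ ≤ C * ((∫ z in ball (0:ℂ) (1/2), |u z|) + B) := by
  obtain ⟨C, hC, h⟩ := norm_dr_zero_le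
  have hi := (integrableOn_ball_norm_rpow (a := 1) (s := 1/2) (by norm_num) 0)
  simp only [sub_zero, Real.rpow_neg_one] at hi
  set J := ∫ z in ball (0:ℂ) (1/2), ‖z‖⁻¹
  have hJ : 0 ≤ J := by positivity
  refine ⟨C * (1 + J), by positivity, fun u B hu hB hb => (h u hu).trans ?_⟩
  have h1 : ∫ z in ball (0:ℂ) (1/2), |lp u z| * ‖z‖⁻¹ ≤ B * J := by
    rw [← integral_const_mul]
    refine integral_mono_of_nonneg (Eventually.of_forall fun z => by positivity) (hi.const_mul B) ?_
    filter_upwards [ae_restrict_mem measurableSet_ball] with z hz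
    gcongr; exact hb z hz
  have p2 : 0 ≤ ∫ z in ball (0:ℂ) (1/2), |u z| := by positivity
  rw [mul_assoc]
  gcongr
  nlinarith

/-- A radial weight on the unit disc. -/
def wt (x : ℂ) : ℝ := (max 0 (1 - ‖x‖ ^ 2)) ^ 2

/-- A radial function on the unit disc with `∇ wtK x = - wt x • x`. -/
def wtK (x : ℂ) : ℝ := (max 0 (1 - ‖x‖ ^ 2)) ^ 3 / 6

lemma continuous_wt : Continuous wt := by unfold wt; fun_prop
lemma continuous_wtK : Continuous wtK := by unfold wtK; fun_prop
lemma wt_nonneg (x : ℂ) : 0 ≤ wt x := by unfold wt; positivity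
lemma wtK_nonneg (x : ℂ) : 0 ≤ wtK x := by unfold wtK; positivity

lemma max_le_one_aux (x : ℂ) : max 0 (1 - ‖x‖ ^ 2) ≤ 1 :=
  max_le zero_le_one (by nlinarith [sq_nonneg ‖x‖])

lemma wtK_le_one (x : ℂ) : wtK x ≤ 1 := by
  have : (max 0 (1 - ‖x‖ ^ 2)) ^ 3 ≤ 1 := pow_le_one₀ (le_max_left _ _) (max_le_one_aux x)
  unfold wtK; linarith

lemma max_eq_zero_aux {x : ℂ} (hx : 1 ≤ ‖x‖) : max 0 (1 - ‖x‖ ^ 2) = 0 :=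
  max_eq_left (by nlinarith)

lemma wt_eq_zero {x : ℂ} (hx : 1 ≤ ‖x‖) : wt x = 0 := by simp [wt, max_eq_zero_aux hx]
lemma wtK_eq_zero {x : ℂ} (hx : 1 ≤ ‖x‖) : wtK x = 0 := by simp [wtK, max_eq_zero_aux hx]

lemma hasCompactSupport_wt : HasCompactSupport wt :=
  HasCompactSupport.intro (isCompact_closedBall (0:ℂ) 1) fun x hx =>
    wt_eq_zero (by simp at hx; exact hx.le)
lemma hasCompactSupport_wtK : HasCompactSupport wtK :=
  HasCompactSupport.intro (isCompact_closedBall (0:ℂ) 1) fun x hx =>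
    wtK_eq_zero (by simp at hx; exact hx.le)

lemma integrable_wt : Integrable wt :=
  continuous_wt.integrable_of_hasCompactSupport hasCompactSupport_wt
lemma integrable_wtK : Integrable wtK :=
  continuous_wtK.integrable_of_hasCompactSupport hasCompactSupport_wtK

lemma wt_ge {r : ℝ} (hr : r < 1) {x : ℂ} (hx : ‖x‖ ≤ r) : (1 - r) ^ 2 ≤ wt x := by
  have h0 := norm_nonneg x
  have : 1 - r ≤ max 0 (1 - ‖x‖ ^ 2) := le_max_of_le_right (by nlinarith)
  unfold wt; gcongr

/-- The total mass of `wt`. -/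
def wtM : ℝ := ∫ x, wt x

lemma wtM_pos : 0 < wtM := by
  refine (integral_pos_iff_support_of_nonneg wt_nonneg integrable_wt).2 ?_
  refine lt_of_lt_of_le (measure_ball_pos volume (0:ℂ) (r := 1/2) (by norm_num)) (measure_mono ?_)
  intro x hx
  have := wt_ge (r := 1/2) (by norm_num) (x := x) (by simpa using (mem_ball_zero_iff.1 hx).le)
  simp only [Function.mem_support]; norm_num at this; linarith

lemma hasDerivAt_max_cube (t : ℝ) : HasDerivAt (fun t : ℝ => (max 0 t) ^ 3 / 6) ((max 0 t) ^ 2 / 2) t := by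
  rcases lt_trichotomy t 0 with h | h | h
  · have : (fun t : ℝ => (max 0 t) ^ 3 / 6) =ᶠ[𝓝 t] fun _ => 0 := by
      filter_upwards [Iio_mem_nhds h] with s hs
      simp [max_eq_left (show s ≤ 0 from le_of_lt hs)]
    rw [max_eq_left h.le]
    simpa using (hasDerivAt_const t (0:ℝ)).congr_of_eventuallyEq this
  · subst h
    have : (fun t : ℝ => (max 0 t) ^ 3 / 6) =O[𝓝 0] fun t => ‖t - 0‖ ^ 3 := by
      refine Asymptotics.IsBigO.of_bound 1 (Eventually.of_forall fun t => ?_)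
      have h1 : max 0 t ≤ |t| := max_le (abs_nonneg _) (le_abs_self _)
      have h2 : (max 0 t) ^ 3 ≤ |t| ^ 3 := by gcongr
      have h3 : 0 ≤ (max 0 t) ^ 3 := by positivity
      rw [Real.norm_of_nonneg (by positivity), norm_pow, norm_norm, sub_zero, Real.norm_eq_abs]
      linarith
    have := this.hasFDerivAt (𝕜 := ℝ) (by norm_num)
    simpa using this.hasDerivAt
  · have : (fun t : ℝ => (max 0 t) ^ 3 / 6) =ᶠ[𝓝 t] fun t => t ^ 3 / 6 := by
      filter_upwards [Ioi_mem_nhds h] with s hs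
      simp [max_eq_right (show 0 ≤ s from le_of_lt hs)]
    rw [max_eq_right h.le]
    refine (((hasDerivAt_pow 3 t).div_const 6).congr_of_eventuallyEq this).congr_deriv ?_
    norm_num; ring

lemma hasFDerivAt_wtK (x : ℂ) : HasFDerivAt wtK (-(wt x) • innerSL ℝ x) x := by
  have h1 : HasFDerivAt (fun x : ℂ => 1 - ‖x‖ ^ 2) (-(2 • innerSL ℝ x)) x :=
    (hasStrictFDerivAt_norm_sq x).hasFDerivAt.const_sub 1
  have h2 := (hasDerivAt_max_cube (1 - ‖x‖ ^ 2)).comp_hasFDerivAt x h1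
  refine h2.congr_fderiv ?_
  ext <;> simp [wt] <;> ring

lemma fderiv_wtK_apply (x v : ℂ) : fderiv ℝ wtK x v = -(wt x) * (x.re * v.re + x.im * v.im) := by
  rw [(hasFDerivAt_wtK x).fderiv]
  simp only [ContinuousLinearMap.smul_apply, innerSL_apply_apply, Complex.inner, smul_eq_mul]
  simp
  left; ring

lemma integral_fderiv_wt {u : ℂ → ℝ} (hu : ContDiff ℝ ∞ u) (c : ℂ) (s : ℝ) :
    ∫ x, fderiv ℝ u (c + s * x) x * wt x = s * ∫ x, lp u (c + s * x) * wtK x := by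
  have hdw (v : ℂ) : ContDiff ℝ ∞ (fun w => fderiv ℝ u w v) :=
    (hu.fderiv_right (m := ∞) (by norm_cast)).clm_apply contDiff_const
  have hg (v : ℂ) : ContDiff ℝ ∞ (fun x : ℂ => fderiv ℝ u (c + s * x) v) :=
    (hdw v).comp (contDiff_affine c s)
  have hfw (v : ℂ) : (fun x => fderiv ℝ wtK x v) = fun x => -(wt x) * (x.re * v.re + x.im * v.im) := by
    ext x; exact fderiv_wtK_apply x v
  have hcw : ∀ v : ℂ, Continuous (fun x => fderiv ℝ wtK x v) := by
    intro v; rw [hfw]; have := continuous_wt; fun_prop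
  have i1 (v : ℂ) : Integrable (fun x : ℂ => fderiv ℝ (fun x : ℂ => fderiv ℝ u (c + s * x) v) x v * wtK x) :=
    ((((hg v).continuous_fderiv (by simp)).clm_apply continuous_const).mul
      continuous_wtK).integrable_of_hasCompactSupport hasCompactSupport_wtK.mul_left
  have i2 (v : ℂ) : Integrable (fun x : ℂ => fderiv ℝ u (c + s * x) v * fderiv ℝ wtK x v) :=
    ((hg v).continuous.mul (hcw v)).integrable_of_hasCompactSupport
      (hasCompactSupport_wtK.fderiv_apply ℝ v).mul_left
  have key (v : ℂ) : ∫ x : ℂ, fderiv ℝ u (c + s * x) v * fderiv ℝ wtK x v =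
      - ∫ x : ℂ, fderiv ℝ (fun x : ℂ => fderiv ℝ u (c + s * x) v) x v * wtK x :=
    integral_mul_fderiv_eq_neg_fderiv_mul_of_integrable (i1 v) (i2 v)
      (((hg v).continuous.mul continuous_wtK).integrable_of_hasCompactSupport
        hasCompactSupport_wtK.mul_left)
      (fun x _ => (hg v).differentiable (by simp) x)
      (fun x _ => (hasFDerivAt_wtK x).differentiableAt)
  have e1 : ∀ x : ℂ, fderiv ℝ u (c + s * x) x * wt x =
      -(fderiv ℝ u (c + s * x) 1 * fderiv ℝ wtK x 1) - fderiv ℝ u (c + s * x) I * fderiv ℝ wtK x I := by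
    intro x
    have hx : x = x.re • (1 : ℂ) + x.im • I := by
      apply Complex.ext <;> simp
    have : fderiv ℝ u (c + s * x) x = x.re * fderiv ℝ u (c + s * x) 1 + x.im * fderiv ℝ u (c + s * x) I := by
      conv_lhs => enter [2]; rw [hx]
      rw [map_add, map_smul, map_smul]; simp
    rw [this, fderiv_wtK_apply, fderiv_wtK_apply]; simp; ring
  have e2 : ∀ x : ℂ, s * (lp u (c + s * x) * wtK x) =
      fderiv ℝ (fun x : ℂ => fderiv ℝ u (c + s * x) 1) x 1 * wtK x +
      fderiv ℝ (fun x : ℂ => fderiv ℝ u (c + s * x) I) x I * wtK x := by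
    intro x
    rw [fderiv_comp_affine (u := fun w => fderiv ℝ u w 1) c s x ((hdw 1).differentiable (by simp) _),
      fderiv_comp_affine (u := fun w => fderiv ℝ u w I) c s x ((hdw I).differentiable (by simp) _), lp]
    simp; ring
  rw [← integral_const_mul]
  simp only [e1, e2]
  have hh := integral_sub (i2 1).neg (i2 I)
  simp only [Pi.neg_apply] at hh
  rw [hh, integral_neg, key, key, integral_add (i1 1) (i1 I)]
  ring

/-- A mean value formula. -/
lemma mean_value {u : ℂ → ℝ} (hu : ContDiff ℝ ∞ u) (c : ℂ) {s : ℝ} (hs : 0 ≤ s) :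
    ∫ x, u (c + s * x) * wt x =
      u c * wtM + ∫ σ in (0:ℝ)..s, σ * ∫ x, lp u (c + σ * x) * wtK x := by
  have hd : Differentiable ℝ u := hu.differentiable (by simp)
  have hcf : Continuous (fderiv ℝ u) := hu.continuous_fderiv (by simp)
  have hw := continuous_wt
  have hucont := hu.continuous
  have ftc : ∀ x : ℂ, u (c + s * x) - u c = ∫ σ in (0:ℝ)..s, fderiv ℝ u (c + σ * x) x := by
    intro x
    have h1 : ∀ σ : ℝ, HasDerivAt (fun σ : ℝ => u (c + σ * x)) (fderiv ℝ u (c + σ * x) x) σ := by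
      intro σ
      have : HasDerivAt (fun σ : ℝ => c + σ * x) x σ := by
        simpa using ((Complex.ofRealCLM.hasDerivAt (x := σ)).mul_const x).const_add c
      exact (hd _).hasFDerivAt.comp_hasDerivAt σ this
    rw [intervalIntegral.integral_eq_sub_of_hasDerivAt (fun σ _ => h1 σ)
      ((by fun_prop : Continuous fun σ : ℝ => fderiv ℝ u (c + σ * x) x).intervalIntegrable _ _)]
    simp
  have hi1 : Integrable (fun x : ℂ => u (c + s * x) * wt x) :=
    (by fun_prop : Continuous fun x : ℂ => u (c + s * x) * wt x).integrable_of_hasCompactSupport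
      hasCompactSupport_wt.mul_left
  have e1 : (∫ x, u (c + s * x) * wt x) - u c * wtM =
      ∫ x : ℂ, ∫ σ in (0:ℝ)..s, fderiv ℝ u (c + σ * x) x * wt x := by
    rw [wtM, ← integral_const_mul, ← integral_sub hi1 (integrable_wt.const_mul _)]
    congr 1; ext x
    rw [intervalIntegral.integral_mul_const, ← ftc]; ring
  have e2 : ∫ x : ℂ, ∫ σ in (0:ℝ)..s, fderiv ℝ u (c + σ * x) x * wt x =
      ∫ σ in (0:ℝ)..s, ∫ x : ℂ, fderiv ℝ u (c + σ * x) x * wt x := by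
    have r1 : ∀ F : ℂ → ℝ, (∀ x : ℂ, x ∉ closedBall (0:ℂ) 1 → F x = 0) →
        ∫ x, F x = ∫ x in closedBall (0:ℂ) 1, F x := fun F hF =>
      (setIntegral_eq_integral_of_forall_compl_eq_zero hF).symm
    have hz : ∀ x : ℂ, x ∉ closedBall (0:ℂ) 1 → wt x = 0 := fun x hx =>
      wt_eq_zero (by simp at hx; exact hx.le)
    rw [r1 _ (fun x hx => by simp [hz x hx])]
    simp only [intervalIntegral.integral_of_le hs]
    have r2 : ∀ σ : ℝ, ∫ x : ℂ, fderiv ℝ u (c + σ * x) x * wt x =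
        ∫ x in closedBall (0:ℂ) 1, fderiv ℝ u (c + σ * x) x * wt x := fun σ =>
      r1 _ (fun x hx => by simp [hz x hx])
    simp only [r2]
    rw [integral_integral_swap]
    rw [Measure.prod_restrict]
    refine IntegrableOn.mono_set (t := closedBall (0:ℂ) 1 ×ˢ Icc (0:ℝ) s) ?_
      (prod_mono subset_rfl Ioc_subset_Icc_self)
    refine ContinuousOn.integrableOn_compact ((isCompact_closedBall _ _).prod isCompact_Icc) ?_
    refine Continuous.continuousOn ?_
    unfold Function.uncurry
    fun_prop
  rw [e2] at e1
  rw [← sub_eq_iff_eq_add', e1]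
  congr 1; ext σ
  exact integral_fderiv_wt hu c σ

/-- Second derivative test in one variable. -/
lemma deriv_deriv_nonneg_of_isLocalMin {g g' : ℝ → ℝ} {g'' : ℝ} {a : ℝ}
    (hg : ∀ t, HasDerivAt g (g' t) t) (hg' : HasDerivAt g' g'' a) (hm : IsLocalMin g a) :
    0 ≤ g'' := by
  by_contra hneg
  push Not at hneg
  have h0 : g' a = 0 := hm.hasDerivAt_eq_zero (hg a)
  have hs := hasDerivAt_iff_tendsto_slope.1 hg'
  have h1 : ∀ᶠ t in 𝓝[≠] a, slope g' a t < 0 := hs.eventually (gt_mem_nhds hneg)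
  have h2 : ∀ᶠ t in 𝓝[>] a, slope g' a t < 0 := h1.filter_mono (nhdsWithin_mono a (fun x hx => ne_of_gt hx))
  have h3 : ∀ᶠ t in 𝓝[>] a, g a ≤ g t := (hm.filter_mono nhdsWithin_le_nhds)
  obtain ⟨b, hb, hb2⟩ := (mem_nhdsGT_iff_exists_Ioo_subset).1 h2
  obtain ⟨c, hc, hc2⟩ := (mem_nhdsGT_iff_exists_Ioo_subset).1 h3
  have hab : a < min b c := lt_min hb hc
  set d := (a + min b c) / 2 with hd
  have had : a < d := by rw [hd]; linarith
  have hdb : d < min b c := by rw [hd]; linarith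
  obtain ⟨x, hx, hx2⟩ := exists_hasDerivAt_eq_slope g g' had
    (fun t _ => (hg t).continuousAt.continuousWithinAt) (fun t _ => hg t)
  have hxs : slope g' a x < 0 := hb2 ⟨hx.1, lt_trans hx.2 (lt_of_lt_of_le hdb (min_le_left _ _))⟩
  rw [slope_def_field, h0, sub_zero] at hxs
  have hxn : g' x < 0 := by
    have : 0 < x - a := sub_pos.2 hx.1
    rcases div_neg_iff.1 hxs with h | h
    · linarith
    · exact h.1
  have hgd : g a ≤ g d := hc2 ⟨had, lt_of_lt_of_le hdb (min_le_right _ _)⟩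
  rw [hx2] at hxn
  have : 0 ≤ (g d - g a) / (d - a) := div_nonneg (by linarith) (by linarith)
  linarith

lemma hasDerivAt_line (z v : ℂ) (t : ℝ) : HasDerivAt (fun t : ℝ => z + t • v) v t := by
  simpa using ((hasDerivAt_id t).smul_const v).const_add z

lemma fderiv_fderiv_nonneg_of_isLocalMin {u : ℂ → ℝ} (hu : ContDiff ℝ ∞ u) {z : ℂ}
    (hm : IsLocalMin u z) (v : ℂ) : 0 ≤ fderiv ℝ (fun w => fderiv ℝ u w v) z v := by
  have hdw : ContDiff ℝ ∞ (fun w => fderiv ℝ u w v) :=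
    (hu.fderiv_right (m := ∞) (by norm_cast)).clm_apply contDiff_const
  refine deriv_deriv_nonneg_of_isLocalMin (a := 0) (g := fun t : ℝ => u (z + t • v))
    (g' := fun t : ℝ => fderiv ℝ u (z + t • v) v) (fun t => ?_) ?_ ?_
  · exact (hu.differentiable (by simp) _).hasFDerivAt.comp_hasDerivAt t (hasDerivAt_line z v t)
  · have := (hdw.differentiable (by simp) (z + (0:ℝ) • v)).hasFDerivAt.comp_hasDerivAt 0 (hasDerivAt_line z v 0)
    simpa [Function.comp_def] using this
  · have hc : ContinuousAt (fun t : ℝ => z + t • v) 0 := (hasDerivAt_line z v 0).continuousAt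
    have := hc.tendsto
    simp only [zero_smul, add_zero] at this
    have := this.eventually hm
    simpa [IsLocalMin, IsMinFilter] using this

/-- Second derivative test: the Laplacian is nonnegative at a local minimum. -/
lemma lp_nonneg_of_isLocalMin {u : ℂ → ℝ} (hu : ContDiff ℝ ∞ u) {z : ℂ}
    (hm : IsLocalMin u z) : 0 ≤ lp u z :=
  add_nonneg (fderiv_fderiv_nonneg_of_isLocalMin hu hm 1) (fderiv_fderiv_nonneg_of_isLocalMin hu hm I)

lemma integral_wtK_le : ∫ x, wtK x ≤ 4 := by
  have h : ∫ x, wtK x = ∫ x in closedBall (0:ℂ) 1, wtK x :=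
    (setIntegral_eq_integral_of_forall_compl_eq_zero fun x hx =>
      wtK_eq_zero (by simp at hx; exact hx.le)).symm
  rw [h]
  have h2 : ∫ x in closedBall (0:ℂ) 1, wtK x ≤ ∫ x in closedBall (0:ℂ) 1, (1:ℝ) :=
    integral_mono integrable_wtK.integrableOn
      (integrableOn_const (by simp) (by simp)) wtK_le_one
  refine h2.trans ?_
  simp [Measure.real]
  exact Real.pi_le_four

lemma integrable_mul_wt {g : ℂ → ℝ} (hg : Continuous g) : Integrable fun x => g x * wt x :=
  (hg.mul continuous_wt).integrable_of_hasCompactSupport hasCompactSupport_wt.mul_left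

lemma mean_value_abs {u : ℂ → ℝ} (hu : ContDiff ℝ ∞ u) (c : ℂ) {s B : ℝ} (hs : 0 ≤ s)
    (hB : ∀ y ∈ ball c s, |lp u y| ≤ B) :
    |(∫ x : ℂ, u (c + s * x) * wt x) - u c * wtM| ≤ 4 * B * s ^ 2 := by
  rcases hs.eq_or_lt with rfl | hs
  · simp [integral_const_mul, wtM]
  have hB0 : 0 ≤ B := (abs_nonneg _).trans (hB c (mem_ball_self hs))
  rw [mean_value hu c hs.le, add_sub_cancel_left, ← Real.norm_eq_abs]
  have hin : ∀ σ ∈ Ioc 0 s, ‖σ * ∫ x : ℂ, lp u (c + σ * x) * wtK x‖ ≤ 4 * B * s := by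
    intro σ hσ
    have h1 : ‖∫ x : ℂ, lp u (c + σ * x) * wtK x‖ ≤ B * 4 := by
      have h2 : ‖∫ x : ℂ, lp u (c + σ * x) * wtK x‖ ≤ ∫ x : ℂ, B * wtK x := by
        refine norm_integral_le_of_norm_le (integrable_wtK.const_mul B) (Eventually.of_forall fun x => ?_)
        rw [norm_mul, Real.norm_eq_abs, Real.norm_of_nonneg (wtK_nonneg x)]
        by_cases hx : ‖x‖ < 1
        · refine mul_le_mul_of_nonneg_right (hB _ ?_) (wtK_nonneg x)
          simp [abs_of_pos hσ.1]
          nlinarith [hσ.1, hσ.2, norm_nonneg x]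
        · simp [wtK_eq_zero (not_lt.1 hx)]
      refine h2.trans ?_
      rw [integral_const_mul]
      exact mul_le_mul_of_nonneg_left integral_wtK_le hB0
    rw [norm_mul, Real.norm_of_nonneg hσ.1.le]
    nlinarith [hσ.1, hσ.2, norm_nonneg (∫ x : ℂ, lp u (c + σ * x) * wtK x)]
  have := intervalIntegral.norm_integral_le_of_norm_le_const (a := 0) (b := s) (C := 4 * B * s)
    (f := fun σ => σ * ∫ x : ℂ, lp u (c + σ * x) * wtK x) (by rwa [uIoc_of_le hs.le])
  rw [sub_zero, abs_of_pos hs] at this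
  linarith [this]

lemma integral_ball_half_le {g : ℂ → ℝ} (hg : Continuous g) (h0 : ∀ x ∈ ball (0:ℂ) 1, 0 ≤ g x) :
    ∫ x in ball (0:ℂ) (1/2), |g x| ≤ 4 * ∫ x, g x * wt x := by
  have hnn : ∀ x, 0 ≤ g x * wt x := by
    intro x
    by_cases hx : ‖x‖ < 1
    · exact mul_nonneg (h0 x (by simpa using hx)) (wt_nonneg x)
    · simp [wt_eq_zero (not_lt.1 hx)]
  rw [← integral_const_mul]
  have hi := (integrable_mul_wt hg).const_mul 4
  refine le_trans ?_ (setIntegral_le_integral (s := ball (0:ℂ) (1/2)) hi (Eventually.of_forall fun x =>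
    mul_nonneg (by norm_num) (hnn x)))
  refine setIntegral_mono_on ?_ hi.integrableOn measurableSet_ball ?_
  · exact (hg.abs.continuousOn.integrableOn_compact (isCompact_closedBall (0:ℂ) (1/2))).mono_set
      ball_subset_closedBall
  · intro x hx
    have hx' := mem_ball_zero_iff.1 hx
    have h1 := wt_ge (r := 1/2) (by norm_num) hx'.le
    have h2 := h0 x (by simp; linarith)
    rw [abs_of_nonneg h2]
    nlinarith

/-- Gradient bound for positive functions. -/
lemma norm_dr_le_of_pos : ∃ C > 0, ∃ δ₁ > 0, ∀ (v : ℂ → ℝ) (z : ℂ), ContDiff ℝ ∞ v →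
    (∀ y ∈ closedBall z 1, 0 < v y) → (∀ y ∈ closedBall z 1, |lp v y| ≤ δ₁ * v y) →
    ‖dr v z‖ ≤ C * v z := by
  obtain ⟨C1, hC1, hgrad⟩ := norm_dr_le_of_bound
  set t := C1 * (4 * wtM + 1) with ht
  have htpos : 0 < t := by have := wtM_pos; positivity
  refine ⟨2 * t, by positivity, Real.exp (-(4 * t)) / 20, by positivity, fun v z hv hpos hlap => ?_⟩
  have hcd : Continuous (dr v) := (contDiff_dr hv).continuous
  have hvc := hv.continuous
  have hcont : ContinuousOn (fun y => (1 - ‖y - z‖) * (‖dr v y‖ / v y)) (closedBall z 1) := by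
    refine ContinuousOn.mul (by fun_prop) (ContinuousOn.div (by fun_prop) (by fun_prop) ?_)
    exact fun y hy => (hpos y hy).ne'
  obtain ⟨y0, hy0, hmax⟩ := (isCompact_closedBall z 1).exists_isMaxOn ⟨z, by simp⟩ hcont
  have hv0 := hpos y0 hy0
  set N := ‖dr v y0‖ / v y0 with hN
  set d := 1 - ‖y0 - z‖ with hd
  by_cases hG : d * N ≤ 2 * t
  · have := hmax (mem_closedBall_self (x := z) zero_le_one)
    simp only [mem_setOf_eq, sub_self, norm_zero, sub_zero, one_mul] at this
    have h2 := this.trans hG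
    rwa [div_le_iff₀ (hpos z (by simp))] at h2
  exfalso
  push Not at hG
  have hd0 : 0 ≤ d := by rw [mem_closedBall, dist_eq_norm] at hy0; linarith
  have hd1 : d ≤ 1 := by linarith [norm_nonneg (y0 - z)]
  have hN0 : 0 < N := by
    by_contra h
    nlinarith
  set s := t / N with hs
  have hs0 : 0 < s := by positivity
  have hsd : s ≤ d / 2 := by rw [hs, div_le_iff₀ hN0]; linarith
  have hsub : closedBall y0 s ⊆ closedBall z 1 := by
    refine closedBall_subset_closedBall' ?_
    rw [dist_eq_norm]; linarith
  have hratio : ∀ y ∈ closedBall y0 s, ‖dr v y‖ ≤ 2 * N * v y := by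
    intro y hy
    have h1 := hmax (hsub hy)
    simp only [mem_setOf_eq] at h1
    have h2 : d / 2 ≤ 1 - ‖y - z‖ := by
      have : ‖y - z‖ ≤ ‖y - y0‖ + ‖y0 - z‖ := by
        simpa using norm_add_le (y - y0) (y0 - z)
      rw [mem_closedBall, dist_eq_norm] at hy
      linarith
    have h3 : 0 ≤ ‖dr v y‖ / v y := div_nonneg (norm_nonneg _) (hpos y (hsub hy)).le
    have hdpos : 0 < d := by by_contra h; nlinarith
    have h4 : d / 2 * (‖dr v y‖ / v y) ≤ d * N := (mul_le_mul_of_nonneg_right h2 h3).trans h1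
    have h5 : ‖dr v y‖ / v y ≤ 2 * N := by
      by_contra hc
      push Not at hc
      nlinarith
    rwa [div_le_iff₀ (hpos y (hsub hy))] at h5
  have hlog : ∀ y ∈ closedBall y0 s, v y ≤ Real.exp (4 * t) * v y0 := by
    intro y hy
    have hder : ∀ x ∈ closedBall y0 s, HasFDerivWithinAt (fun x => Real.log (v x))
        ((v x)⁻¹ • fderiv ℝ v x) (closedBall y0 s) x := fun x hx =>
      ((hv.differentiable (by simp) x).hasFDerivAt.log (hpos x (hsub hx)).ne').hasFDerivWithinAt
    have hbd : ∀ x ∈ closedBall y0 s, ‖(v x)⁻¹ • fderiv ℝ v x‖ ≤ 4 * N := by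
      intro x hx
      have hvx := hpos x (hsub hx)
      rw [norm_smul, norm_inv, Real.norm_of_nonneg hvx.le, inv_mul_le_iff₀ hvx]
      refine ContinuousLinearMap.opNorm_le_bound _ (by positivity) fun w => ?_
      have h1 := abs_fderiv_le (hv.differentiable (by simp) x) w
      have h2 := hratio x hx
      rw [Real.norm_eq_abs]
      nlinarith [norm_nonneg w]
    have := (convex_closedBall y0 s).norm_image_sub_le_of_norm_hasFDerivWithin_le hder hbd
      (mem_closedBall_self hs0.le) hy
    rw [mem_closedBall, dist_eq_norm] at hy
    have h6 : Real.log (v y) - Real.log (v y0) ≤ 4 * t := by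
      refine (le_abs_self _).trans (this.trans ?_)
      calc 4 * N * ‖y - y0‖ ≤ 4 * N * s := by gcongr
        _ = 4 * t := by rw [hs]; field_simp
    rw [← Real.exp_log (hpos y (hsub (by rwa [mem_closedBall, dist_eq_norm]))), ← Real.exp_log hv0,
      ← Real.exp_add, Real.exp_le_exp]
    linarith
  set w : ℂ → ℝ := fun x => v (y0 + s * x) with hw
  have hwc : ContDiff ℝ ∞ w := hv.comp (contDiff_affine y0 s)
  have hmem : ∀ x ∈ ball (0:ℂ) 1, y0 + s * x ∈ closedBall y0 s := by
    intro x hx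
    have := mem_ball_zero_iff.1 hx
    simp [abs_of_pos hs0]
    nlinarith
  have hlpv : ∀ y ∈ closedBall y0 s, |lp v y| ≤ v y0 / 20 := by
    intro y hy
    refine (hlap y (hsub hy)).trans ?_
    have := hlog y hy
    calc Real.exp (-(4 * t)) / 20 * v y ≤ Real.exp (-(4 * t)) / 20 * (Real.exp (4 * t) * v y0) := by gcongr
      _ = (Real.exp (-(4 * t)) * Real.exp (4 * t)) * v y0 / 20 := by ring
      _ = v y0 / 20 := by rw [← Real.exp_add]; simp
  have hs1 : s ^ 2 ≤ 1 / 4 := by nlinarith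
  have g1 := hgrad w (v y0 / 20) hwc (by positivity) (fun x hx => by
    rw [hw, lp_comp_affine hv, abs_mul, abs_of_nonneg (by positivity)]
    have hm := hmem x (ball_subset_ball (by norm_num) hx)
    have := hlpv _ hm
    nlinarith [abs_nonneg (lp v (y0 + s * x))])
  have g2 := integral_ball_half_le hwc.continuous (fun x hx => (hpos _ (hsub (hmem x hx))).le)
  have g3 := mean_value_abs hv y0 hs0.le (fun y hy => hlpv y (ball_subset_closedBall hy))
  have g4 := (abs_le.1 g3).2
  have g5 : dr w 0 = s * dr v y0 := by
    rw [hw, dr_comp_affine hv]; simp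
  have g6 : ‖dr w 0‖ = t * v y0 := by
    rw [g5, norm_mul, Complex.norm_real, Real.norm_of_nonneg hs0.le, hs]
    have hNv : ‖dr v y0‖ = N * v y0 := by rw [hN]; field_simp
    rw [hNv]; field_simp
  rw [g6] at g1
  have g7 : (∫ x in ball (0:ℂ) (1/2), |w x|) + v y0 / 20 ≤ (4 * wtM + 1/2) * v y0 := by
    have : 4 * (v y0 / 20) * s ^ 2 ≤ v y0 / 20 := by nlinarith
    nlinarith
  have g8 := g1.trans (mul_le_mul_of_nonneg_left g7 hC1.le)
  rw [ht] at g8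
  nlinarith [mul_pos hC1 hv0]

/-- A smooth mollifier supported in the disc of radius `η`. -/
structure Moll (η : ℝ) (ρ : ℂ → ℝ) : Prop where
  smooth : ContDiff ℝ ∞ ρ
  nonneg : ∀ x, 0 ≤ ρ x
  int : ∫ x, ρ x = 1
  zero : ∀ x, η ≤ ‖x‖ → ρ x = 0
  pos : ∀ x, ‖x‖ < η → 0 < ρ x

lemma exists_moll {η : ℝ} (hη : 0 < η) : ∃ ρ, Moll η ρ := by
  let b : ContDiffBump (0:ℂ) := ⟨η / 2, η, by positivity, by linarith⟩
  have hsupp : Function.support (b.normed volume) = ball 0 η := b.support_normed_eq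
  refine ⟨b.normed volume, b.contDiff_normed, b.nonneg_normed, b.integral_normed, fun x hx => ?_, fun x hx => ?_⟩
  · by_contra h
    have : x ∈ Function.support (b.normed volume) := h
    rw [hsupp, mem_ball_zero_iff] at this
    linarith
  · have : x ∈ Function.support (b.normed volume) := by rw [hsupp]; simpa using hx
    exact lt_of_le_of_ne (b.nonneg_normed x) (Ne.symm this)

namespace Moll
variable {η : ℝ} {ρ : ℂ → ℝ} (h : Moll η ρ)
include h

lemma hasCompactSupport : HasCompactSupport ρ :=
  HasCompactSupport.intro (isCompact_closedBall (0:ℂ) η) fun x hx => h.zero x (by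
    simp at hx; exact hx.le)

lemma integrable : Integrable ρ :=
  h.smooth.continuous.integrable_of_hasCompactSupport h.hasCompactSupport

lemma int_sub (x : ℂ) : ∫ t, ρ (x - t) = 1 := by
  rw [integral_sub_left_eq_self]; exact h.int

lemma zero_sub {x t : ℂ} (ht : t ∉ ball x η) : ρ (x - t) = 0 := by
  refine h.zero _ ?_
  rw [mem_ball, dist_comm, dist_eq_norm] at ht
  linarith

lemma cv_const (c : ℝ) (x : ℂ) : cv (fun _ => c) ρ x = c := by
  rw [cv, integral_const_mul, h.int_sub, mul_one]

lemma cv_mono {f g : ℂ → ℝ} (hf : LocallyIntegrable f) (hg : LocallyIntegrable g) {x : ℂ}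
    (hfg : ∀ t ∈ ball x η, f t ≤ g t) : cv f ρ x ≤ cv g ρ x := by
  refine integral_mono (integrable_cv hf h.smooth.continuous h.hasCompactSupport x)
    (integrable_cv hg h.smooth.continuous h.hasCompactSupport x) fun t => ?_
  by_cases ht : t ∈ ball x η
  · exact mul_le_mul_of_nonneg_right (hfg t ht) (h.nonneg _)
  · simp [h.zero_sub ht]

lemma abs_cv_le {f g : ℂ → ℝ} (hf : LocallyIntegrable f) (hg : LocallyIntegrable g) {x : ℂ}
    (hfg : ∀ t ∈ ball x η, |f t| ≤ g t) : |cv f ρ x| ≤ cv g ρ x := by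
  rw [abs_le]
  constructor
  · have h1 := h.cv_mono hg.neg hf (x := x) (fun t ht => by
      have := abs_le.1 (hfg t ht); simp; linarith)
    have h2 : cv (-g) ρ x = - cv g ρ x := by simp [cv, integral_neg]
    rwa [h2] at h1
  · exact h.cv_mono hf hg (fun t ht => (le_abs_self _).trans (hfg t ht))

lemma cv_pos {f : ℂ → ℝ} (hf : LocallyIntegrable f) {x : ℂ} (hη : 0 < η)
    (hfp : ∀ t ∈ ball x η, 0 < f t) : 0 < cv f ρ x := by
  have hnn : ∀ t, 0 ≤ f t * ρ (x - t) := fun t => by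
    by_cases ht : t ∈ ball x η
    · exact mul_nonneg (hfp t ht).le (h.nonneg _)
    · simp [h.zero_sub ht]
  refine (integral_pos_iff_support_of_nonneg hnn
    (integrable_cv hf h.smooth.continuous h.hasCompactSupport x)).2 ?_
  refine lt_of_lt_of_le (measure_ball_pos volume x hη) (measure_mono fun t ht => ?_)
  refine (mul_pos (hfp t ht) (h.pos _ ?_)).ne'
  rwa [mem_ball, dist_comm, dist_eq_norm] at ht

end Moll

lemma locallyIntegrable_of_bdd {f : ℂ → ℝ} (hf : Measurable f) {c : ℝ} (hc : ∀ x, |f x| ≤ c) :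
    LocallyIntegrable f := by
  refine (locallyIntegrable_const c).mono hf.aestronglyMeasurable (Eventually.of_forall fun x => ?_)
  rw [Real.norm_eq_abs, Real.norm_eq_abs]
  exact (hc x).trans (le_abs_self c)

lemma lp_cv {f g : ℂ → ℝ} (hf : LocallyIntegrable f) (hg : ContDiff ℝ ∞ g) (hc : HasCompactSupport g)
    (x : ℂ) : lp (cv f g) x = cv f (lp g) x := by
  have hd (v : ℂ) : ContDiff ℝ ∞ (fun w => fderiv ℝ g w v) :=
    (hg.fderiv_right (m := ∞) (by norm_cast)).clm_apply contDiff_const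
  have hdc (v : ℂ) : HasCompactSupport (fun w => fderiv ℝ g w v) := hc.fderiv_apply ℝ v
  have h1 (v : ℂ) : fderiv ℝ (fun w => fderiv ℝ (cv f g) w v) x v =
      cv f (fun w => fderiv ℝ (fun w => fderiv ℝ g w v) w v) x := by
    have : (fun w => fderiv ℝ (cv f g) w v) = cv f (fun w => fderiv ℝ g w v) := by
      ext w; exact fderiv_cv hf hg hc w v
    rw [this, fderiv_cv hf (hd v) (hdc v)]
  have i (v : ℂ) := integrable_cv (g := fun w => fderiv ℝ (fun w => fderiv ℝ g w v) w v) hf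
    (((hd v).continuous_fderiv (by simp)).clm_apply continuous_const) ((hdc v).fderiv_apply ℝ v) x
  unfold lp
  rw [h1, h1]
  simp only [cv]
  rw [← integral_add (i 1) (i I)]
  simp only [mul_add]

/-- A bounded continuous weak solution of `Δ U + W U = 0` on a large disc, with small potential. -/
structure Sol (L δ : ℝ) (U W : ℂ → ℝ) : Prop where
  measU : Measurable U
  measW : Measurable W
  hU : ∀ z, |U z| ≤ 1
  hW : ∀ z, |W z| ≤ δ
  cont : ContinuousOn U (ball 0 (3 / 2 * L))
  weak : ∀ h : ℂ → ℝ, ContDiff ℝ ∞ h → HasCompactSupport h → tsupport h ⊆ ball 0 (3 / 2 * L) →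
    (∫ x, U x * lp h x) + (∫ x, W x * U x * h x) = 0

lemma Sol.lp_cv {L δ η : ℝ} {U W ρ : ℂ → ℝ} (hs : Sol L δ U W) (hm : Moll η ρ) {x : ℂ}
    (hx : ‖x‖ + η < 3 / 2 * L) : lp (cv U ρ) x = - cv (fun t => W t * U t) ρ x := by
  rw [Landis.lp_cv (locallyIntegrable_of_bdd hs.measU hs.hU) hm.smooth hm.hasCompactSupport]
  have e : (fun t : ℂ => ρ (x - t)) = fun t : ℂ => ρ (x + ((-1 : ℝ) : ℂ) * t) := by
    ext t; congr 1; simp; ring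
  have hz : ∀ t ∉ closedBall x η, ρ (x - t) = 0 := fun t ht => hm.zero_sub (fun h => ht (ball_subset_closedBall h))
  have := hs.weak (fun t => ρ (x - t)) (hm.smooth.comp (contDiff_const.sub contDiff_id))
    (HasCompactSupport.intro (isCompact_closedBall x η) hz) ?_
  · have e2 : ∀ t, lp (fun t : ℂ => ρ (x - t)) t = lp ρ (x - t) := by
      intro t; rw [e, lp_comp_affine hm.smooth]
      simp [sub_eq_add_neg]
    simp only [e2] at this
    unfold cv
    linarith
  · refine (closure_minimal (fun t ht => ?_) isClosed_closedBall).trans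
      (closedBall_subset_ball' (x := x) (ε₁ := η) (by simpa [add_comm] using hx))
    by_contra h
    exact ht (hz t h)

/-- A smooth approximation of a solution. -/
structure Approx (L δ θ : ℝ) (U u w : ℂ → ℝ) : Prop where
  smooth : ContDiff ℝ ∞ u
  smooth_w : ContDiff ℝ ∞ w
  hw : ∀ z, |w z| ≤ δ
  le_one : ∀ z, |u z| ≤ 1
  close : ∀ z ∈ ball (0:ℂ) (29 / 20 * L), |u z - U z| ≤ θ
  eq : ∀ z ∈ ball (0:ℂ) (29 / 20 * L), |lp u z + w z * u z| ≤ θ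
  bd : ∀ z ∈ ball (0:ℂ) (29 / 20 * L), ∀ a, (∀ y ∈ ball z θ, |U y| ≤ a) → |u z| ≤ a ∧ |lp u z| ≤ δ * a
  pos : ∀ z ∈ ball (0:ℂ) (29 / 20 * L), (∀ y ∈ ball z θ, 0 < U y) → 0 < u z ∧ |lp u z| ≤ δ * u z
  neg : ∀ z ∈ ball (0:ℂ) (29 / 20 * L), (∀ y ∈ ball z θ, U y < 0) → u z < 0 ∧ |lp u z| ≤ δ * (-u z)

lemma Sol.delta_nonneg {L δ : ℝ} {U W : ℂ → ℝ} (hs : Sol L δ U W) : 0 ≤ δ :=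
  (abs_nonneg _).trans (hs.hW 0)

set_option maxHeartbeats 1000000 in
lemma Sol.exists_approx {L δ θ : ℝ} {U W : ℂ → ℝ} (hs : Sol L δ U W) (hL : 80 ≤ L) (hθ : 0 < θ) :
    ∃ u w, Approx L δ θ U u w := by
  have hδ := hs.delta_nonneg
  set θ' := θ / (2 * (1 + δ)) with hθ'
  have hθ'0 : 0 < θ' := by positivity
  have hθ'1 : θ' * (2 * (1 + δ)) = θ := by rw [hθ']; field_simp
  have huc := (isCompact_closedBall (0:ℂ) (59 / 40 * L)).uniformContinuousOn_of_continuous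
    (hs.cont.mono (closedBall_subset_ball (by linarith)))
  obtain ⟨η0, hη0, hη⟩ := Metric.uniformContinuousOn_iff.1 huc θ' hθ'0
  set η := min (min η0 θ) 1 with hηd
  have hηpos : 0 < η := by positivity
  have hη1 : η ≤ 1 := min_le_right _ _
  have hηθ : η ≤ θ := (min_le_left _ _).trans (min_le_right _ _)
  have hηη : η ≤ η0 := (min_le_left _ _).trans (min_le_left _ _)
  obtain ⟨ρ, hm⟩ := exists_moll hηpos
  have lU := locallyIntegrable_of_bdd hs.measU hs.hU
  have lW := locallyIntegrable_of_bdd hs.measW hs.hW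
  have bWU : ∀ z, |W z * U z| ≤ δ := fun z => by
    rw [abs_mul]; nlinarith [hs.hU z, hs.hW z, abs_nonneg (U z), abs_nonneg (W z)]
  have lWU : LocallyIntegrable (fun z => W z * U z) :=
    locallyIntegrable_of_bdd (hs.measW.mul hs.measU) bWU
  have lc (c : ℝ) : LocallyIntegrable (fun _ : ℂ => c) := locallyIntegrable_const c
  have hlp : ∀ z ∈ ball (0:ℂ) (29 / 20 * L), lp (cv U ρ) z = - cv (fun t => W t * U t) ρ z := by
    intro z hz
    rw [mem_ball_zero_iff] at hz
    exact hs.lp_cv hm (by linarith)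
  have hosc : ∀ z ∈ ball (0:ℂ) (29 / 20 * L), ∀ t ∈ ball z η, |U t - U z| ≤ θ' := by
    intro z hz t ht
    rw [mem_ball_zero_iff] at hz
    have h1 : ‖t‖ ≤ ‖t - z‖ + ‖z‖ := by simpa using norm_add_le (t - z) z
    have ht' := ht
    rw [mem_ball, dist_eq_norm] at ht'
    have h2 : ‖t‖ ≤ 59 / 40 * L := by linarith
    have h3 : ‖z‖ ≤ 59 / 40 * L := by linarith
    have h4 : ‖t - z‖ < η0 := by linarith
    have h5 := hη t (mem_closedBall_zero_iff.2 h2) z (mem_closedBall_zero_iff.2 h3) ((dist_eq_norm t z).trans_lt h4)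
    exact ((Real.dist_eq _ _).symm.trans_lt h5).le
  have icv {f : ℂ → ℝ} (hf : LocallyIntegrable f) (x : ℂ) : Integrable (fun t => f t * ρ (x - t)) :=
    integrable_cv (𝕜 := ℝ) hf hm.smooth.continuous hm.hasCompactSupport x
  have hclose : ∀ z ∈ ball (0:ℂ) (29 / 20 * L), |cv U ρ z - U z| ≤ θ' := by
    intro z hz
    have e : cv U ρ z - U z = cv (fun t => U t - U z) ρ z := by
      have : cv (fun t => U t - U z) ρ z = cv U ρ z - cv (fun _ => U z) ρ z := by
        unfold cv
        rw [← integral_sub (icv lU z) (icv (lc _) z)]; simp only [sub_mul]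
      rw [this, hm.cv_const]
    rw [e]
    have := hm.abs_cv_le (lU.sub (lc (U z))) (lc θ') (x := z) (hosc z hz)
    rwa [hm.cv_const] at this
  have hsign : ∀ z ∈ ball (0:ℂ) (29 / 20 * L), ∀ G : ℂ → ℝ, LocallyIntegrable G →
      (∀ y ∈ ball z θ, |U y| ≤ G y) → |lp (cv U ρ) z| ≤ cv (fun t => δ * G t) ρ z := by
    intro z hz G hG hUG
    rw [hlp z hz, abs_neg]
    have hG' : LocallyIntegrable (fun t => δ * G t) := hG.smul δ
    refine hm.abs_cv_le lWU hG' (fun t ht => ?_)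
    show |W t * U t| ≤ δ * G t
    rw [abs_mul]
    exact mul_le_mul (hs.hW t) (hUG t (ball_subset_ball hηθ ht)) (abs_nonneg _) hδ
  have cvmul (G : ℂ → ℝ) (c : ℝ) (z : ℂ) : cv (fun t => c * G t) ρ z = c * cv G ρ z := by
    unfold cv; rw [← integral_const_mul]; simp only [mul_assoc]
  have s1 : ContDiff ℝ ∞ (cv U ρ) := contDiff_cv (𝕜 := ℝ) lU hm.smooth hm.hasCompactSupport
  have s2 : ContDiff ℝ ∞ (cv W ρ) := contDiff_cv (𝕜 := ℝ) lW hm.smooth hm.hasCompactSupport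
  refine ⟨cv U ρ, cv W ρ, ?_⟩
  refine Approx.mk s1 s2 ?_ ?_ ?_ ?_ ?_ ?_ ?_
  · intro z
    have := hm.abs_cv_le lW (lc δ) (x := z) (fun t _ => hs.hW t)
    rwa [hm.cv_const] at this
  · intro z
    have := hm.abs_cv_le lU (lc 1) (x := z) (fun t _ => hs.hU t)
    rwa [hm.cv_const] at this
  · intro z hz
    refine (hclose z hz).trans ?_
    linarith [mul_nonneg hθ'0.le hδ]
  · intro z hz
    have e : lp (cv U ρ) z + cv W ρ z * cv U ρ z = cv (fun t => W t * (cv U ρ z - U t)) ρ z := by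
      have h1 : cv (fun t => W t * (cv U ρ z - U t)) ρ z =
          cv U ρ z * cv W ρ z - cv (fun t => W t * U t) ρ z := by
        rw [← cvmul]
        simp only [cv]
        have h5 := icv (f := fun t => cv U ρ z * W t) (lW.smul (cv U ρ z)) z
        simp only [cv] at h5
        rw [← integral_sub h5 (icv lWU z)]
        congr 1; ext t; ring
      rw [h1, hlp z hz]; ring
    rw [e]
    have hb := fun t => hs.hW t
    have l3 : LocallyIntegrable (fun t => W t * (cv U ρ z - U t)) := by
      have := (lW.smul (cv U ρ z)).sub lWU
      convert this using 1
      ext t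
      simp; ring
    have := hm.abs_cv_le l3 (lc (δ * (2 * θ'))) (x := z) (fun t ht => by
      rw [abs_mul]
      refine mul_le_mul (hs.hW t) ?_ (abs_nonneg _) hδ
      have h1 := hclose z hz
      have h2 := hosc z hz t ht
      rw [abs_le] at h1 h2 ⊢
      constructor <;> linarith)
    rw [hm.cv_const] at this
    linarith
  · intro z hz a ha
    have h1 := hm.abs_cv_le lU (lc a) (x := z) (fun t ht => ha t (ball_subset_ball hηθ ht))
    have h2 := hsign z hz (fun _ => a) (lc a) ha
    rw [hm.cv_const] at h1 h2
    exact ⟨h1, h2⟩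
  · intro z hz hp
    have h1 := hm.cv_pos lU (x := z) hηpos (fun t ht => hp t (ball_subset_ball hηθ ht))
    have h2 := hsign z hz U lU (fun t ht => (abs_of_pos (hp t ht)).le)
    rw [cvmul] at h2
    exact ⟨h1, h2⟩
  · intro z hz hp
    have h1 := hm.cv_pos lU.neg (x := z) hηpos (fun t ht => by
      simpa using hp t (ball_subset_ball hηθ ht))
    have h2 := hsign z hz (-U) lU.neg (fun t ht => (abs_of_neg (hp t ht)).le)
    rw [cvmul] at h2
    have h3 : cv (-U) ρ z = - cv U ρ z := by simp [cv, integral_neg]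
    rw [h3] at h1 h2
    exact ⟨by linarith, h2⟩

lemma lp_add {u v : ℂ → ℝ} (hu : ContDiff ℝ ∞ u) (hv : ContDiff ℝ ∞ v) (z : ℂ) :
    lp (fun x => u x + v x) z = lp u z + lp v z := by
  have hd {u : ℂ → ℝ} (hu : ContDiff ℝ ∞ u) (v : ℂ) : Differentiable ℝ (fun w => fderiv ℝ u w v) :=
    ((hu.fderiv_right (m := ∞) (by norm_cast)).clm_apply contDiff_const).differentiable (by simp)
  have h1 (d : ℂ) : (fun w => fderiv ℝ (fun x => u x + v x) w d) =
      fun w => fderiv ℝ u w d + fderiv ℝ v w d := by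
    ext w
    rw [fderiv_fun_add (hu.differentiable (by simp) w) (hv.differentiable (by simp) w)]; rfl
  unfold lp
  rw [h1, h1, fderiv_fun_add (hd hu 1 z) (hd hv 1 z), fderiv_fun_add (hd hu I z) (hd hv I z)]
  simp only [ContinuousLinearMap.add_apply]
  ring

lemma lp_const_mul {u : ℂ → ℝ} (hu : ContDiff ℝ ∞ u) (c : ℝ) (z : ℂ) :
    lp (fun x => c * u x) z = c * lp u z := by
  have hd (v : ℂ) : Differentiable ℝ (fun w => fderiv ℝ u w v) :=
    ((hu.fderiv_right (m := ∞) (by norm_cast)).clm_apply contDiff_const).differentiable (by simp)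
  have h1 (d : ℂ) : (fun w => fderiv ℝ (fun x => c * u x) w d) = fun w => c * fderiv ℝ u w d := by
    ext w
    rw [fderiv_const_mul (hu.differentiable (by simp) w)]; rfl
  unfold lp
  rw [h1, h1, fderiv_const_mul (hd 1 z), fderiv_const_mul (hd I z)]
  simp only [ContinuousLinearMap.smul_apply, smul_eq_mul]
  ring

lemma lp_neg {u : ℂ → ℝ} (hu : ContDiff ℝ ∞ u) (z : ℂ) : lp (fun x => - u x) z = - lp u z := by
  have := lp_const_mul hu (-1) z
  simpa using this

lemma lp_const (c : ℝ) (z : ℂ) : lp (fun _ => c) z = 0 := by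
  simp [lp]

lemma contDiff_quad (a b : ℝ) (z₀ : ℂ) : ContDiff ℝ ∞ (fun x : ℂ => a + b * ‖x - z₀‖ ^ 2) :=
  contDiff_const.add (contDiff_const.mul ((contDiff_id.sub contDiff_const).norm_sq ℝ))

lemma lp_quad (a b : ℝ) (z₀ z : ℂ) : lp (fun x : ℂ => a + b * ‖x - z₀‖ ^ 2) z = 4 * b := by
  have h1 (w : ℂ) : HasFDerivAt (fun x : ℂ => a + b * ‖x - z₀‖ ^ 2) (b • (2 • innerSL ℝ (w - z₀))) w := by
    have := ((hasStrictFDerivAt_norm_sq (w - z₀)).hasFDerivAt.comp w ((hasFDerivAt_id w).sub_const z₀))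
    have := (this.const_mul b).const_add a
    simpa [Function.comp_def] using this
  have h2 (d : ℂ) : (fun w => fderiv ℝ (fun x : ℂ => a + b * ‖x - z₀‖ ^ 2) w d) =
      fun w => 2 * b * ((w.re - z₀.re) * d.re + (w.im - z₀.im) * d.im) := by
    ext w
    rw [(h1 w).fderiv]
    simp [Complex.inner]; ring
  have h3 (d z : ℂ) : HasFDerivAt (fun w : ℂ => 2 * b * ((w.re - z₀.re) * d.re + (w.im - z₀.im) * d.im))
      ((2 * b) • (d.re • Complex.reCLM + d.im • Complex.imCLM)) z := by
    have hr := (Complex.reCLM.hasFDerivAt (x := z)).sub_const z₀.re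
    have hi := (Complex.imCLM.hasFDerivAt (x := z)).sub_const z₀.im
    exact ((hr.mul_const d.re).add (hi.mul_const d.im)).const_mul (2 * b)
  unfold lp
  rw [h2, h2, (h3 1 z).fderiv, (h3 I z).fderiv]
  simp; ring

lemma Sol.neg {L δ : ℝ} {U W : ℂ → ℝ} (hs : Sol L δ U W) : Sol L δ (fun z => - U z) W := by
  refine ⟨hs.measU.neg, hs.measW, fun z => by simpa using hs.hU z, hs.hW, hs.cont.neg, fun h h1 h2 h3 => ?_⟩
  have := hs.weak h h1 h2 h3
  simp only [neg_mul, mul_neg, integral_neg]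
  linarith

lemma Sol.no_pos_circle {L δ : ℝ} {U W : ℂ → ℝ} (hs : Sol L δ U W) (hL : 80 ≤ L) (hδ : δ ≤ 1)
    {z₀ : ℂ} {r : ℝ} (hr : 0 < r) (hr1 : r ≤ 1) (hz : ‖z₀‖ + 1 < 29 / 20 * L) (h0 : U z₀ = 0) :
    ∃ ζ ∈ sphere z₀ r, U ζ ≤ 0 := by
  by_contra hcon
  push Not at hcon
  have hdom : closedBall z₀ r ⊆ ball 0 (29 / 20 * L) := by
    refine closedBall_subset_ball' ?_
    rw [dist_zero_right]; linarith
  have hne : (sphere z₀ r).Nonempty := (NormedSpace.sphere_nonempty).2 hr.le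
  obtain ⟨p, hp, hpmin⟩ := (isCompact_sphere z₀ r).exists_isMinOn hne
    (hs.cont.mono ((sphere_subset_closedBall.trans hdom).trans (ball_subset_ball (by linarith))))
  have hc := hcon p hp
  set c := U p with hcdef
  obtain ⟨u, w, ha⟩ := hs.exists_approx hL (θ := c / 16) (by positivity)
  have huc : Continuous u := ha.smooth.continuous
  set g : ℂ → ℝ := fun x => u x + (-(c / 8) + (-(c / 8)) * ‖x - z₀‖ ^ 2) with hg
  set φ : ℂ → ℝ := fun x => 2 - ‖x - z₀‖ ^ 2 with hφ
  have hφpos : ∀ x ∈ closedBall z₀ r, 1 ≤ φ x := by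
    intro x hx
    rw [mem_closedBall, dist_eq_norm] at hx
    have := norm_nonneg (x - z₀)
    simp only [hφ]; nlinarith
  have hcont : ContinuousOn (fun x => g x / φ x) (closedBall z₀ r) :=
    ContinuousOn.div (by fun_prop) (by fun_prop) fun x hx => (lt_of_lt_of_le one_pos (hφpos x hx)).ne'
  obtain ⟨q, hq, hqmin⟩ := (isCompact_closedBall z₀ r).exists_isMinOn ⟨z₀, mem_closedBall_self hr.le⟩ hcont
  set t := - (g q / φ q) with ht
  have hφq := hφpos q hq
  have htq : g q = - t * φ q := by rw [ht]; field_simp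
  have hmin : ∀ x ∈ closedBall z₀ r, 0 ≤ g x + t * φ x := by
    intro x hx
    have h1 : g q / φ q ≤ g x / φ x := hqmin hx
    have h2 := hφpos x hx
    rw [le_div_iff₀ (by linarith)] at h1
    rw [ht]; linarith
  by_cases htp : t ≤ 0
  · have h1 := hmin z₀ (mem_closedBall_self hr.le)
    have h2 := ha.close z₀ (hdom (mem_closedBall_self hr.le))
    rw [h0, sub_zero] at h2
    have h3 := (abs_le.1 h2).2
    simp [hg, hφ] at h1
    linarith
  push Not at htp
  have hqne : q ∉ sphere z₀ r := by
    intro hqs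
    have h1 : c ≤ U q := hpmin hqs
    have h2 := (abs_le.1 (ha.close q (hdom hq))).1
    rw [mem_sphere, dist_eq_norm] at hqs
    have h3 : g q < 0 := by rw [htq]; nlinarith
    simp only [hg, hqs] at h3
    have hr2 : r ^ 2 ≤ 1 := by nlinarith
    linarith [mul_le_mul_of_nonneg_left hr2 hc.le]
  have hqb : q ∈ ball z₀ r := by
    rw [← closedBall_diff_sphere]; exact ⟨hq, hqne⟩
  have hG : (fun x => u x + ((-(c / 8) + 2 * t) + (-(c / 8) - t) * ‖x - z₀‖ ^ 2)) = fun x => g x + t * φ x := by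
    ext x; simp only [hg, hφ]; ring
  have hloc : IsLocalMin (fun x => u x + ((-(c / 8) + 2 * t) + (-(c / 8) - t) * ‖x - z₀‖ ^ 2)) q := by
    rw [hG]
    filter_upwards [isOpen_ball.mem_nhds hqb] with x hx
    have := hmin x (ball_subset_closedBall hx)
    have h2 : g q + t * φ q = 0 := by rw [htq]; ring
    linarith
  have hlp := lp_nonneg_of_isLocalMin (ha.smooth.add (contDiff_quad _ _ z₀)) hloc
  rw [lp_add ha.smooth (contDiff_quad _ _ z₀), lp_quad] at hlp
  have heq := (abs_le.1 (ha.eq q (hdom hq))).2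
  have hw := abs_le.1 (ha.hw q)
  have huq : u q = c / 8 * (1 + ‖q - z₀‖ ^ 2) - t * φ q := by
    have : g q = u q + (-(c / 8) + (-(c / 8)) * ‖q - z₀‖ ^ 2) := rfl
    linarith [htq]
  rw [mem_closedBall, dist_eq_norm] at hq
  have hn0 := norm_nonneg (q - z₀)
  have hn1 : ‖q - z₀‖ ^ 2 ≤ 1 := by nlinarith
  have hφ2 : φ q ≤ 2 := by simp only [hφ]; nlinarith
  have hX0 : 0 ≤ c / 8 * (1 + ‖q - z₀‖ ^ 2) := by positivity
  have hX1 : c / 8 * (1 + ‖q - z₀‖ ^ 2) ≤ c / 4 := by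
    linarith [mul_le_mul_of_nonneg_left hn1 hc.le]
  have b1 : - (w q * (c / 8 * (1 + ‖q - z₀‖ ^ 2))) ≤ c / 4 := by
    linarith [mul_nonneg (by linarith : 0 ≤ 1 + w q) hX0]
  have hY0 : 0 ≤ t * φ q := by positivity
  have hY1 : t * φ q ≤ 2 * t := by linarith [mul_le_mul_of_nonneg_left hφ2 htp.le]
  have b2 : w q * (t * φ q) ≤ 2 * t := by
    linarith [mul_nonneg (by linarith : 0 ≤ 1 - w q) hY0]
  have b3 : w q * u q = w q * (c / 8 * (1 + ‖q - z₀‖ ^ 2)) - w q * (t * φ q) := by rw [huq]; ring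
  nlinarith

/-- Zeros of a solution propagate to all small circles around a zero. -/
lemma Sol.exists_zero_circle {L δ : ℝ} {U W : ℂ → ℝ} (hs : Sol L δ U W) (hL : 80 ≤ L) (hδ : δ ≤ 1)
    {z₀ : ℂ} {r : ℝ} (hr : 0 < r) (hr1 : r ≤ 1) (hz : ‖z₀‖ + 1 < 29 / 20 * L) (h0 : U z₀ = 0) :
    ∃ ζ ∈ sphere z₀ r, U ζ = 0 := by
  obtain ⟨a, ha, ha0⟩ := hs.no_pos_circle hL hδ hr hr1 hz h0
  obtain ⟨b, hb, hb0⟩ := hs.neg.no_pos_circle hL hδ hr hr1 hz (by simp [h0])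
  have hdom : sphere z₀ r ⊆ ball 0 (3 / 2 * L) := by
    refine sphere_subset_closedBall.trans (closedBall_subset_ball' ?_)
    rw [dist_zero_right]; linarith
  have hpre : IsPreconnected (sphere z₀ r) := isPreconnected_sphere (by simp) z₀ r
  have := hpre.intermediate_value ha hb (hs.cont.mono hdom)
  exact this ⟨ha0, by linarith⟩

/-- An antiderivative of `|x| ^ (-1/2)`. -/
def sgnSqrt (x : ℝ) : ℝ := if 0 ≤ x then 2 * √x else -(2 * √(-x))

lemma sgnSqrt_sub_ge {x h M : ℝ} (hh : 0 < h) (hM : h ≤ M) (hx : |x| ≤ M) :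
    h * (√M)⁻¹ ≤ 2 * (sgnSqrt x - sgnSqrt (x - h)) := by
  have hM0 : 0 < M := hh.trans_le hM
  have hs : 0 < √M := Real.sqrt_pos.2 hM0
  have hsq : √M * √M = M := Real.mul_self_sqrt hM0.le
  have hx2 := abs_le.1 hx
  rw [← div_eq_mul_inv, div_le_iff₀ hs]
  unfold sgnSqrt
  by_cases h1 : 0 ≤ x
  · by_cases h2 : 0 ≤ x - h
    · rw [if_pos h1, if_pos h2]
      have a1 : √x ≤ √M := Real.sqrt_le_sqrt hx2.2
      have a2 : √(x - h) ≤ √x := Real.sqrt_le_sqrt (by linarith)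
      have e1 := Real.mul_self_sqrt h1
      have e2 := Real.mul_self_sqrt h2
      have n2 := Real.sqrt_nonneg (x - h)
      nlinarith
    · rw [if_pos h1, if_neg h2]
      have e1 := Real.mul_self_sqrt h1
      have e2 := Real.mul_self_sqrt (show 0 ≤ -(x - h) by linarith)
      have n1 := Real.sqrt_nonneg x
      have n2 := Real.sqrt_nonneg (-(x - h))
      have a1 : √x ≤ √M := Real.sqrt_le_sqrt hx2.2
      have a2 : √(-(x - h)) ≤ √M := Real.sqrt_le_sqrt (by linarith)
      nlinarith
  · have h2 : ¬ 0 ≤ x - h := by linarith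
    rw [if_neg h1, if_neg h2]
    have e1 := Real.mul_self_sqrt (show 0 ≤ -x by linarith)
    have e2 := Real.mul_self_sqrt (show 0 ≤ -(x - h) by linarith)
    have n1 := Real.sqrt_nonneg (-x)
    have n2 := Real.sqrt_nonneg (-(x - h))
    have a1 : √(-x) ≤ √M := Real.sqrt_le_sqrt (by linarith)
    have a2 : √(-(x - h)) ≤ 2 * √M := by
      rw [show 2 * √M = √(4 * M) by
        rw [Real.sqrt_mul (by norm_num), show (4:ℝ) = 2 ^ 2 by norm_num, Real.sqrt_sq (by norm_num)]]
      exact Real.sqrt_le_sqrt (by linarith)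
    have a3 : √(-x) ≤ √(-(x - h)) := Real.sqrt_le_sqrt (by linarith)
    nlinarith

lemma abs_sgnSqrt_le {x : ℝ} (hx : |x| ≤ 4) : |sgnSqrt x| ≤ 4 := by
  have hx2 := abs_le.1 hx
  have h4 : √(4:ℝ) = 2 := by rw [show (4:ℝ) = 2 ^ 2 by norm_num, Real.sqrt_sq (by norm_num)]
  unfold sgnSqrt
  split_ifs with h
  · rw [abs_of_nonneg (by positivity)]
    have := Real.sqrt_le_sqrt hx2.2
    linarith
  · rw [abs_neg, abs_of_nonneg (by positivity)]
    have := Real.sqrt_le_sqrt (show -x ≤ 4 by linarith)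
    linarith

lemma sum_inv_sqrt_le {n : ℕ} (hn : 0 < n) {ζ₀ : ℂ} {ζ : ℕ → ℂ}
    (hζ : ∀ k < n, ‖ζ k - ζ₀‖ = (k + 1) / n) (w : ℂ) :
    ∑ k ∈ Finset.range n, (√(max ‖w - ζ k‖ (1 / n)))⁻¹ ≤ 16 * n := by
  have hn' : (0:ℝ) < n := by exact_mod_cast hn
  set a := ‖w - ζ₀‖ with ha
  have htri : ∀ k < n, |((k:ℝ) + 1) / n - a| ≤ ‖w - ζ k‖ := by
    intro k hk
    rw [← hζ k hk, ha]
    refine (abs_norm_sub_norm_le _ _).trans (le_of_eq ?_)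
    rw [norm_sub_rev]; congr 1; ring
  by_cases h3 : a ≤ 3
  · have hterm : ∀ k ∈ Finset.range n, (1 / (n:ℝ)) * (√(max ‖w - ζ k‖ (1 / n)))⁻¹ ≤
        2 * sgnSqrt (((k + 1 : ℕ) : ℝ) / n - a) - 2 * sgnSqrt ((k : ℝ) / n - a) := by
      intro k hk
      have := sgnSqrt_sub_ge (x := ((k + 1 : ℕ) : ℝ) / n - a) (h := 1 / n) (M := max ‖w - ζ k‖ (1 / n))
        (by positivity) (le_max_right _ _) (le_max_of_le_left (by
          push_cast; exact htri k (Finset.mem_range.1 hk)))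
      refine this.trans (le_of_eq ?_)
      have e : ((k + 1 : ℕ) : ℝ) / n - a - 1 / n = (k : ℝ) / n - a := by push_cast; ring
      rw [e]; ring
    have hs := Finset.sum_le_sum hterm
    rw [Finset.sum_range_sub (fun k : ℕ => 2 * sgnSqrt ((k : ℝ) / n - a)), ← Finset.mul_sum] at hs
    have ha0 : 0 ≤ a := norm_nonneg _
    have e1 : |sgnSqrt ((n:ℝ) / n - a)| ≤ 4 := abs_sgnSqrt_le (by
      rw [div_self hn'.ne', abs_le]; constructor <;> linarith)
    have e2 : |sgnSqrt (((0:ℕ):ℝ) / n - a)| ≤ 4 := abs_sgnSqrt_le (by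
      rw [Nat.cast_zero, zero_div, abs_le]; constructor <;> linarith)
    rw [abs_le] at e1 e2
    set S := ∑ k ∈ Finset.range n, (√(max ‖w - ζ k‖ (1 / n)))⁻¹ with hS
    have hs2 : (1 / (n:ℝ)) * S ≤ 16 := by linarith
    calc S = n * ((1 / (n:ℝ)) * S) := by field_simp
      _ ≤ n * 16 := by gcongr
      _ = 16 * n := by ring
  · push Not at h3
    have : ∀ k ∈ Finset.range n, (√(max ‖w - ζ k‖ (1 / n)))⁻¹ ≤ 1 := by
      intro k hk
      have hk' := Finset.mem_range.1 hk
      refine inv_le_one_of_one_le₀ (Real.one_le_sqrt.2 (le_max_of_le_left ?_))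
      have h1 := htri k hk'
      have h2 : ((k:ℝ) + 1) / n ≤ 1 := by
        rw [div_le_one hn']; exact_mod_cast hk'
      have := (abs_le.1 h1).1
      linarith
    refine (Finset.sum_le_sum this).trans ?_
    simp; linarith

lemma exists_moll_le {n : ℕ} (hn : 0 < n) : ∃ ρ, Moll (1 / n : ℝ) ρ ∧ ∀ x, ρ x ≤ 2 * n ^ 2 := by
  have hn' : (0:ℝ) < n := by exact_mod_cast hn
  let b : ContDiffBump (0:ℂ) := ⟨1 / (2 * n), 1 / n, by positivity, by
    rw [div_lt_div_iff₀ (by positivity) hn']; linarith⟩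
  have hsupp : Function.support (b.normed volume) = ball 0 (1 / n : ℝ) := b.support_normed_eq
  refine ⟨b.normed volume, ⟨b.contDiff_normed, b.nonneg_normed, b.integral_normed, fun x hx => ?_,
    fun x hx => ?_⟩, fun x => ?_⟩
  · by_contra h
    have : x ∈ Function.support (b.normed volume) := h
    rw [hsupp, mem_ball_zero_iff] at this
    linarith
  · have : x ∈ Function.support (b.normed volume) := by rw [hsupp]; simpa using hx
    exact lt_of_le_of_ne (b.nonneg_normed x) (Ne.symm this)
  · refine (b.normed_le_div_measure_closedBall_rIn volume x).trans ?_
    have hr : b.rIn = 1 / (2 * n) := rfl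
    have hv : (volume : Measure ℂ).real (closedBall 0 b.rIn) = Real.pi * (1 / (2 * n)) ^ 2 := by
      rw [hr]
      simp [Measure.real]
      ring
    rw [hv, div_le_iff₀ (by positivity)]
    have : 2 * (n:ℝ) ^ 2 * (Real.pi * (1 / (2 * n)) ^ 2) = Real.pi / 2 := by field_simp
    rw [this]; linarith [Real.pi_gt_three]

/-- Potential of a bump of size `1/n` against the kernel `‖·‖ ^ (-s)`. -/
lemma lintegral_bump_le {n : ℕ} (hn : 0 < n) {ρ : ℂ → ℝ} (hm : Moll (1 / n : ℝ) ρ)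
    (hb : ∀ x, ρ x ≤ 2 * n ^ 2) {s : ℝ} (hs0 : 0 ≤ s) (hs1 : s ≤ 1) (c w : ℂ) :
    ∫⁻ ζ, ENNReal.ofReal (ρ (ζ - c) * ‖w - ζ‖ ^ (-s)) ≤
      ENNReal.ofReal (256 * (max ‖w - c‖ (1 / n)) ^ (-s)) := by
  have hn' : (0:ℝ) < n := by exact_mod_cast hn
  set M := max ‖w - c‖ (1 / n : ℝ) with hM
  have hM0 : 0 < M := lt_of_lt_of_le (by positivity) (le_max_right _ _)
  have hzero : ∀ ζ, ζ ∉ ball c (1 / n : ℝ) → ρ (ζ - c) = 0 := by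
    intro ζ h
    refine hm.zero _ ?_
    rw [mem_ball, dist_eq_norm] at h; linarith
  by_cases hfar : 2 / (n:ℝ) ≤ ‖w - c‖
  · have hpt : ∀ ζ, ρ (ζ - c) * ‖w - ζ‖ ^ (-s) ≤ ρ (ζ - c) * (2 * M ^ (-s)) := by
      intro ζ
      by_cases h : ζ ∈ ball c (1 / n : ℝ)
      · refine mul_le_mul_of_nonneg_left ?_ (hm.nonneg _)
        rw [mem_ball, dist_eq_norm] at h
        have hMe : M = ‖w - c‖ := max_eq_left (le_trans (by gcongr; norm_num) hfar)
        have h2 : M / 2 ≤ ‖w - ζ‖ := by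
          have h3 : ‖w - c‖ ≤ ‖w - ζ‖ + ‖ζ - c‖ := by simpa using norm_add_le (w - ζ) (ζ - c)
          have h4 : 2 / (n:ℝ) = 1 / n + 1 / n := by ring
          linarith
        calc ‖w - ζ‖ ^ (-s) ≤ (M / 2) ^ (-s) := Real.rpow_le_rpow_of_nonpos (by positivity) h2 (by linarith)
          _ = 2 ^ s * M ^ (-s) := by
            rw [Real.div_rpow hM0.le (by norm_num), Real.rpow_neg (by norm_num : (0:ℝ) ≤ 2)]
            field_simp
          _ ≤ 2 * M ^ (-s) := by
            gcongr
            calc (2:ℝ) ^ s ≤ 2 ^ (1:ℝ) := Real.rpow_le_rpow_of_exponent_le (by norm_num) hs1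
              _ = 2 := by norm_num
      · simp [hzero ζ h]
    calc ∫⁻ ζ, ENNReal.ofReal (ρ (ζ - c) * ‖w - ζ‖ ^ (-s))
        ≤ ∫⁻ ζ, ENNReal.ofReal (ρ (ζ - c) * (2 * M ^ (-s))) :=
          lintegral_mono fun ζ => ENNReal.ofReal_le_ofReal (hpt ζ)
      _ = ENNReal.ofReal (∫ ζ, ρ (ζ - c) * (2 * M ^ (-s))) := by
          rw [ofReal_integral_eq_lintegral_ofReal]
          · exact (hm.integrable.comp_sub_right c).mul_const _
          · exact Eventually.of_forall fun ζ => mul_nonneg (hm.nonneg _) (by positivity)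
      _ ≤ ENNReal.ofReal (256 * M ^ (-s)) := by
          refine ENNReal.ofReal_le_ofReal ?_
          rw [integral_mul_const, integral_sub_right_eq_self, hm.int, one_mul]
          gcongr; norm_num
  · push Not at hfar
    have hM2 : M ≤ 2 / n := max_le hfar.le (by gcongr; norm_num)
    have hpt : ∀ ζ, ENNReal.ofReal (ρ (ζ - c) * ‖w - ζ‖ ^ (-s)) ≤
        (ball w (3 / n : ℝ)).indicator (fun ζ => ENNReal.ofReal (2 * n ^ 2) * ENNReal.ofReal (‖ζ - w‖ ^ (-s))) ζ := by
      intro ζ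
      by_cases h : ζ ∈ ball c (1 / n : ℝ)
      · have h2 : ζ ∈ ball w (3 / n : ℝ) := by
          rw [mem_ball, dist_eq_norm] at h ⊢
          have h3 : ‖ζ - w‖ ≤ ‖ζ - c‖ + ‖w - c‖ := by
            rw [norm_sub_rev w c]; simpa using norm_add_le (ζ - c) (c - w)
          have h4 : 3 / (n:ℝ) = 1 / n + 2 / n := by ring
          linarith
        rw [indicator_of_mem h2, ← ENNReal.ofReal_mul (by positivity), norm_sub_rev]
        refine ENNReal.ofReal_le_ofReal ?_
        gcongr
        exact hb _
      · simp [hzero ζ h]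
    refine (lintegral_mono hpt).trans ?_
    rw [lintegral_indicator measurableSet_ball, lintegral_const_mul' _ _ ENNReal.ofReal_ne_top]
    have htr : ∫⁻ ζ in ball w (3 / n : ℝ), ENNReal.ofReal (‖ζ - w‖ ^ (-s)) =
        ∫⁻ z in ball (0:ℂ) (3 / n : ℝ), ENNReal.ofReal (‖z‖ ^ (-s)) := by
      rw [← lintegral_indicator measurableSet_ball, ← lintegral_indicator measurableSet_ball,
        ← lintegral_sub_right_eq_self ((ball (0:ℂ) (3 / n : ℝ)).indicator fun z => ENNReal.ofReal (‖z‖ ^ (-s))) w]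
      congr 1; ext ζ
      simp [indicator, dist_eq_norm]
    rw [htr, lintegral_ball_norm_rpow (by linarith) (by positivity), ← ENNReal.ofReal_mul (by positivity)]
    refine ENNReal.ofReal_le_ofReal ?_
    have e1 : (3 / (n:ℝ)) ^ (2 - s) ≤ 9 / n ^ 2 * (n:ℝ) ^ s := by
      rw [Real.div_rpow (by norm_num) hn'.le, Real.rpow_sub hn', div_div_eq_mul_div, div_mul_eq_mul_div]
      have h3 : (3:ℝ) ^ (2 - s) ≤ 9 := by
        calc (3:ℝ) ^ (2 - s) ≤ 3 ^ (2:ℝ) := Real.rpow_le_rpow_of_exponent_le (by norm_num) (by linarith)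
          _ = 9 := by norm_num
      have h4 : (n:ℝ) ^ (2:ℝ) = n ^ 2 := by norm_cast
      rw [h4]; gcongr
    have e2 : (n:ℝ) ^ s ≤ 2 * M ^ (-s) := by
      calc (n:ℝ) ^ s = 2 ^ s * (2 / n : ℝ) ^ (-s) := by
            rw [Real.div_rpow (by norm_num) hn'.le, Real.rpow_neg (by norm_num : (0:ℝ) ≤ 2), Real.rpow_neg hn'.le]
            field_simp
        _ ≤ 2 * M ^ (-s) := by
            refine mul_le_mul ?_ (Real.rpow_le_rpow_of_nonpos hM0 hM2 (by linarith)) (by positivity) (by norm_num)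
            calc (2:ℝ) ^ s ≤ 2 ^ (1:ℝ) := Real.rpow_le_rpow_of_exponent_le (by norm_num) hs1
              _ = 2 := by norm_num
    have e3 : 2 * Real.pi / (2 - s) ≤ 7 := by
      rw [div_le_iff₀ (by linarith)]
      linarith [Real.pi_lt_d2]
    have hX : 0 ≤ M ^ (-s) := by positivity
    calc 2 * (n:ℝ) ^ 2 * (2 * Real.pi / (2 - s) * (3 / (n:ℝ)) ^ (2 - s))
        ≤ 2 * (n:ℝ) ^ 2 * (7 * (9 / n ^ 2 * (2 * M ^ (-s)))) := by
          gcongr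
          exact e1.trans (by gcongr)
      _ = 252 * M ^ (-s) := by field_simp; ring
      _ ≤ 256 * M ^ (-s) := by linarith

/-- Averaged bumps along a sequence of points at distances `(k + 1) / n` from a centre. -/
structure Ring (n : ℕ) (ζ : ℕ → ℂ) (m : ℂ → ℝ) : Prop where
  smooth : ContDiff ℝ ∞ m
  nonneg : ∀ z, 0 ≤ m z
  near : ∀ z, m z ≠ 0 → ∃ k < n, ‖z - ζ k‖ < 1 / n
  integrable : Integrable m
  int : ∫ z, m z = 1
  half : ∀ w, ∫⁻ z, ENNReal.ofReal (m z * ‖w - z‖ ^ (-(1/2) : ℝ)) ≤ ENNReal.ofReal 4096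
  one : ∀ w, ∫⁻ z, ENNReal.ofReal (m z * ‖w - z‖ ^ (-1 : ℝ)) ≤ ENNReal.ofReal (4096 * √n)

lemma exists_ring {n : ℕ} (hn : 0 < n) {ζ₀ : ℂ} {ζ : ℕ → ℂ}
    (hζ : ∀ k < n, ‖ζ k - ζ₀‖ = (k + 1) / n) : ∃ m, Ring n ζ m := by
  have hn' : (0:ℝ) < n := by exact_mod_cast hn
  obtain ⟨ρ, hρ, hb⟩ := exists_moll_le hn
  have hinteg : ∀ k, Integrable fun z => ρ (z - ζ k) := fun k => hρ.integrable.comp_sub_right _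
  have key : ∀ (s : ℝ) (hs0 : 0 ≤ s) (hs1 : s ≤ 1) (w : ℂ),
      ∫⁻ z, ENNReal.ofReal ((1 / n * ∑ k ∈ Finset.range n, ρ (z - ζ k)) * ‖w - z‖ ^ (-s)) ≤
        ENNReal.ofReal (1 / n * ∑ k ∈ Finset.range n, 256 * (max ‖w - ζ k‖ (1 / n)) ^ (-s)) := by
    intro s hs0 hs1 w
    have e : ∀ z, ENNReal.ofReal ((1 / n * ∑ k ∈ Finset.range n, ρ (z - ζ k)) * ‖w - z‖ ^ (-s)) =
        ENNReal.ofReal (1 / n) * ∑ k ∈ Finset.range n, ENNReal.ofReal (ρ (z - ζ k) * ‖w - z‖ ^ (-s)) := by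
      intro z
      rw [← ENNReal.ofReal_sum_of_nonneg, ← ENNReal.ofReal_mul (by positivity), mul_assoc, Finset.sum_mul]
      intro k _
      exact mul_nonneg (hρ.nonneg _) (by positivity)
    simp_rw [e]
    rw [lintegral_const_mul' _ _ ENNReal.ofReal_ne_top, lintegral_finsetSum]
    · rw [ENNReal.ofReal_mul (by positivity), ENNReal.ofReal_sum_of_nonneg (fun k _ => by positivity)]
      gcongr with k _
      exact lintegral_bump_le hn hρ hb hs0 hs1 _ _
    · intro k _
      have := hρ.smooth.continuous.measurable
      fun_prop
  have hsum := sum_inv_sqrt_le hn hζ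
  refine ⟨fun z => 1 / n * ∑ k ∈ Finset.range n, ρ (z - ζ k), ?_, ?_, ?_, ?_, ?_, ?_, ?_⟩
  · refine contDiff_const.mul (ContDiff.sum fun k _ => ?_)
    exact hρ.smooth.comp (contDiff_id.sub contDiff_const)
  · intro z
    exact mul_nonneg (by positivity) (Finset.sum_nonneg fun k _ => hρ.nonneg _)
  · intro z hz
    by_contra! h
    refine hz ?_
    rw [Finset.sum_eq_zero, mul_zero]
    intro k hk
    exact hρ.zero _ (h k (Finset.mem_range.1 hk))
  · exact (integrable_finsetSum _ fun k _ => hinteg k).const_mul _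
  · rw [integral_const_mul, integral_finsetSum _ fun k _ => hinteg k]
    simp_rw [integral_sub_right_eq_self, hρ.int]
    simp; field_simp
  · intro w
    refine (key (1/2) (by norm_num) (by norm_num) w).trans (ENNReal.ofReal_le_ofReal ?_)
    have e : ∀ k, (max ‖w - ζ k‖ (1 / n : ℝ)) ^ (-(1/2) : ℝ) = (√(max ‖w - ζ k‖ (1 / n)))⁻¹ := by
      intro k
      rw [Real.rpow_neg (by positivity), Real.sqrt_eq_rpow]
    simp_rw [e]
    rw [← Finset.mul_sum]
    calc 1 / n * (256 * ∑ k ∈ Finset.range n, (√(max ‖w - ζ k‖ (1 / n)))⁻¹)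
        ≤ 1 / n * (256 * (16 * n)) := by gcongr; exact hsum w
      _ = 4096 := by field_simp; norm_num
  · intro w
    refine (key 1 (by norm_num) (by norm_num) w).trans (ENNReal.ofReal_le_ofReal ?_)
    have e : ∀ k, (max ‖w - ζ k‖ (1 / n : ℝ)) ^ (-1 : ℝ) ≤ √n * (√(max ‖w - ζ k‖ (1 / n)))⁻¹ := by
      intro k
      set M := max ‖w - ζ k‖ (1 / n : ℝ) with hM
      have hM0 : 0 < M := lt_of_lt_of_le (by positivity) (le_max_right _ _)
      rw [Real.rpow_neg_one]
      have h1 : (√M)⁻¹ ≤ √n := by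
        have h2 : 1 / √(n:ℝ) ≤ √M := by
          rw [show 1 / √(n:ℝ) = √(1 / n) by simp]
          exact Real.sqrt_le_sqrt (le_max_right _ _)
        rw [inv_le_comm₀ (Real.sqrt_pos.2 hM0) (Real.sqrt_pos.2 hn')]
        simpa using h2
      have h3 : M⁻¹ = (√M)⁻¹ * (√M)⁻¹ := by
        rw [← mul_inv, Real.mul_self_sqrt hM0.le]
      rw [h3]
      gcongr
    calc 1 / n * ∑ k ∈ Finset.range n, 256 * (max ‖w - ζ k‖ (1 / n : ℝ)) ^ (-1 : ℝ)
        ≤ 1 / n * ∑ k ∈ Finset.range n, 256 * (√n * (√(max ‖w - ζ k‖ (1 / n)))⁻¹) := by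
          gcongr with k _; exact e k
      _ = 1 / n * (256 * (√n * ∑ k ∈ Finset.range n, (√(max ‖w - ζ k‖ (1 / n)))⁻¹)) := by
          rw [← Finset.mul_sum, ← Finset.mul_sum]
      _ ≤ 1 / n * (256 * (√n * (16 * n))) := by gcongr; exact hsum w
      _ = 4096 * √n := by field_simp; norm_num

/-- The constant bounding potentials of the near charges. -/
def CP : ℝ := 2 ^ 24

structure Charge (L : ℝ) (U : ℂ → ℝ) (n : ℕ) (Pn Pf : ℂ → ℝ) : Prop where
  smooth_n : ContDiff ℝ ∞ Pn
  smooth_f : ContDiff ℝ ∞ Pf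
  nonneg_n : ∀ z, 0 ≤ Pn z
  nonneg_f : ∀ z, 0 ≤ Pf z
  le_one_f : ∀ z, Pf z ≤ 1
  cpt_n : HasCompactSupport Pn
  cpt_f : HasCompactSupport fun z => Pf z - 1
  half : ∀ w, ∫⁻ z in ball w 20, ENNReal.ofReal (Pn z * ‖w - z‖ ^ (-(1/2) : ℝ)) ≤ ENNReal.ofReal CP
  one : ∀ w, ∫⁻ z in ball w 20, ENNReal.ofReal (Pn z * ‖w - z‖ ^ (-1 : ℝ)) ≤ ENNReal.ofReal (CP * √n)
  mass : ∫ z, Pn z ≤ 100 * L ^ 2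
  near : ∀ z, Pn z ≠ 0 → ∃ ζ, U ζ = 0 ∧ ‖ζ‖ < 29 / 20 * L ∧ ‖z - ζ‖ < 1 / n
  far : ∀ z, Pf z ≠ 0 → ∀ ζ, U ζ = 0 → ‖ζ‖ ≤ 7 / 5 * L → 3 ≤ ‖z - ζ‖
  lower : ∀ w, 1 ≤ ∫ z in ball w 9, (Pn z + Pf z)

/-- The lattice point `a + b i`. -/
def lat (g : ℤ × ℤ) : ℂ := ⟨g.1, g.2⟩

lemma exists_lat (z : ℂ) : ∃ g, ‖z - lat g‖ ≤ 1 ∧ |(g.1:ℝ)| ≤ ‖z‖ + 1 ∧ |(g.2:ℝ)| ≤ ‖z‖ + 1 := by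
  have h1 := abs_sub_round z.re
  have h2 := abs_sub_round z.im
  refine ⟨(round z.re, round z.im), ?_, ?_, ?_⟩
  · refine (Complex.norm_le_abs_re_add_abs_im _).trans ?_
    simp only [lat, Complex.sub_re, Complex.sub_im]
    linarith
  · have h3 := Complex.abs_re_le_norm z
    have := abs_sub_abs_le_abs_sub (round z.re : ℝ) z.re
    rw [abs_sub_comm] at this; dsimp only; linarith
  · have h3 := Complex.abs_im_le_norm z
    have := abs_sub_abs_le_abs_sub (round z.im : ℝ) z.im
    rw [abs_sub_comm] at this; dsimp only; linarith

lemma card_icc_le (x : ℝ) (r : ℕ) : (Finset.Icc ⌈x - r⌉ ⌊x + r⌋).card ≤ 2 * r + 1 := by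
  rw [Int.card_Icc, Int.toNat_le]
  have h1 := Int.le_ceil (x - r)
  have h2 := Int.floor_le (x + r)
  have : (⌊x + r⌋ - ⌈x - r⌉ : ℝ) ≤ 2 * r := by linarith
  have h3 : ⌊x + r⌋ - ⌈x - r⌉ ≤ 2 * r := by exact_mod_cast this
  push_cast; omega

lemma card_lat_le (G : Finset (ℤ × ℤ)) (w : ℂ) (r : ℕ) (hG : ∀ g ∈ G, ‖w - lat g‖ ≤ r) :
    G.card ≤ (2 * r + 1) ^ 2 := by
  have : G ⊆ Finset.Icc ⌈w.re - r⌉ ⌊w.re + r⌋ ×ˢ Finset.Icc ⌈w.im - r⌉ ⌊w.im + r⌋ := by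
    intro g hg
    have h1 := (Complex.abs_re_le_norm (w - lat g)).trans (hG g hg)
    have h2 := (Complex.abs_im_le_norm (w - lat g)).trans (hG g hg)
    simp only [lat, Complex.sub_re, Complex.sub_im, abs_le] at h1 h2
    simp only [Finset.mem_product, Finset.mem_Icc, Int.ceil_le, Int.le_floor]
    refine ⟨⟨?_, ?_⟩, ?_, ?_⟩ <;> linarith
  refine (Finset.card_le_card this).trans ?_
  rw [Finset.card_product, pow_two]
  exact Nat.mul_le_mul (card_icc_le _ _) (card_icc_le _ _)

lemma exists_smooth_cutoff {A B : Set ℂ} (hA : IsClosed A) (hB : IsClosed B) (hd : Disjoint A B) :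
    ∃ p : ℂ → ℝ, ContDiff ℝ ∞ p ∧ (∀ z, 0 ≤ p z) ∧ (∀ z, p z ≤ 1) ∧ (∀ z ∈ A, p z = 0) ∧
      ∀ z ∈ B, p z = 1 := by
  obtain ⟨f, hf0, hf1, hf⟩ := exists_contMDiffMap_zero_one_of_isClosed
    (n := (⊤ : ℕ∞)) (modelWithCornersSelf ℝ ℂ) hA hB hd
  exact ⟨f, f.contMDiff.contDiff, fun z => (hf z).1, fun z => (hf z).2, fun z hz => hf0 hz,
    fun z hz => hf1 hz⟩

lemma exists_smooth_fat {Z : Set ℂ} (hZ : IsCompact Z) :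
    ∃ p : ℂ → ℝ, ContDiff ℝ ∞ p ∧ (∀ z, 0 ≤ p z) ∧ (∀ z, p z ≤ 1) ∧
      (HasCompactSupport fun z => p z - 1) ∧ (∀ z, p z ≠ 0 → ∀ ζ ∈ Z, 3 ≤ ‖z - ζ‖) ∧
      ∀ z, (∀ ζ ∈ Z, 4 ≤ ‖z - ζ‖) → p z = 1 := by
  have hd : Disjoint (cthickening 3 Z) (thickening 4 Z)ᶜ := by
    rw [Set.disjoint_compl_right_iff_subset]
    exact cthickening_subset_thickening' (by norm_num) (by norm_num) Z
  obtain ⟨p, hp, h0, h1, hA, hB⟩ := exists_smooth_cutoff isClosed_cthickening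
    isOpen_thickening.isClosed_compl hd
  have hB' : ∀ z, (∀ ζ ∈ Z, 4 ≤ ‖z - ζ‖) → p z = 1 := by
    intro z h
    refine hB z fun hz => ?_
    obtain ⟨ζ, hζ, hd⟩ := mem_thickening_iff.1 hz
    have := h ζ hζ
    rw [dist_eq_norm] at hd; linarith
  refine ⟨p, hp, h0, h1, ?_, ?_, hB'⟩
  · refine HasCompactSupport.intro (hZ.cthickening (r := 4)) fun z hz => ?_
    rw [hB z fun h => hz (thickening_subset_cthickening _ _ h), sub_self]
  · intro z hz ζ hζ
    by_contra! h
    exact hz (hA z (thickening_subset_cthickening _ _ (mem_thickening_iff.2 ⟨ζ, hζ, by rwa [dist_eq_norm]⟩)))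

lemma Sol.exists_charge {L δ : ℝ} {U W : ℂ → ℝ} (hs : Sol L δ U W) (hL : 80 ≤ L) (hδ : δ ≤ 1)
    {n : ℕ} (hn : 0 < n) : ∃ Pn Pf, Charge L U n Pn Pf := by
  classical
  have hn' : (0:ℝ) < n := by exact_mod_cast hn
  have hn1 : (1:ℝ) / n ≤ 1 := by rw [div_le_one hn']; exact_mod_cast hn
  set Z : Set ℂ := closedBall 0 (7 / 5 * L) ∩ U ⁻¹' {0} with hZ
  have hZc : IsCompact Z := by
    refine (isCompact_closedBall _ _).of_isClosed_subset ?_ inter_subset_left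
    refine ContinuousOn.preimage_isClosed_of_isClosed (hs.cont.mono ?_) isClosed_closedBall isClosed_singleton
    exact closedBall_subset_ball (by linarith)
  obtain ⟨Pf, hf, hf0, hf1, hfc, hffar, hfone⟩ := exists_smooth_fat hZc
  have hring : ∀ ζ₀ ∈ Z, ∃ m, ∃ ζ : ℕ → ℂ, (∀ k < n, U (ζ k) = 0 ∧ ‖ζ k - ζ₀‖ ≤ 1) ∧ Ring n ζ m := by
    intro ζ₀ hζ₀
    have hz : ‖ζ₀‖ ≤ 7 / 5 * L := by simpa using hζ₀.1
    have : ∀ k : ℕ, ∃ ζ, k < n → U ζ = 0 ∧ ‖ζ - ζ₀‖ = (k + 1) / n := by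
      intro k
      by_cases hk : k < n
      · have h1 : ((k:ℝ) + 1) / n ≤ 1 := by
          rw [div_le_one hn']; exact_mod_cast hk
        obtain ⟨ζ, h2, h3⟩ := hs.exists_zero_circle hL hδ (r := (k + 1) / n) (by positivity) h1
          (by linarith) hζ₀.2
        exact ⟨ζ, fun _ => ⟨h3, by simpa [dist_eq_norm] using h2⟩⟩
      · exact ⟨0, fun h => absurd h hk⟩
    choose ζ hζ using this
    obtain ⟨m, hm⟩ := exists_ring hn (fun k hk => (hζ k hk).2)
    refine ⟨m, ζ, fun k hk => ⟨(hζ k hk).1, ?_⟩, hm⟩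
    rw [(hζ k hk).2, div_le_one hn']; exact_mod_cast hk
  let Nn : ℕ := ⌈7 / 5 * L + 1⌉₊
  let G : Finset (ℤ × ℤ) := (Finset.Icc (-(Nn:ℤ)) Nn ×ˢ Finset.Icc (-(Nn:ℤ)) Nn).filter
    fun g => ∃ ζ ∈ Z, ‖ζ - lat g‖ ≤ 1
  have hGr : ∀ g : ℤ × ℤ, ∃ m : ℂ → ℝ, g ∈ G → (∃ ζ : ℕ → ℂ, (∀ k < n, U (ζ k) = 0 ∧ ‖ζ k - lat g‖ ≤ 2 ∧
      ‖ζ k‖ < 29 / 20 * L) ∧ Ring n ζ m) := by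
    intro g
    by_cases hg : g ∈ G
    · obtain ⟨ζ₀, hζ₀, hd⟩ := (Finset.mem_filter.1 hg).2
      obtain ⟨m, ζ, h1, h2⟩ := hring ζ₀ hζ₀
      have hz : ‖ζ₀‖ ≤ 7 / 5 * L := by simpa using hζ₀.1
      refine ⟨m, fun _ => ⟨ζ, fun k hk => ⟨(h1 k hk).1, ?_, ?_⟩, h2⟩⟩
      · have := norm_add_le (ζ k - ζ₀) (ζ₀ - lat g)
        rw [sub_add_sub_cancel] at this
        linarith [(h1 k hk).2]
      · have := norm_add_le (ζ k - ζ₀) ζ₀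
        rw [sub_add_cancel] at this
        linarith [(h1 k hk).2]
    · exact ⟨0, fun h => absurd h hg⟩
  choose m hm using hGr
  have hmsupp : ∀ g ∈ G, ∀ z, m g z ≠ 0 → ‖z - lat g‖ < 3 := by
    intro g hg z hz
    obtain ⟨ζ, h1, h2⟩ := hm g hg
    obtain ⟨k, hk, h3⟩ := h2.near z hz
    have := norm_add_le (z - ζ k) (ζ k - lat g)
    rw [sub_add_sub_cancel] at this
    linarith [(h1 k hk).2.1]
  have hpot : ∀ (a B : ℝ), 0 ≤ B → (∀ g ∈ G, ∀ w, ∫⁻ z, ENNReal.ofReal (m g z * ‖w - z‖ ^ a) ≤ ENNReal.ofReal B) →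
      ∀ w, ∫⁻ z in ball w 20, ENNReal.ofReal ((∑ g ∈ G, m g z) * ‖w - z‖ ^ a) ≤ ENNReal.ofReal (2209 * B) := by
    intro a B hB h w
    let G' := G.filter fun g => ‖w - lat g‖ ≤ (23:ℕ)
    have hcard : (G'.card : ℝ) ≤ 2209 := by
      have := card_lat_le G' w 23 fun g hg => (Finset.mem_filter.1 hg).2
      norm_num at this; exact_mod_cast this
    have e : ∀ z ∈ ball w 20, ENNReal.ofReal ((∑ g ∈ G, m g z) * ‖w - z‖ ^ a) =
        ∑ g ∈ G', ENNReal.ofReal (m g z * ‖w - z‖ ^ a) := by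
      intro z hz
      rw [Finset.sum_mul, ← ENNReal.ofReal_sum_of_nonneg]
      · congr 1
        symm
        refine Finset.sum_subset (Finset.filter_subset _ _) fun g hg hg' => ?_
        rw [mul_eq_zero]; left
        by_contra h0
        refine hg' (Finset.mem_filter.2 ⟨hg, ?_⟩)
        have h1 := hmsupp g hg z h0
        rw [mem_ball, dist_comm, dist_eq_norm] at hz
        have := norm_add_le (w - z) (z - lat g)
        rw [sub_add_sub_cancel] at this
        push_cast; linarith
      · intro g hg
        obtain ⟨ζ, h1, h2⟩ := hm g (Finset.mem_filter.1 hg).1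
        exact mul_nonneg (h2.nonneg _) (by positivity)
    rw [setLIntegral_congr_fun measurableSet_ball e, lintegral_finsetSum']
    · calc ∑ g ∈ G', ∫⁻ z in ball w 20, ENNReal.ofReal (m g z * ‖w - z‖ ^ a)
          ≤ ∑ g ∈ G', ENNReal.ofReal B := by
            refine Finset.sum_le_sum fun g hg => (setLIntegral_le_lintegral _ _).trans ?_
            exact h g (Finset.mem_filter.1 hg).1 w
        _ = ENNReal.ofReal (G'.card * B) := by
            rw [Finset.sum_const, nsmul_eq_mul, ENNReal.ofReal_mul (by positivity), ENNReal.ofReal_natCast]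
        _ ≤ _ := by gcongr
    · intro g hg
      obtain ⟨ζ, h1, h2⟩ := hm g (Finset.mem_filter.1 hg).1
      have := h2.smooth.continuous.measurable
      exact Measurable.aemeasurable (by fun_prop)
  have hcardG : (G.card : ℝ) ≤ 100 * L ^ 2 := by
    have h1 : G.card ≤ (2 * Nn + 1) ^ 2 := by
      refine (Finset.card_filter_le _ _).trans ?_
      rw [Finset.card_product, Int.card_Icc]
      have : ((Nn:ℤ) + 1 - -Nn).toNat = 2 * Nn + 1 := by omega
      rw [this, pow_two]
    have h2 : (Nn : ℝ) < 7 / 5 * L + 1 + 1 := Nat.ceil_lt_add_one (by linarith)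
    calc (G.card : ℝ) ≤ ((2 * Nn + 1) ^ 2 : ℕ) := by exact_mod_cast h1
      _ = (2 * Nn + 1 : ℝ) ^ 2 := by push_cast; ring
      _ ≤ (10 * L) ^ 2 := by gcongr; linarith
      _ = 100 * L ^ 2 := by ring
  have hinteg : ∀ g ∈ G, Integrable (m g) := fun g hg => by
    obtain ⟨ζ, h1, h2⟩ := hm g hg; exact h2.integrable
  have hnn : ∀ g ∈ G, ∀ z, 0 ≤ m g z := fun g hg => by
    obtain ⟨ζ, h1, h2⟩ := hm g hg; exact h2.nonneg
  have hone : ∀ g ∈ G, ∫ z, m g z = 1 := fun g hg => by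
    obtain ⟨ζ, h1, h2⟩ := hm g hg; exact h2.int
  refine ⟨fun z => ∑ g ∈ G, m g z, Pf, ⟨?_, hf, fun z => Finset.sum_nonneg fun g hg => hnn g hg z, hf0, hf1,
    ?_, hfc, ?_, ?_, ?_, ?_, ?_, ?_⟩⟩
  · refine ContDiff.sum fun g hg => ?_
    obtain ⟨ζ, h1, h2⟩ := hm g hg; exact h2.smooth
  · refine HasCompactSupport.intro (isCompact_closedBall 0 (3 * Nn + 5 : ℝ)) fun z hz => ?_
    refine Finset.sum_eq_zero fun g hg => ?_
    by_contra h0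
    have h1 := hmsupp g hg z h0
    refine hz ?_
    have h2 := Finset.mem_product.1 (Finset.mem_filter.1 hg).1
    simp only [Finset.mem_Icc] at h2
    have h3 : |(g.1:ℝ)| ≤ Nn := by rw [abs_le]; exact_mod_cast h2.1
    have h4 : |(g.2:ℝ)| ≤ Nn := by rw [abs_le]; exact_mod_cast h2.2
    have h5 := Complex.norm_le_abs_re_add_abs_im (lat g)
    have h6 := norm_add_le (z - lat g) (lat g)
    rw [sub_add_cancel] at h6
    simp only [lat] at h5 h6 h1
    rw [mem_closedBall_zero_iff]; linarith
  · intro w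
    refine (hpot _ 4096 (by norm_num) (fun g hg w => ?_) w).trans (ENNReal.ofReal_le_ofReal (by norm_num [CP]))
    obtain ⟨ζ, h1, h2⟩ := hm g hg; exact h2.half w
  · intro w
    refine (hpot _ (4096 * √n) (by positivity) (fun g hg w => ?_) w).trans (ENNReal.ofReal_le_ofReal ?_)
    · obtain ⟨ζ, h1, h2⟩ := hm g hg; exact h2.one w
    · rw [← mul_assoc]; gcongr; norm_num [CP]
  · rw [integral_finsetSum _ hinteg, Finset.sum_congr rfl hone]
    simpa using hcardG
  · intro z hz
    obtain ⟨g, hg, h0⟩ := Finset.exists_ne_zero_of_sum_ne_zero hz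
    obtain ⟨ζ, h1, h2⟩ := hm g hg
    obtain ⟨k, hk, h3⟩ := h2.near z h0
    exact ⟨ζ k, (h1 k hk).1, (h1 k hk).2.2, h3⟩
  · intro z hz ζ h1 h2
    exact hffar z hz ζ ⟨by simpa using h2, h1⟩
  · intro w
    have hcont : Continuous fun z => ∑ g ∈ G, m g z := by
      refine continuous_finset_sum _ fun g hg => ?_
      obtain ⟨ζ, h1, h2⟩ := hm g hg; exact h2.smooth.continuous
    have hI : IntegrableOn (fun z => (∑ g ∈ G, m g z) + Pf z) (ball w 9) :=
      ((hcont.add hf.continuous).locallyIntegrable.integrableOn_isCompact (isCompact_closedBall w 9)).mono_set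
        ball_subset_closedBall
    by_cases hw : ∃ ζ ∈ Z, ‖w - ζ‖ < 5
    · obtain ⟨ζ₀, hζ₀, hd⟩ := hw
      have hz : ‖ζ₀‖ ≤ 7 / 5 * L := by simpa using hζ₀.1
      obtain ⟨g, hg1, hg2, hg3⟩ := exists_lat ζ₀
      have hle : 7 / 5 * L + 1 ≤ Nn := Nat.le_ceil _
      have hgG : g ∈ G := by
        refine Finset.mem_filter.2 ⟨?_, ζ₀, hζ₀, hg1⟩
        have h3 : |(g.1:ℝ)| ≤ Nn := by linarith
        have h4 : |(g.2:ℝ)| ≤ Nn := by linarith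
        rw [abs_le] at h3 h4
        simp only [Finset.mem_product, Finset.mem_Icc]
        have h3' : -(Nn:ℤ) ≤ g.1 ∧ g.1 ≤ Nn := by exact_mod_cast h3
        have h4' : -(Nn:ℤ) ≤ g.2 ∧ g.2 ≤ Nn := by exact_mod_cast h4
        exact ⟨h3', h4'⟩
      calc 1 = ∫ z in ball w 9, m g z := by
            rw [← hone g hgG, setIntegral_eq_integral_of_forall_compl_eq_zero]
            intro z hz'
            by_contra h0
            have h1 := hmsupp g hgG z h0
            rw [mem_ball, dist_eq_norm, norm_sub_rev] at hz'
            have h2 := norm_add_le (w - ζ₀) (ζ₀ - lat g)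
            have h3 := norm_add_le (w - lat g) (lat g - z)
            rw [sub_add_sub_cancel] at h2 h3
            rw [norm_sub_rev] at h1
            linarith
        _ ≤ _ := by
            refine setIntegral_mono (hinteg g hgG).integrableOn hI fun z => ?_
            have := Finset.single_le_sum (fun g hg => hnn g hg z) hgG
            linarith [hf0 z]
    · push Not at hw
      have h1 : ∀ z ∈ ball w 1, (1:ℝ) ≤ (∑ g ∈ G, m g z) + Pf z := by
        intro z hz
        rw [hfone z]
        · linarith [Finset.sum_nonneg fun g hg => hnn g hg z]
        · intro ζ hζ
          have h2 := hw ζ hζ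
          have h3 := norm_add_le (w - z) (z - ζ)
          rw [sub_add_sub_cancel] at h3
          rw [mem_ball, dist_comm, dist_eq_norm] at hz
          linarith
      calc (1:ℝ) ≤ Real.pi := by linarith [Real.pi_gt_three]
        _ = ∫ z in ball w 1, (1:ℝ) := by simp [Measure.real]
        _ ≤ ∫ z in ball w 1, ((∑ g ∈ G, m g z) + Pf z) := by
            refine setIntegral_mono_on (by simp) (hI.mono_set (ball_subset_ball (by norm_num))) measurableSet_ball h1
        _ ≤ _ := by
            refine setIntegral_mono_set hI (Eventually.of_forall fun z => ?_) (ball_subset_ball (by norm_num)).eventuallyLE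
            exact add_nonneg (Finset.sum_nonneg fun g hg => hnn g hg z) (hf0 z)

/-- The kernel of the mean value formula `mean_value` at radius `10`. -/
def kr (y : ℂ) : ℝ := ∫ σ in Ioc (0:ℝ) 10, σ⁻¹ * wtK ((-σ)⁻¹ • y)

lemma kr_aux {σ : ℝ} (hσ : σ ∈ Ioc (0:ℝ) 10) {y : ℂ} (hy : y ≠ 0) :
    0 ≤ σ⁻¹ * wtK ((-σ)⁻¹ • y) ∧
    σ⁻¹ * wtK ((-σ)⁻¹ • y) ≤ σ ^ (-(1/2) : ℝ) * (ball (0:ℂ) 10).indicator (fun y => ‖y‖ ^ (-(1/2) : ℝ)) y := by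
  have h0 : 0 < σ := hσ.1
  have hy0 : 0 < ‖y‖ := norm_pos_iff.2 hy
  refine ⟨mul_nonneg (by positivity) (wtK_nonneg _), ?_⟩
  have hn : ‖(-σ)⁻¹ • y‖ = ‖y‖ / σ := by
    rw [norm_smul, norm_inv, norm_neg, Real.norm_of_nonneg h0.le]; field_simp
  rcases lt_or_ge ‖y‖ σ with h | h
  · rw [indicator_of_mem (by simpa using h.trans_le hσ.2)]
    calc σ⁻¹ * wtK ((-σ)⁻¹ • y) ≤ σ⁻¹ * 1 := by gcongr; exact wtK_le_one _
      _ = σ ^ (-(1/2) : ℝ) * σ ^ (-(1/2) : ℝ) := by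
        rw [← Real.rpow_add h0]; norm_num [Real.rpow_neg_one]
      _ ≤ σ ^ (-(1/2) : ℝ) * ‖y‖ ^ (-(1/2) : ℝ) := by
        refine mul_le_mul_of_nonneg_left (Real.rpow_le_rpow_of_nonpos hy0 h.le (by norm_num)) (by positivity)
  · rw [wtK_eq_zero, mul_zero]
    · exact mul_nonneg (by positivity) (indicator_nonneg (fun _ _ => by positivity) _)
    · rw [hn, le_div_iff₀ h0]; linarith

lemma integrableOn_rpow_aux : IntegrableOn (fun σ : ℝ => σ ^ (-(1/2) : ℝ)) (Ioc 0 10) :=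
  (intervalIntegrable_iff_integrableOn_Ioc_of_le (by norm_num)).1
    (intervalIntegral.intervalIntegrable_rpow' (by norm_num))

lemma kr_nonneg (y : ℂ) : 0 ≤ kr y :=
  setIntegral_nonneg measurableSet_Ioc fun σ hσ =>
    mul_nonneg (inv_nonneg.2 hσ.1.le) (wtK_nonneg _)

lemma kr_le {y : ℂ} (hy : y ≠ 0) : kr y ≤ 7 * (ball (0:ℂ) 10).indicator (fun y => ‖y‖ ^ (-(1/2) : ℝ)) y := by
  have h1 : kr y ≤ ∫ σ in Ioc (0:ℝ) 10, σ ^ (-(1/2) : ℝ) * (ball (0:ℂ) 10).indicator (fun y => ‖y‖ ^ (-(1/2) : ℝ)) y := by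
    refine integral_mono_of_nonneg ?_ (integrableOn_rpow_aux.mul_const _) ?_
    · exact (ae_restrict_mem measurableSet_Ioc).mono fun σ hσ => (kr_aux hσ hy).1
    · exact (ae_restrict_mem measurableSet_Ioc).mono fun σ hσ => (kr_aux hσ hy).2
  refine h1.trans ?_
  rw [integral_mul_const, ← intervalIntegral.integral_of_le (by norm_num), integral_rpow (by norm_num)]
  refine mul_le_mul_of_nonneg_right ?_ (indicator_nonneg (fun _ _ => by positivity) _)
  norm_num
  rw [← Real.sqrt_eq_rpow]
  have : √10 ≤ 7 / 2 := Real.sqrt_le_iff.2 (by norm_num)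
  linarith

lemma integrable_indicator_rpow :
    Integrable ((ball (0:ℂ) 10).indicator fun y => ‖y‖ ^ (-(1/2) : ℝ)) := by
  rw [integrable_indicator_iff measurableSet_ball]
  simpa using integrableOn_ball_norm_rpow (a := 1/2) (s := 10) (by norm_num) (0:ℂ)

lemma integrable_kr_aux {g : ℂ → ℝ} (hg : Continuous g) {B : ℝ} (hB : ∀ z, |g z| ≤ B) (w : ℂ) :
    Integrable (fun q : ℝ × ℂ => q.1⁻¹ * wtK ((-q.1)⁻¹ • q.2) * g (w - q.2))
      ((volume.restrict (Ioc 0 10)).prod volume) := by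
  have hI := ((integrableOn_rpow_aux.const_mul B).mul_prod integrable_indicator_rpow)
  have e : (volume : Measure ℂ) = volume.restrict {0}ᶜ := (restrict_compl_singleton (μ := volume) (0:ℂ)).symm
  rw [e, Measure.prod_restrict] at hI ⊢
  have hw := continuous_wtK.measurable
  have hgm := hg.measurable
  refine hI.mono' (Measurable.aestronglyMeasurable (by fun_prop)) ?_
  refine ae_restrict_of_forall_mem (measurableSet_Ioc.prod (measurableSet_singleton _).compl) ?_
  rintro ⟨σ, y⟩ ⟨hσ, hy⟩
  have h := kr_aux hσ hy
  dsimp only at h ⊢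
  rw [Real.norm_eq_abs, abs_mul, abs_of_nonneg h.1]
  calc _ ≤ _ := mul_le_mul h.2 (hB (w - y)) (abs_nonneg _) (h.1.trans h.2)
    _ = _ := by ring

lemma integrable_kr_mul {g : ℂ → ℝ} (hg : Continuous g) {B : ℝ} (hB : ∀ z, |g z| ≤ B) (w : ℂ) :
    Integrable fun t => kr t * g (w - t) := by
  refine (integrable_kr_aux hg hB w).integral_prod_right.congr (Eventually.of_forall fun t => ?_)
  simp only [kr, integral_mul_const]

lemma integrable_kr : Integrable kr := by
  simpa using integrable_kr_mul (g := fun _ => 1) continuous_const (B := 1) (by simp) 0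

lemma cv_kr {g : ℂ → ℝ} (hg : Continuous g) {B : ℝ} (hB : ∀ z, |g z| ≤ B) (w : ℂ) :
    cv kr g w = ∫ σ in (0:ℝ)..10, σ * ∫ x, g (w + σ * x) * wtK x := by
  have h := integral_integral_swap
    (f := fun (σ : ℝ) (t : ℂ) => σ⁻¹ * wtK ((-σ)⁻¹ • t) * g (w - t)) (integrable_kr_aux hg hB w)
  rw [intervalIntegral.integral_of_le (by norm_num), cv]
  have e : ∀ t, kr t * g (w - t) = ∫ σ in Ioc (0:ℝ) 10, σ⁻¹ * wtK ((-σ)⁻¹ • t) * g (w - t) := by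
    intro t; simp only [kr, integral_mul_const]
  simp_rw [e]
  rw [← h]
  refine setIntegral_congr_fun measurableSet_Ioc fun σ hσ => ?_
  have h0 : 0 < σ := hσ.1
  have h2 := Measure.integral_comp_smul volume (fun t : ℂ => σ⁻¹ * wtK ((-σ)⁻¹ • t) * g (w - t)) (-σ)
  have h3 : ∀ x : ℂ, σ⁻¹ * wtK ((-σ)⁻¹ • (-σ) • x) * g (w - (-σ) • x) = σ⁻¹ * (g (w + σ * x) * wtK x) := by
    intro x
    rw [smul_smul, inv_mul_cancel₀ (by linarith), one_smul]
    simp; ring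
  simp only [h3, integral_const_mul, Complex.finrank_real_complex, smul_eq_mul] at h2
  rw [abs_of_nonneg (by positivity)] at h2
  field_simp at h2 ⊢
  linarith

lemma lp_cv_kr {p : ℂ → ℝ} (hp : ContDiff ℝ ∞ p) (hc : HasCompactSupport p) (w : ℂ) :
    lp (cv kr p) w = (∫ x, p (w + 10 * x) * wt x) - p w * wtM := by
  have h1 : Continuous (lp p) := (contDiff_lp hp).continuous
  have h2 : HasCompactSupport (lp p) :=
    ((hc.fderiv_apply ℝ 1).fderiv_apply ℝ 1).add ((hc.fderiv_apply ℝ I).fderiv_apply ℝ I)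
  obtain ⟨B, hB⟩ := h1.bounded_above_of_compact_support h2
  rw [lp_cv integrable_kr.locallyIntegrable hp hc, cv_kr h1 hB]
  have := mean_value hp w (s := 10) (by norm_num)
  push_cast at this
  linarith

namespace Charge
variable {L : ℝ} {U : ℂ → ℝ} {n : ℕ} {Pn Pf : ℂ → ℝ}

lemma smooth (h : Charge L U n Pn Pf) : ContDiff ℝ ∞ fun z => Pn z + Pf z := h.smooth_n.add h.smooth_f

lemma nonneg (h : Charge L U n Pn Pf) (z : ℂ) : 0 ≤ Pn z + Pf z := add_nonneg (h.nonneg_n z) (h.nonneg_f z)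

lemma cpt (h : Charge L U n Pn Pf) : HasCompactSupport fun z => Pn z + Pf z - 1 := by
  have := h.cpt_n.add h.cpt_f
  have e : (fun z => Pn z + Pf z - 1) = Pn + fun z => Pf z - 1 := by
    ext z; simp only [Pi.add_apply]; ring
  rwa [e]

lemma bdd (h : Charge L U n Pn Pf) : ∃ B, ∀ z, |Pn z + Pf z| ≤ B := by
  obtain ⟨B, hB⟩ := ((h.smooth.continuous).sub continuous_const).bounded_above_of_compact_support h.cpt
  refine ⟨B + 1, fun z => ?_⟩
  have h1 := hB z
  rw [Real.norm_eq_abs] at h1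
  dsimp only [Pi.sub_apply] at h1
  have := abs_add_le (Pn z + Pf z - 1) 1
  rw [sub_add_cancel, abs_one] at this
  linarith

lemma cv_kr_le (h : Charge L U n Pn Pf) (w : ℂ) : cv kr (fun z => Pn z + Pf z) w ≤ 7 * (CP + 200) := by
  obtain ⟨B, hB⟩ := h.bdd
  have hcont := h.smooth.continuous
  have hI := integrable_kr_mul hcont hB w
  rw [cv, integral_eq_lintegral_of_nonneg_ae
    (Eventually.of_forall fun t => mul_nonneg (kr_nonneg t) (h.nonneg _)) hI.aestronglyMeasurable]
  refine ENNReal.toReal_le_of_le_ofReal (by norm_num [CP]) ?_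
  rw [← lintegral_sub_left_eq_self _ w]
  have h1 : ∀ᵐ t, ENNReal.ofReal (kr (w - t) * (Pn (w - (w - t)) + Pf (w - (w - t)))) ≤
      (ball w 10).indicator (fun t => 7 * ENNReal.ofReal (Pn t * ‖w - t‖ ^ (-(1/2) : ℝ)) +
        7 * ENNReal.ofReal (‖w - t‖ ^ (-(1/2) : ℝ))) t := by
    have : ∀ᵐ t : ℂ, t ≠ w := by simp [ae_iff]
    filter_upwards [this] with t ht
    have h2 := kr_le (sub_ne_zero.2 ht.symm)
    rw [sub_sub_cancel]
    by_cases hb : t ∈ ball w 10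
    · rw [indicator_of_mem (by rwa [mem_ball_zero_iff, ← dist_eq_norm, dist_comm])] at h2
      rw [indicator_of_mem hb, ← ENNReal.ofReal_ofNat, ← ENNReal.ofReal_mul (by norm_num), ← ENNReal.ofReal_mul (by norm_num),
        ← ENNReal.ofReal_add (mul_nonneg (by norm_num) (mul_nonneg (h.nonneg_n t) (by positivity))) (by positivity)]
      refine ENNReal.ofReal_le_ofReal ?_
      calc kr (w - t) * (Pn t + Pf t) ≤ (7 * ‖w - t‖ ^ (-(1/2) : ℝ)) * (Pn t + 1) := by
            refine mul_le_mul h2 (by linarith [h.le_one_f t]) (h.nonneg t) (by positivity)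
        _ = _ := by ring
    · rw [indicator_of_notMem (by rwa [mem_ball_zero_iff, ← dist_eq_norm, dist_comm])] at h2
      have h3 : kr (w - t) = 0 := le_antisymm (by linarith) (kr_nonneg _)
      simp [h3]
  refine (lintegral_mono_ae h1).trans ?_
  rw [lintegral_indicator measurableSet_ball, lintegral_add_right, lintegral_const_mul' _ _ (by simp),
    lintegral_const_mul' _ _ (by simp)]
  · have h3 : ∫⁻ t in ball w 10, ENNReal.ofReal (‖w - t‖ ^ (-(1/2) : ℝ)) ≤ ENNReal.ofReal 200 := by
      have e : ∫⁻ t in ball w 10, ENNReal.ofReal (‖w - t‖ ^ (-(1/2) : ℝ)) =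
          ∫⁻ z in ball (0:ℂ) 10, ENNReal.ofReal (‖z‖ ^ (-(1/2) : ℝ)) := by
        rw [← lintegral_indicator measurableSet_ball, ← lintegral_indicator measurableSet_ball,
          ← lintegral_sub_left_eq_self ((ball (0:ℂ) 10).indicator fun z => ENNReal.ofReal (‖z‖ ^ (-(1/2) : ℝ))) w]
        congr 1; ext ζ
        simp [indicator, dist_eq_norm, norm_sub_rev]
      rw [e, lintegral_ball_norm_rpow (by norm_num) (by norm_num)]
      refine ENNReal.ofReal_le_ofReal ?_
      have : (10:ℝ) ^ (2 - 1/2 : ℝ) ≤ 10 * (10/3) := by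
        rw [show (2 - 1/2 : ℝ) = 1 + 1/2 by norm_num, Real.rpow_add (by norm_num), Real.rpow_one, ← Real.sqrt_eq_rpow]
        gcongr
        exact Real.sqrt_le_iff.2 (by norm_num)
      calc 2 * Real.pi / (2 - 1/2) * (10:ℝ) ^ (2 - 1/2 : ℝ) ≤ 2 * 3.15 / (2 - 1/2) * (10 * (10/3)) := by
            gcongr; linarith [Real.pi_lt_d2]
        _ ≤ 200 := by norm_num
    have h4 := (lintegral_mono_set (ball_subset_ball (by norm_num : (10:ℝ) ≤ 20))).trans (h.half w)
    rw [mul_add, ENNReal.ofReal_add (by norm_num [CP]) (by norm_num), ENNReal.ofReal_mul (by norm_num),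
      ENNReal.ofReal_mul (by norm_num), ENNReal.ofReal_ofNat]
    gcongr
  · fun_prop

lemma avg_ge (h : Charge L U n Pn Pf) (w : ℂ) :
    1 / 10 ^ 4 ≤ ∫ x : ℂ, (Pn (w + 10 * x) + Pf (w + 10 * x)) * wt x := by
  have hcont := h.smooth.continuous
  set P : ℂ → ℝ := fun z => Pn z + Pf z with hP
  set f : ℂ → ℝ := (ball w 9).indicator P with hf
  have hIf : Integrable f := by
    rw [hf, integrable_indicator_iff measurableSet_ball]
    exact (hcont.locallyIntegrable.integrableOn_isCompact (isCompact_closedBall w 9)).mono_set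
        ball_subset_closedBall
  have e1 : ∫ x : ℂ, f (w + (10:ℝ) • x) = 1 / 100 * ∫ z in ball w 9, P z := by
    rw [Measure.integral_comp_smul volume (fun z : ℂ => f (w + z)) 10, integral_add_left_eq_self,
      hf, integral_indicator measurableSet_ball, Complex.finrank_real_complex, abs_of_nonneg (by positivity)]
    norm_num
  have h1 : 1 ≤ ∫ z in ball w 9, P z := h.lower w
  have h2 : ∫ x : ℂ, 1 / 100 * f (w + (10:ℝ) • x) ≤ ∫ x : ℂ, P (w + 10 * x) * wt x := by
    refine integral_mono ((((hIf.comp_add_left w).comp_smul (R := (10:ℝ)) (by norm_num))).const_mul _)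
      (integrable_mul_wt (g := fun x => P (w + 10 * x)) (by fun_prop)) fun x => ?_
    have e2 : w + (10:ℝ) • x = w + 10 * x := by simp
    dsimp only
    rw [e2]
    by_cases hx : w + 10 * x ∈ ball w 9
    · rw [hf, indicator_of_mem hx, mul_comm]
      refine mul_le_mul_of_nonneg_left ?_ (h.nonneg _)
      have hx' : ‖x‖ ≤ 9 / 10 := by
        rw [mem_ball, dist_eq_norm, add_sub_cancel_left, norm_mul] at hx
        norm_num at hx; linarith
      have := wt_ge (by norm_num) hx'
      norm_num at this ⊢; exact this
    · rw [hf, indicator_of_notMem hx, mul_zero]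
      exact mul_nonneg (h.nonneg _) (wt_nonneg _)
  rw [integral_const_mul, e1] at h2
  refine le_trans ?_ h2
  linarith

end Charge

/-- A uniformly positive supersolution for a charge potential. -/
lemma exists_super : ∃ κ > 0, ∃ c₀ > 0, ∀ L U n Pn Pf, Charge L U n Pn Pf → ∃ H : ℂ → ℝ,
    ContDiff ℝ ∞ H ∧ (∀ z, 1 / 2 ≤ H z) ∧ (∀ z, H z ≤ 1) ∧ (∃ B, ∀ z, |lp H z| ≤ B) ∧
    ∀ z, c₀ ≤ - lp H z + κ * (Pn z + Pf z) * H z := by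
  set N₀ := 7 * (CP + 200) with hN₀
  have hN0 : 0 < N₀ := by norm_num [hN₀, CP]
  set η := 1 / (2 * N₀) with hη
  have hη0 : 0 < η := by positivity
  refine ⟨2 * η * wtM, mul_pos (by positivity) wtM_pos, η / 10 ^ 4, by positivity, fun L U n Pn Pf h => ?_⟩
  set p : ℂ → ℝ := fun z => Pn z + Pf z - 1 with hp
  have hps : ContDiff ℝ ∞ p := h.smooth.sub contDiff_const
  have hpc : HasCompactSupport p := h.cpt
  obtain ⟨B, hB⟩ := h.bdd
  have hcont := h.smooth.continuous
  have hNe : ∀ w, cv kr (fun z => Pn z + Pf z) w = (∫ t, kr t) + cv kr p w := by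
    intro w
    simp only [cv, hp]
    rw [← integral_add integrable_kr (integrable_cv (𝕜 := ℝ) integrable_kr.locallyIntegrable hps.continuous hpc w)]
    congr 1; ext t; simp only [hp]; ring
  have hNs := contDiff_cv (𝕜 := ℝ) integrable_kr.locallyIntegrable hps hpc
  have hlp : ∀ w, lp (fun w => 1 - η * ((∫ t, kr t) + cv kr p w)) w =
      - η * ((∫ x, (Pn (w + 10 * x) + Pf (w + 10 * x)) * wt x) - (Pn w + Pf w) * wtM) := by
    intro w
    have e : (fun w => 1 - η * ((∫ t, kr t) + cv kr p w)) = fun w => (1 - η * ∫ t, kr t) + (-η) * cv kr p w := by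
      ext w; ring
    rw [e, lp_add contDiff_const (contDiff_const.mul hNs), lp_const, lp_const_mul hNs, lp_cv_kr hps hpc, zero_add]
    congr 1
    have : ∀ x, p (w + 10 * x) * wt x = (Pn (w + 10 * x) + Pf (w + 10 * x)) * wt x - wt x := fun x => by
      simp only [hp]; ring
    simp_rw [this]
    rw [integral_sub (integrable_mul_wt (g := fun x : ℂ => Pn (w + 10 * x) + Pf (w + 10 * x))
      (hcont.comp (by fun_prop : Continuous fun x : ℂ => w + 10 * x))) integrable_wt]
    simp only [hp, wtM]; ring
  have hHle : ∀ z, 0 ≤ (∫ t, kr t) + cv kr p z ∧ (∫ t, kr t) + cv kr p z ≤ N₀ := by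
    intro z
    rw [← hNe]
    exact ⟨integral_nonneg fun t => mul_nonneg (kr_nonneg t) (h.nonneg _), h.cv_kr_le z⟩
  have hhalf : η * N₀ = 1 / 2 := by rw [hη]; field_simp
  refine ⟨fun w => 1 - η * ((∫ t, kr t) + cv kr p w), ?_, ?_, ?_, ?_, ?_⟩
  · exact contDiff_const.sub (contDiff_const.mul (contDiff_const.add hNs))
  · intro z
    linarith [mul_le_mul_of_nonneg_left (hHle z).2 hη0.le]
  · intro z
    linarith [mul_nonneg hη0.le (hHle z).1]
  · refine ⟨η * (B * wtM + B * wtM), fun w => ?_⟩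
    rw [hlp, abs_mul, abs_neg, abs_of_pos hη0]
    gcongr
    refine (abs_sub _ _).trans ?_
    rw [abs_mul (Pn w + Pf w), abs_of_pos wtM_pos]
    gcongr
    · rw [wtM, ← integral_const_mul, ← Real.norm_eq_abs]
      refine norm_integral_le_of_norm_le (integrable_wt.const_mul _) (Eventually.of_forall fun x => ?_)
      rw [Real.norm_eq_abs, abs_mul, abs_of_nonneg (wt_nonneg x)]
      gcongr
      · exact wt_nonneg x
      · exact hB _
    · exact wtM_pos.le
    · exact hB w
  · intro z
    rw [hlp]
    have h1 := h.avg_ge z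
    have h2 : 0 ≤ (Pn z + Pf z) * wtM := mul_nonneg (h.nonneg z) wtM_pos.le
    have h3 := mul_le_mul_of_nonneg_left (hHle z).2 hη0.le
    have h4 := mul_nonneg (mul_nonneg hη0.le h2) (by linarith : 0 ≤ 1 - 2 * (η * ((∫ t, kr t) + cv kr p z)))
    have h5 := mul_le_mul_of_nonneg_left h1 hη0.le
    calc η / 10 ^ 4 = η * (1 / 10 ^ 4) := by ring
      _ ≤ _ := by linarith

open SchwartzMap in
lemma schwartz_tendsto (f : 𝓢(ℂ, ℝ)) : Tendsto f (cocompact ℂ) (𝓝 0) := by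
  have h1 := f.isBigO_cocompact_rpow (-1)
  refine h1.trans_tendsto ?_
  exact (tendsto_rpow_neg_atTop (y := 1) one_pos).comp (tendsto_norm_cocompact_atTop (E := ℂ))

/-- One-sided maximum principle with a positive strict supersolution. -/
lemma le_super_of_residual_le {q ψ H : ℂ → ℝ} (hψ : ContDiff ℝ ∞ ψ) (hH : ContDiff ℝ ∞ H)
    (hH2 : ∀ z, 1 / 2 ≤ H z) (ht : Tendsto ψ (cocompact ℂ) (𝓝 0)) {a : ℝ} (ha : 0 ≤ a)
    (hg : ∀ z, 0 < - lp H z + q z * H z)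
    (hr : ∀ z, - lp ψ z + q z * ψ z ≤ a * (- lp H z + q z * H z)) (z : ℂ) :
    ψ z ≤ a * H z := by
  by_contra! hc
  have hHp : ∀ z, 0 < H z := fun z => by linarith [hH2 z]
  set R : ℂ → ℝ := fun z => ψ z / H z with hR
  have hRc : Continuous R := hψ.continuous.div hH.continuous fun z => (hHp z).ne'
  have hRz : a < R z := by rw [hR]; exact (lt_div_iff₀ (hHp z)).2 hc
  have hRt : Tendsto R (cocompact ℂ) (𝓝 0) := by
    refine squeeze_zero_norm (a := fun z => 2 * ‖ψ z‖) (fun z => ?_) (by simpa using ht.norm.const_mul 2)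
    rw [hR, norm_div, Real.norm_of_nonneg (hHp z).le, div_le_iff₀ (hHp z)]
    nlinarith [norm_nonneg (ψ z), hH2 z]
  obtain ⟨y, hy⟩ := hRc.exists_forall_ge' z
    ((hRt.eventually (gt_mem_nhds (ha.trans_lt hRz))).mono fun x hx => hx.le)
  set t := R y with htdef
  have hta : a < t := hRz.trans_le (hy z)
  have hv : ContDiff ℝ ∞ (fun z => t * H z) := contDiff_const.mul hH
  have hm : IsLocalMin (fun z => t * H z + (-1) * ψ z) y := by
    refine Eventually.of_forall fun x => ?_
    have h1 : ψ x ≤ t * H x := (div_le_iff₀ (hHp x)).1 (hy x)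
    have h2 : ψ y = t * H y := ((div_eq_iff (hHp y).ne').1 htdef.symm)
    show t * H y + (-1) * ψ y ≤ t * H x + (-1) * ψ x
    linarith
  have hl := lp_nonneg_of_isLocalMin (hv.add (contDiff_const.mul hψ)) hm
  rw [lp_add hv (contDiff_const.mul hψ), lp_const_mul hH _, lp_const_mul hψ _] at hl
  have h2 : ψ y = t * H y := ((div_eq_iff (hHp y).ne').1 htdef.symm)
  have h3 := hr y
  rw [h2] at h3
  have h4 : 0 < (t - a) * (- lp H y + q y * H y) := mul_pos (by linarith) (hg y)
  nlinarith

lemma abs_le_super_of_residual_le {q ψ H : ℂ → ℝ} (hψ : ContDiff ℝ ∞ ψ) (hH : ContDiff ℝ ∞ H)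
    (hH2 : ∀ z, 1 / 2 ≤ H z) (ht : Tendsto ψ (cocompact ℂ) (𝓝 0)) {a : ℝ} (ha : 0 ≤ a)
    (hg : ∀ z, 0 < - lp H z + q z * H z)
    (hr : ∀ z, |- lp ψ z + q z * ψ z| ≤ a * (- lp H z + q z * H z)) (z : ℂ) :
    |ψ z| ≤ a * H z := by
  refine abs_le.2 ⟨?_, le_super_of_residual_le hψ hH hH2 ht ha hg (fun z => (abs_le.1 (hr z)).2) z⟩
  have := le_super_of_residual_le (ψ := fun z => (-1) * ψ z) (contDiff_const.mul hψ) hH hH2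
    (by simpa using ht.const_mul (-1)) ha hg (fun z => by
      rw [lp_const_mul hψ _]; linarith [(abs_le.1 (hr z)).1]) z
  linarith

open SchwartzMap in
lemma exists_resolvent {Λ : ℝ} (hΛ : 0 < Λ) (r : 𝓢(ℂ, ℝ)) :
    ∃ ψ : 𝓢(ℂ, ℝ), ∀ z, Λ * ψ z - lp ψ z = r z := by
  set R : 𝓢(ℂ, ℂ) := r.postcompCLM (𝕜 := ℝ) Complex.ofRealCLM with hR
  set b : ℝ := 2 * Real.pi / √Λ with hb
  have hb2 : b ^ 2 = (2 * Real.pi) ^ 2 / Λ := by rw [hb, div_pow, Real.sq_sqrt hΛ.le]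
  set g : ℂ → ℝ := fun ξ => Λ⁻¹ * (1 + ‖b • ξ‖ ^ 2) ^ (-1 : ℝ) with hg
  have hgt : g.HasTemperateGrowth := by
    have h1 : (fun ξ : ℂ => (1 + ‖b • ξ‖ ^ 2) ^ (-1 : ℝ)).HasTemperateGrowth :=
      (Function.hasTemperateGrowth_one_add_norm_sq_rpow ℂ (-1)).comp
        ((b • ContinuousLinearMap.id ℝ ℂ).hasTemperateGrowth)
    exact (Function.HasTemperateGrowth.const Λ⁻¹).mul h1
  set m : ℂ → ℝ := fun ξ => ‖ξ‖ ^ 2 with hm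
  have hmt : m.HasTemperateGrowth := by rw [hm]; fun_prop
  set G : 𝓢(ℂ, ℂ) := fourierMultiplierCLM ℂ g R with hG
  have hprod : g * m = fun ξ => ((2 * Real.pi) ^ 2)⁻¹ * (1 - Λ * g ξ) := by
    funext ξ
    have hpos : 0 < 1 + ‖b • ξ‖ ^ 2 := by positivity
    have hp : (2 * Real.pi) ^ 2 ≠ 0 := by positivity
    simp only [hg, hm, Pi.mul_apply, Real.rpow_neg_one]
    have h2 : ‖b • ξ‖ ^ 2 = (2 * Real.pi) ^ 2 / Λ * ‖ξ‖ ^ 2 := by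
      rw [norm_smul, mul_pow, Real.norm_eq_abs, sq_abs, hb2]
    rw [h2] at hpos ⊢
    have h3 : Λ + (2 * Real.pi) ^ 2 * ‖ξ‖ ^ 2 ≠ 0 := by positivity
    have h4 : 1 + (2 * Real.pi) ^ 2 / Λ * ‖ξ‖ ^ 2 = (Λ + (2 * Real.pi) ^ 2 * ‖ξ‖ ^ 2) / Λ := by
      field_simp
    rw [h4, inv_div]
    field_simp
    ring
  have hlap : ∀ z, Λ * G z - (Δ G : 𝓢(ℂ, ℂ)) z = R z := by
    intro z
    have e1 : fourierMultiplierCLM ℂ m G = ((2 * Real.pi) ^ 2)⁻¹ • (R - Λ • G) := by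
      rw [hG, fourierMultiplierCLM_fourierMultiplierCLM_apply hmt hgt, mul_comm, hprod]
      have e2 : (fun ξ => ((2 * Real.pi) ^ 2)⁻¹ * (1 - Λ * g ξ)) =
          ((2 * Real.pi) ^ 2)⁻¹ • (∑ i ∈ (Finset.univ : Finset Bool),
            (if i then (fun _ => (1 : ℝ)) else (-Λ) • g) ·) := by
        funext ξ
        simp [sub_eq_add_neg]
      have hgi : ∀ i ∈ (Finset.univ : Finset Bool),
          (if i then (fun _ => (1 : ℝ)) else (-Λ) • g : ℂ → ℝ).HasTemperateGrowth := by
        intro i _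
        cases i
        · exact (Function.HasTemperateGrowth.const (-Λ)).mul hgt
        · exact Function.HasTemperateGrowth.const 1
      have hsum : (∑ i ∈ (Finset.univ : Finset Bool),
            (if i then (fun _ => (1 : ℝ)) else (-Λ) • g : ℂ → ℝ) ·).HasTemperateGrowth :=
        Function.HasTemperateGrowth.sum hgi
      rw [e2, fourierMultiplierCLM_smul hsum, fourierMultiplierCLM_sum ℂ hgi]
      simp only [Fintype.sum_bool, if_true, Bool.false_eq_true, if_false]
      rw [fourierMultiplierCLM_smul hgt, fourierMultiplierCLM_const]
      ext x
      simp
      ring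
    have e3 := laplacian_eq_fourierMultiplierCLM G
    have e4 : (fourierMultiplierCLM ℂ (‖·‖ ^ 2) G : 𝓢(ℂ, ℂ)) = fourierMultiplierCLM ℂ m G := rfl
    rw [e3, e4, e1]
    have hp : ((2 * Real.pi : ℝ) : ℂ) ^ 2 ≠ 0 := by
      norm_cast; positivity
    simp
  refine ⟨G.postcompCLM (𝕜 := ℝ) Complex.reCLM, fun z => ?_⟩
  have h5 := hlap z
  have h6 : lp (G.postcompCLM (𝕜 := ℝ) Complex.reCLM) z = ((Δ G : 𝓢(ℂ, ℂ)) z).re := by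
    have hs : ContDiff ℝ ∞ (G.postcompCLM (𝕜 := ℝ) Complex.reCLM) := SchwartzMap.smooth _ _
    have h7 : ((Δ G : 𝓢(ℂ, ℂ)) z).re = Δ (Complex.reCLM ∘ G) z := by
      rw [ContDiffAt.laplacian_CLM_comp_left, SchwartzMap.laplacian_apply]
      · rfl
      · exact (G.smooth 2).contDiffAt
    have h8 : (Complex.reCLM ∘ G) = ⇑(G.postcompCLM (𝕜 := ℝ) Complex.reCLM) := by
      funext x; simp [SchwartzMap.postcompCLM_apply]
    rw [h7, h8, InnerProductSpace.laplacian_eq_iteratedFDeriv_complexPlane]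
    have hd : DifferentiableAt ℝ (fderiv ℝ (G.postcompCLM (𝕜 := ℝ) Complex.reCLM)) z :=
      (hs.fderiv_right (m := 1) (by norm_cast)).differentiable (by norm_num) z
    simp only [iteratedFDeriv_two_apply, lp]
    simp only [Matrix.cons_val_zero, Matrix.cons_val_one]
    rw [fderiv_clm_apply hd (differentiableAt_const _), fderiv_clm_apply hd (differentiableAt_const _)]
    simp
  have h9 := congrArg Complex.re h5
  rw [h6]
  simpa [hR, SchwartzMap.postcompCLM_apply] using h9

lemma HasCompactSupport.temperate_const_add {p : ℂ → ℝ} (hp : ContDiff ℝ ∞ p)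
    (hc : HasCompactSupport p) (c : ℝ) : (fun z => c + p z).HasTemperateGrowth :=
  (Function.HasTemperateGrowth.const c).add (hc.hasTemperateGrowth hp)

open SchwartzMap in
/-- Approximate solvability of `-Δψ + qψ = r₀` for a constant-plus-compactly-supported potential
admitting a positive supersolution. -/
lemma exists_approx_solution {p H : ℂ → ℝ} {c c₀ B : ℝ} (hp : ContDiff ℝ ∞ p)
    (hpc : HasCompactSupport p) (hH : ContDiff ℝ ∞ H) (hH2 : ∀ z, 1 / 2 ≤ H z)
    (hH1 : ∀ z, H z ≤ 1) (hB : ∀ z, |lp H z| ≤ B) (hc₀ : 0 < c₀)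
    (hg : ∀ z, c₀ ≤ - lp H z + (c + p z) * H z) (r₀ : 𝓢(ℂ, ℝ)) {b : ℝ} (hb : ∀ z, |r₀ z| ≤ b)
    {err : ℝ} (herr : 0 < err) :
    ∃ ψ : 𝓢(ℂ, ℝ), (∀ z, |- lp ψ z + (c + p z) * ψ z - r₀ z| ≤ err) ∧
      ∀ z, |ψ z| ≤ (b + err) / c₀ := by
  obtain ⟨K, hK⟩ := hpc.exists_bound_of_continuous hp.continuous
  have hK0 : 0 ≤ K := (norm_nonneg _).trans (hK 0)
  set Λ : ℝ := |c| + K + 1 with hΛ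
  have hΛ0 : 0 < Λ := by positivity
  have hq : ∀ z, 0 ≤ Λ - (c + p z) := fun z => by
    have := hK z
    rw [Real.norm_eq_abs] at this
    linarith [le_abs_self c, le_abs_self (p z)]
  set g : ℂ → ℝ := fun z => - lp H z + Λ * H z with hgd
  have hB0 : 0 ≤ B := (abs_nonneg _).trans (hB 0)
  set M := B + Λ with hM
  have hM0 : 0 < M := by positivity
  have hgc : ∀ z, c₀ ≤ g z := fun z => by
    have h1 := mul_nonneg (hq z) (by linarith [hH2 z] : 0 ≤ H z)
    have := hg z
    simp only [hgd]; linarith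
  have hgM : ∀ z, g z ≤ M := fun z => by
    have h1 := mul_nonneg hΛ0.le (by linarith [hH1 z] : 0 ≤ 1 - H z)
    have h2 := neg_abs_le (lp H z)
    have := hB z
    simp only [hgd, hM]; linarith
  have hcM : c₀ ≤ M := (hgc 0).trans (hgM 0)
  set ρ := 1 - c₀ / M with hρ
  have hρ0 : 0 ≤ ρ := by rw [hρ, sub_nonneg, div_le_one hM0]; exact hcM
  have hρ1 : ρ < 1 := by rw [hρ]; linarith [div_pos hc₀ hM0]
  have hb0 : 0 ≤ b := (abs_nonneg _).trans (hb 0)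
  have hqt := HasCompactSupport.temperate_const_add hp hpc
  have hmt : (fun z => Λ - (c + p z)).HasTemperateGrowth :=
    (Function.HasTemperateGrowth.const Λ).sub (hqt c)
  have key : ∀ N : ℕ, ∃ ψ r : 𝓢(ℂ, ℝ), (∀ z, - lp ψ z + (c + p z) * ψ z + r z = r₀ z) ∧
      ∀ z, |r z| ≤ b / c₀ * ρ ^ N * g z := by
    intro N
    induction N with
    | zero =>
      refine ⟨0, r₀, fun z => ?_, fun z => ?_⟩
      · have : lp (⇑(0 : 𝓢(ℂ, ℝ))) z = 0 := lp_const 0 z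
        rw [this]; simp
      · refine (hb z).trans ?_
        rw [pow_zero, mul_one, div_mul_eq_mul_div, le_div_iff₀ hc₀]
        exact mul_le_mul_of_nonneg_left (hgc z) hb0
    | succ N ih =>
      obtain ⟨ψ, r, h1, h2⟩ := ih
      obtain ⟨G, hG⟩ := exists_resolvent hΛ0 r
      set a := b / c₀ * ρ ^ N with ha
      have ha0 : 0 ≤ a := by positivity
      have hGa : ∀ z, |G z| ≤ a * H z :=
        abs_le_super_of_residual_le (q := fun _ => Λ) (G.smooth _) hH hH2 (schwartz_tendsto G) ha0
          (fun z => hc₀.trans_le (hgc z)) (fun z => by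
            have : - lp G z + Λ * G z = r z := by linarith [hG z]
            rw [this]; exact h2 z)
      refine ⟨ψ + G, smulLeftCLM ℝ (fun z => Λ - (c + p z)) G, fun z => ?_, fun z => ?_⟩
      · have : lp (⇑(ψ + G)) z = lp ψ z + lp G z := lp_add (ψ.smooth _) (G.smooth _) z
        rw [this, smulLeftCLM_apply_apply hmt, SchwartzMap.add_apply, smul_eq_mul]
        linarith [h1 z, hG z]
      · rw [smulLeftCLM_apply_apply hmt, smul_eq_mul, abs_mul, abs_of_nonneg (hq z)]
        have h3 := mul_le_mul_of_nonneg_left (hGa z) (hq z)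
        have h4 : (Λ - (c + p z)) * (a * H z) ≤ a * (g z - c₀) := by
          have := mul_le_mul_of_nonneg_left (hg z) ha0
          simp only [hgd]; linarith
        have h5 : a * (g z - c₀) ≤ a * (ρ * g z) := by
          refine mul_le_mul_of_nonneg_left ?_ ha0
          have : c₀ / M * g z ≤ c₀ := by
            rw [div_mul_eq_mul_div, div_le_iff₀ hM0]
            exact mul_le_mul_of_nonneg_left (hgM z) hc₀.le
          rw [hρ]; linarith
        calc _ ≤ a * (ρ * g z) := h3.trans (h4.trans h5)
          _ = b / c₀ * ρ ^ (N + 1) * g z := by rw [ha]; ring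
  have hlim : Tendsto (fun N : ℕ => b / c₀ * ρ ^ N * M) atTop (𝓝 (b / c₀ * 0 * M)) :=
    ((tendsto_pow_atTop_nhds_zero_of_lt_one hρ0 hρ1).const_mul _).mul_const _
  rw [mul_zero, zero_mul] at hlim
  obtain ⟨N, hN⟩ := (hlim.eventually (gt_mem_nhds herr)).exists
  obtain ⟨ψ, r, h1, h2⟩ := key N
  have hr : ∀ z, |r z| ≤ err := fun z => (h2 z).trans
    ((mul_le_mul_of_nonneg_left (hgM z) (by positivity)).trans hN.le)
  refine ⟨ψ, fun z => ?_, fun z => ?_⟩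
  · have : - lp ψ z + (c + p z) * ψ z - r₀ z = - r z := by linarith [h1 z]
    rw [this, abs_neg]; exact hr z
  · have h0 : 0 ≤ (b + err) / c₀ := by positivity
    have := abs_le_super_of_residual_le (q := fun z => c + p z) (ψ.smooth _) hH hH2
      (schwartz_tendsto ψ) h0 (fun z => hc₀.trans_le (hg z)) (fun z => by
        have e : - lp ψ z + (c + p z) * ψ z = r₀ z - r z := by linarith [h1 z]
        rw [e]
        refine (abs_sub _ _).trans ((add_le_add (hb z) (hr z)).trans ?_)
        rw [div_mul_eq_mul_div, le_div_iff₀ hc₀]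
        exact mul_le_mul_of_nonneg_left (hg z) (by positivity)) z
    refine this.trans ?_
    nlinarith [hH1 z]

/-- The positive multiplier `φ = 1 + ψ` attached to a charge and a potential. -/
lemma exists_multiplier : ∃ κ > 0, ∃ δ₀ > 0, ∃ C > 0, ∀ L U n Pn Pf, Charge L U n Pn Pf → 0 < L →
    ∀ (δ : ℝ) (w : ℂ → ℝ), 0 < δ → δ ≤ δ₀ → ContDiff ℝ ∞ w → (∀ z, |w z| ≤ δ) →
    ∀ err > 0, err ≤ δ → ∃ ψ : ℂ → ℝ, ContDiff ℝ ∞ ψ ∧ (∀ z, |ψ z| ≤ C * δ) ∧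
      (∀ z, |ψ z| ≤ 1 / 2) ∧ (∀ z, |lp ψ z| ≤ C * δ * (Pn z + Pf z + 1)) ∧
      ∀ z ∈ ball (0:ℂ) (7 / 5 * L),
        |lp ψ z + w z * (1 + ψ z) - κ * (Pn z + Pf z) * ψ z| ≤ err := by
  obtain ⟨κ, hκ, c₀, hc₀, hsup⟩ := exists_super
  refine ⟨κ, hκ, c₀ / 8, by positivity, 4 / c₀ * (κ + 1) + 5 / 2, by positivity,
    fun L U n Pn Pf h hL δ w hδ hδ₀ hw hwδ err herr herrδ => ?_⟩
  obtain ⟨H, hH, hH2, hH1, ⟨B, hB⟩, hHs⟩ := hsup L U n Pn Pf h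
  obtain ⟨χ, hχ, hχ0, hχ1, hχA, hχB⟩ := exists_smooth_cutoff
    (A := (ball (0:ℂ) (3 / 2 * L))ᶜ) (B := closedBall (0:ℂ) (7 / 5 * L)) isOpen_ball.isClosed_compl
    isClosed_closedBall (Set.disjoint_left.2 fun z hz hz2 => hz (by
      rw [mem_closedBall_zero_iff] at hz2; rw [mem_ball_zero_iff]; linarith))
  set W : ℂ → ℝ := fun z => χ z * w z with hW
  have hWs : ContDiff ℝ ∞ W := hχ.mul hw
  have hWc : HasCompactSupport W := by
    refine HasCompactSupport.of_support_subset_isCompact (isCompact_closedBall (0:ℂ) (3 / 2 * L)) ?_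
    intro z hz
    by_contra hc
    refine hz ?_
    have : z ∈ (ball (0:ℂ) (3 / 2 * L))ᶜ := fun h2 => hc (ball_subset_closedBall h2)
    simp [hW, hχA z this]
  have hWδ : ∀ z, |W z| ≤ δ := fun z => by
    rw [hW, abs_mul, abs_of_nonneg (hχ0 z)]
    nlinarith [hχ0 z, hχ1 z, hwδ z, abs_nonneg (w z)]
  set P : ℂ → ℝ := fun z => Pn z + Pf z with hP
  have hP0 : ∀ z, 0 ≤ P z := h.nonneg
  set p : ℂ → ℝ := fun z => κ * (Pn z + Pf z - 1) - W z with hp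
  have hps : ContDiff ℝ ∞ p := (contDiff_const.mul (h.smooth.sub contDiff_const)).sub hWs
  have hpc : HasCompactSupport p := (h.cpt.mul_left (f := fun _ => κ)).sub hWc
  set r₀ : SchwartzMap ℂ ℝ := hWc.toSchwartzMap hWs with hr₀
  have hr₀W : ∀ z, r₀ z = W z := fun z => rfl
  obtain ⟨ψ, hψ1, hψ2⟩ := exists_approx_solution (c := κ) (c₀ := c₀ / 2) hps hpc hH hH2 hH1 hB
    (by positivity) (fun z => by
      have h1 := hHs z
      have h2 : |W z * H z| ≤ δ := by
        rw [abs_mul, abs_of_nonneg (by linarith [hH2 z] : 0 ≤ H z)]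
        nlinarith [hWδ z, hH1 z, hH2 z, abs_nonneg (W z)]
      have h3 := le_abs_self (W z * H z)
      have e : (κ + p z) * H z = κ * (Pn z + Pf z) * H z - W z * H z := by simp only [hp]; ring
      rw [e]; linarith) r₀ (b := δ) (fun z => by rw [hr₀W]; exact hWδ z) herr
  have hψb : ∀ z, |ψ z| ≤ 4 / c₀ * δ := fun z => (hψ2 z).trans (by
    rw [div_mul_eq_mul_div, div_le_div_iff₀ (by positivity) hc₀]
    nlinarith)
  have hψh : ∀ z, |ψ z| ≤ 1 / 2 := fun z => (hψb z).trans (by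
    rw [div_mul_eq_mul_div, div_le_div_iff₀ hc₀ two_pos]; linarith)
  have e : ∀ z, - lp ψ z + (κ + p z) * ψ z - r₀ z
      = -(lp ψ z + W z * (1 + ψ z) - κ * P z * ψ z) := fun z => by
    rw [hr₀W]; simp only [hp, hP]; ring
  have hres : ∀ z, |lp ψ z + W z * (1 + ψ z) - κ * P z * ψ z| ≤ err := fun z => by
    have := hψ1 z
    rwa [e, abs_neg] at this
  refine ⟨ψ, ψ.smooth _, fun z => (hψb z).trans ?_, hψh, fun z => ?_, fun z hz => ?_⟩
  · have : 0 ≤ 4 / c₀ * κ * δ := by positivity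
    nlinarith
  · have h1 : |κ * P z * ψ z| ≤ κ * P z * (4 / c₀ * δ) := by
      rw [abs_mul, abs_of_nonneg (mul_nonneg hκ.le (hP0 z))]
      exact mul_le_mul_of_nonneg_left (hψb z) (mul_nonneg hκ.le (hP0 z))
    have h2 : |W z * (1 + ψ z)| ≤ δ * (3 / 2) := by
      rw [abs_mul]
      refine mul_le_mul (hWδ z) ?_ (abs_nonneg _) hδ.le
      have := abs_add_le 1 (ψ z)
      rw [abs_one] at this
      linarith [hψh z]
    have h3 := hres z
    have h4 : |lp ψ z| ≤ κ * P z * (4 / c₀ * δ) + δ * (3 / 2) + δ := by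
      have e2 : lp ψ z = (lp ψ z + W z * (1 + ψ z) - κ * P z * ψ z) - W z * (1 + ψ z) + κ * P z * ψ z := by
        ring
      rw [abs_le] at h1 h2 h3 ⊢
      constructor <;> linarith [h1.1, h1.2, h2.1, h2.2, h3.1, h3.2]
    refine h4.trans ?_
    have : (4 / c₀ * (κ + 1) + 5 / 2) * δ * (Pn z + Pf z + 1) - (κ * P z * (4 / c₀ * δ) + δ * (3 / 2) + δ)
      = 4 / c₀ * δ * P z + 5 / 2 * δ * P z + 4 / c₀ * (κ + 1) * δ := by simp only [hP]; ring
    have h0 : 0 ≤ 4 / c₀ * δ * P z + 5 / 2 * δ * P z + 4 / c₀ * (κ + 1) * δ := by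
      have := hP0 z
      positivity
    linarith
  · have := hres z
    have hWw : W z = w z := by
      simp only [hW]; rw [hχB z (ball_subset_closedBall hz), one_mul]
    rwa [hWw] at this

lemma lintegral_ball_norm_sub_rpow {a s : ℝ} (ha : a < 2) (hs : 0 ≤ s) (w : ℂ) :
    ∫⁻ z in ball w s, ENNReal.ofReal (‖w - z‖ ^ (-a)) =
      ENNReal.ofReal (2 * Real.pi / (2 - a) * s ^ (2 - a)) := by
  rw [← lintegral_ball_norm_rpow ha hs, ← lintegral_indicator measurableSet_ball,
    ← lintegral_indicator measurableSet_ball,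
    ← lintegral_sub_left_eq_self ((ball (0:ℂ) s).indicator fun z => ENNReal.ofReal (‖z‖ ^ (-a))) w]
  refine lintegral_congr fun z => ?_
  have : z ∈ ball w s ↔ w - z ∈ ball (0:ℂ) s := by
    rw [mem_ball_zero_iff, mem_ball, dist_comm, dist_eq_norm]
  by_cases h : z ∈ ball w s
  · rw [indicator_of_mem h, indicator_of_mem (this.1 h)]
  · rw [indicator_of_notMem h, indicator_of_notMem (mt this.2 h)]

/-- The truncated radial power `‖y‖ ^ (-a)` on the unit disk. -/
def kb (a : ℝ) (y : ℂ) : ℝ≥0∞ := (ball (0:ℂ) 1).indicator (fun y => ENNReal.ofReal (‖y‖ ^ (-a))) y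

lemma measurable_kb (a : ℝ) : Measurable (kb a) :=
  Measurable.indicator (by fun_prop) measurableSet_ball

lemma kb_of_lt {a : ℝ} {y : ℂ} (h : ‖y‖ < 1) : kb a y = ENNReal.ofReal (‖y‖ ^ (-a)) :=
  indicator_of_mem (mem_ball_zero_iff.2 h) _

lemma kb_of_le {a : ℝ} {y : ℂ} (h : 1 ≤ ‖y‖) : kb a y = 0 :=
  indicator_of_notMem (fun h2 => absurd (mem_ball_zero_iff.1 h2) (not_lt.2 h)) _

lemma lintegral_kb {a : ℝ} (ha : a < 2) (x : ℂ) :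
    ∫⁻ z, kb a (z - x) = ENNReal.ofReal (2 * Real.pi / (2 - a)) := by
  rw [lintegral_sub_right_eq_self (kb a) x]
  unfold kb
  rw [lintegral_indicator measurableSet_ball, lintegral_ball_norm_rpow ha zero_le_one,
    Real.one_rpow, mul_one]

/-- The local Newtonian gradient potential of a density. -/
def nk (P : ℂ → ℝ) (z : ℂ) : ℝ≥0∞ := ∫⁻ x, ENNReal.ofReal (P x) * kb 1 (z - x)

lemma inv_mul_inv_le_rpow {a b D : ℝ} (ha : 0 < a) (hb : 0 < b) (hD : 0 < D) (h : D ≤ a + b) :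
    a ^ (-1 : ℝ) * b ^ (-1 : ℝ) ≤
      2 * D ^ (-(1 / 2) : ℝ) * (a ^ (-(3 / 2) : ℝ) + b ^ (-(3 / 2) : ℝ)) := by
  have e (x : ℝ) (hx : 0 < x) : x ^ (-1 : ℝ) = (x ^ (-(1 / 2) : ℝ)) ^ 2 := by
    rw [← Real.rpow_natCast, ← Real.rpow_mul hx.le]; norm_num
  have e3 (x : ℝ) (hx : 0 < x) : x ^ (-(3 / 2) : ℝ) = (x ^ (-(1 / 2) : ℝ)) ^ 3 := by
    rw [← Real.rpow_natCast, ← Real.rpow_mul hx.le]; norm_num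
  have hl (x : ℝ) (hx : D / 2 ≤ x) : x ^ (-(1 / 2) : ℝ) ≤ 2 * D ^ (-(1 / 2) : ℝ) := by
    refine (Real.rpow_le_rpow_of_nonpos (by positivity) hx (by norm_num)).trans ?_
    rw [Real.div_rpow hD.le two_pos.le, Real.rpow_neg two_pos.le, div_inv_eq_mul, mul_comm]
    refine mul_le_mul_of_nonneg_right ?_ (by positivity)
    calc (2:ℝ) ^ (1 / 2 : ℝ) ≤ 2 ^ (1 : ℝ) := Real.rpow_le_rpow_of_exponent_le (by norm_num) (by norm_num)
      _ = 2 := Real.rpow_one 2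
  rw [e a ha, e b hb, e3 a ha, e3 b hb]
  have hs0 : 0 < a ^ (-(1 / 2) : ℝ) := by positivity
  have ht0 : 0 < b ^ (-(1 / 2) : ℝ) := by positivity
  have hab : D / 2 ≤ a ∨ D / 2 ≤ b := by
    by_contra! hc; linarith [hc.1, hc.2]
  have hla := hl a
  have hlb := hl b
  set s := a ^ (-(1 / 2) : ℝ)
  set t := b ^ (-(1 / 2) : ℝ)
  set d := D ^ (-(1 / 2) : ℝ)
  have h1 : s * t ^ 2 ≤ s ^ 3 + t ^ 3 := by
    rcases le_total s t with h | h
    · have := mul_le_mul_of_nonneg_right h (sq_nonneg t)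
      have := pow_pos hs0 3
      nlinarith
    · have := mul_le_mul_of_nonneg_left (pow_le_pow_left₀ ht0.le h 2) hs0.le
      have := pow_pos ht0 3
      nlinarith
  have h2 : t * s ^ 2 ≤ s ^ 3 + t ^ 3 := by
    rcases le_total t s with h | h
    · have := mul_le_mul_of_nonneg_right h (sq_nonneg s)
      have := pow_pos ht0 3
      nlinarith
    · have := mul_le_mul_of_nonneg_left (pow_le_pow_left₀ hs0.le h 2) ht0.le
      have := pow_pos hs0 3
      nlinarith
  have h3 : 0 ≤ s ^ 3 + t ^ 3 := by positivity
  rcases hab with h | h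
  · calc s ^ 2 * t ^ 2 = s * (s * t ^ 2) := by ring
      _ ≤ 2 * d * (s ^ 3 + t ^ 3) := mul_le_mul (hla h) h1 (by positivity) (hs0.le.trans (hla h))
  · calc s ^ 2 * t ^ 2 = t * (t * s ^ 2) := by ring
      _ ≤ 2 * d * (s ^ 3 + t ^ 3) := mul_le_mul (hlb h) h2 (by positivity) (ht0.le.trans (hlb h))

/-- A doubled Newtonian gradient potential is controlled by the half potential. -/
lemma Charge.lintegral_nk_le {L : ℝ} {U : ℂ → ℝ} {n : ℕ} {Pn Pf : ℂ → ℝ} (h : Charge L U n Pn Pf)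
    (w : ℂ) : ∫⁻ z in ball w 3, nk Pn z * ENNReal.ofReal (‖w - z‖ ^ (-1 : ℝ)) ≤
      ENNReal.ofReal (100 * CP) := by
  have hPm : Measurable fun x => ENNReal.ofReal (Pn x) :=
    h.smooth_n.continuous.measurable.ennreal_ofReal
  have hk := measurable_kb 1
  have hrm : Measurable fun z : ℂ => ENNReal.ofReal (‖w - z‖ ^ (-1 : ℝ)) := by fun_prop
  have h1 : ∫⁻ z in ball w 3, nk Pn z * ENNReal.ofReal (‖w - z‖ ^ (-1 : ℝ)) =
      ∫⁻ x, ENNReal.ofReal (Pn x) *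
        ∫⁻ z in ball w 3, kb 1 (z - x) * ENNReal.ofReal (‖w - z‖ ^ (-1 : ℝ)) := by
    calc _ = ∫⁻ z in ball w 3, ∫⁻ x, ENNReal.ofReal (Pn x) *
        (kb 1 (z - x) * ENNReal.ofReal (‖w - z‖ ^ (-1 : ℝ))) := by
          refine lintegral_congr fun z => ?_
          rw [nk, ← lintegral_mul_const _ (by fun_prop)]
          simp only [mul_assoc]
      _ = ∫⁻ x, ∫⁻ z in ball w 3, ENNReal.ofReal (Pn x) *
        (kb 1 (z - x) * ENNReal.ofReal (‖w - z‖ ^ (-1 : ℝ))) := by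
          refine lintegral_lintegral_swap ?_
          have hPm2 : Measurable Pn := h.smooth_n.continuous.measurable
          exact Measurable.aemeasurable (by fun_prop)
      _ = _ := by
          refine lintegral_congr fun x => ?_
          rw [lintegral_const_mul _ (by fun_prop)]
  rw [h1]
  have h2 : ∀ x, x ≠ w → ∫⁻ z in ball w 3, kb 1 (z - x) * ENNReal.ofReal (‖w - z‖ ^ (-1 : ℝ)) ≤
      ENNReal.ofReal 100 *
        (ball w 20).indicator (fun x => ENNReal.ofReal (‖w - x‖ ^ (-(1 / 2) : ℝ))) x := by
    intro x hx
    have hD : 0 < ‖w - x‖ := norm_pos_iff.2 (sub_ne_zero.2 hx.symm)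
    by_cases hx4 : x ∈ ball w 20
    · rw [indicator_of_mem hx4]
      calc _ ≤ ∫⁻ z in ball w 3, ENNReal.ofReal (2 * ‖w - x‖ ^ (-(1 / 2) : ℝ)) *
          (kb (3/2) (z - x) + ENNReal.ofReal (‖w - z‖ ^ (-(3/2) : ℝ))) := by
            refine lintegral_mono fun z => ?_
            show kb 1 (z - x) * ENNReal.ofReal (‖w - z‖ ^ (-1 : ℝ)) ≤ ENNReal.ofReal (2 * ‖w - x‖ ^ (-(1 / 2) : ℝ)) *
              (kb (3/2) (z - x) + ENNReal.ofReal (‖w - z‖ ^ (-(3/2) : ℝ)))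
            rcases le_or_gt 1 ‖z - x‖ with h1 | h1
            · rw [kb_of_le h1]; simp
            rw [kb_of_lt h1, kb_of_lt h1]
            rcases (norm_nonneg (z - x)).eq_or_lt with h2 | h2
            · rw [← h2, Real.zero_rpow (by norm_num)]; simp
            rcases (norm_nonneg (w - z)).eq_or_lt with h3 | h3
            · rw [← h3, Real.zero_rpow (by norm_num)]; simp
            rw [← ENNReal.ofReal_add (by positivity) (by positivity),
              ← ENNReal.ofReal_mul (by positivity), ← ENNReal.ofReal_mul (by positivity)]
            refine ENNReal.ofReal_le_ofReal (inv_mul_inv_le_rpow h2 h3 hD ?_)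
            have := norm_add_le (w - z) (z - x)
            rw [sub_add_sub_cancel] at this
            linarith
        _ ≤ ENNReal.ofReal (2 * ‖w - x‖ ^ (-(1 / 2) : ℝ)) *
            (ENNReal.ofReal (4 * Real.pi) + ENNReal.ofReal (4 * Real.pi * 2)) := by
            have hk2 := measurable_kb (3/2)
            rw [lintegral_const_mul _ (by fun_prop), lintegral_add_left (by fun_prop)]
            gcongr
            · refine (setLIntegral_le_lintegral _ _).trans ?_
              rw [lintegral_kb (by norm_num)]
              refine ENNReal.ofReal_le_ofReal (le_of_eq (by ring))
            · rw [lintegral_ball_norm_sub_rpow (by norm_num) (by norm_num)]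
              refine ENNReal.ofReal_le_ofReal ?_
              have : (3:ℝ) ^ (2 - 3 / 2 : ℝ) ≤ 2 := by
                rw [show (2 - 3 / 2 : ℝ) = 1 / 2 by norm_num, ← Real.sqrt_eq_rpow]
                exact (Real.sqrt_le_left (by norm_num)).2 (by norm_num)
              have hp := Real.pi_pos
              calc 2 * Real.pi / (2 - 3 / 2) * (3:ℝ) ^ (2 - 3 / 2 : ℝ) = 4 * Real.pi * (3:ℝ) ^ (2 - 3 / 2 : ℝ) := by ring
                _ ≤ _ := by gcongr
        _ ≤ _ := by
            have hp := Real.pi_pos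
            rw [← ENNReal.ofReal_add (by positivity) (by positivity),
              ← ENNReal.ofReal_mul (by positivity), ← ENNReal.ofReal_mul (by positivity)]
            refine ENNReal.ofReal_le_ofReal ?_
            have h4 : 0 < ‖w - x‖ ^ (-(1 / 2) : ℝ) := by positivity
            have := Real.pi_lt_four
            nlinarith
    · have h0 : ∫⁻ z in ball w 3, kb 1 (z - x) * ENNReal.ofReal (‖w - z‖ ^ (-1 : ℝ)) = 0 := by
        rw [setLIntegral_congr_fun (g := fun _ => 0) measurableSet_ball]
        · simp
        · intro z hz
          have hz' : ‖z - w‖ < 3 := by rwa [mem_ball, dist_eq_norm] at hz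
          have hx' : 20 ≤ ‖x - w‖ := by rwa [mem_ball, dist_eq_norm, not_lt] at hx4
          have := norm_sub_norm_le (x - w) (z - w)
          rw [sub_sub_sub_cancel_right, norm_sub_rev x z] at this
          show kb 1 (z - x) * _ = 0
          rw [kb_of_le (by linarith), zero_mul]
      rw [h0]; exact zero_le
  calc _ ≤ ∫⁻ x, ENNReal.ofReal 100 * (ball w 20).indicator (fun x => ENNReal.ofReal (Pn x * ‖w - x‖ ^ (-(1 / 2) : ℝ))) x := by
        refine lintegral_mono_ae ?_
        have : ∀ᵐ x : ℂ, x ≠ w := by simp [ae_iff]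
        filter_upwards [this] with x hx
        refine (mul_le_mul_right (h2 x hx) _).trans (le_of_eq ?_)
        by_cases hx4 : x ∈ ball w 20
        · rw [indicator_of_mem hx4, indicator_of_mem hx4, ENNReal.ofReal_mul (h.nonneg_n x)]; ring
        · rw [indicator_of_notMem hx4, indicator_of_notMem hx4]; simp
    _ ≤ _ := by
        have hm : Measurable fun x => ENNReal.ofReal (Pn x * ‖w - x‖ ^ (-(1 / 2) : ℝ)) := by
          have := h.smooth_n.continuous.measurable
          fun_prop
        rw [lintegral_const_mul _ (hm.indicator measurableSet_ball), lintegral_indicator measurableSet_ball,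
          ENNReal.ofReal_mul (by norm_num)]
        gcongr
        exact h.half w

lemma kb_neg (a : ℝ) (y : ℂ) : kb a (-y) = kb a y := by
  rcases lt_or_ge ‖y‖ 1 with h | h
  · rw [kb_of_lt h, kb_of_lt (by rwa [norm_neg]), norm_neg]
  · rw [kb_of_le h, kb_of_le (by rwa [norm_neg])]

lemma nk_eq (P : ℂ → ℝ) (z : ℂ) : nk P z = ∫⁻ y, ENNReal.ofReal (P (z + y)) * kb 1 y := by
  rw [nk, ← lintegral_add_left_eq_self _ z]
  refine lintegral_congr fun y => ?_
  rw [sub_add_cancel_left, kb_neg]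

lemma ofReal_integral_le_lintegral {f : ℂ → ℝ} (hf : ∀ z, 0 ≤ f z) (s : Set ℂ) :
    ENNReal.ofReal (∫ z in s, f z) ≤ ∫⁻ z in s, ENNReal.ofReal (f z) := by
  have := enorm_integral_le_lintegral_enorm (μ := volume.restrict s) f
  rw [Real.enorm_of_nonneg (integral_nonneg hf)] at this
  exact this.trans (lintegral_mono fun z => by rw [Real.enorm_of_nonneg (hf z)])

lemma enorm_dr_le_nk : ∃ C > 0, ∀ (ψ Pn Pf : ℂ → ℝ) (M : ℝ), ContDiff ℝ ∞ ψ → Continuous Pn →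
    0 ≤ M → (∀ z, 0 ≤ Pn z) → (∀ z, Pf z ≤ 1) → (∀ z, |ψ z| ≤ M) →
    (∀ z, |lp ψ z| ≤ M * (Pn z + Pf z + 1)) →
    ∀ z, ‖dr ψ z‖ₑ ≤ ENNReal.ofReal (C * M) * (1 + nk Pn z) := by
  obtain ⟨C, hC, hdr⟩ := norm_dr_zero_le
  refine ⟨C * 17, by positivity, fun ψ Pn Pf M hψ hPc hM hP hPf hψM hlp z => ?_⟩
  set v : ℂ → ℝ := fun x => ψ (z + (1:ℝ) * x) with hv
  have hvs : ContDiff ℝ ∞ v := hψ.comp (contDiff_affine z 1)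
  have h1 := hdr v hvs
  have e1 : dr v 0 = dr ψ z := by rw [hv, dr_comp_affine hψ]; simp
  have e2 : ∀ x, lp v x = lp ψ (z + x) := fun x => by rw [hv, lp_comp_affine hψ]; simp
  rw [e1] at h1
  have hpi := Real.pi_lt_four
  have hk := measurable_kb 1
  have hPm : Measurable Pn := hPc.measurable
  have hI1 : ENNReal.ofReal (∫ x in ball (0:ℂ) (1/2), |v x|) ≤ ENNReal.ofReal M := by
    refine (ofReal_integral_le_lintegral (fun x => abs_nonneg _) _).trans ?_
    calc _ ≤ ∫⁻ x in ball (0:ℂ) (1/2), ENNReal.ofReal M :=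
          lintegral_mono fun x => ENNReal.ofReal_le_ofReal (hψM _)
      _ ≤ ENNReal.ofReal M * 1 := by
          rw [setLIntegral_const]
          gcongr
          rw [Complex.volume_ball, ← ENNReal.ofReal_pow (by norm_num)]
          rw [← ENNReal.ofReal_coe_nnreal, ← ENNReal.ofReal_mul (by norm_num)]
          rw [ENNReal.ofReal_le_one]
          simp only [NNReal.coe_real_pi]; linarith
      _ = _ := mul_one _
  have hI2 : ENNReal.ofReal (∫ x in ball (0:ℂ) (1/2), |lp v x| * ‖x‖⁻¹) ≤
      ENNReal.ofReal M * (nk Pn z + ENNReal.ofReal 16) := by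
    refine (ofReal_integral_le_lintegral (fun x => by positivity) _).trans ?_
    calc _ ≤ ∫⁻ x in ball (0:ℂ) (1/2), ENNReal.ofReal M *
          (ENNReal.ofReal (Pn (z + x)) * kb 1 x + 2 * kb 1 x) := by
          refine setLIntegral_mono (by fun_prop) fun x hx => ?_
          rw [mem_ball_zero_iff] at hx
          rw [kb_of_lt (by linarith), Real.rpow_neg_one, ← add_mul, ← mul_assoc,
            ENNReal.ofReal_mul (abs_nonneg _)]
          gcongr
          rw [e2]
          refine (ENNReal.ofReal_le_ofReal (hlp _)).trans ?_
          rw [ENNReal.ofReal_mul hM]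
          gcongr
          rw [show (2:ℝ≥0∞) = ENNReal.ofReal 2 by simp, ← ENNReal.ofReal_add (hP _) (by norm_num)]
          exact ENNReal.ofReal_le_ofReal (by linarith [hPf (z + x)])
      _ ≤ ∫⁻ x, ENNReal.ofReal M * (ENNReal.ofReal (Pn (z + x)) * kb 1 x + 2 * kb 1 x) :=
          setLIntegral_le_lintegral _ _
      _ ≤ _ := by
          rw [lintegral_const_mul _ (by fun_prop), lintegral_add_left (by fun_prop), ← nk_eq,
            lintegral_const_mul _ hk]
          gcongr
          have := lintegral_kb (a := 1) (by norm_num) 0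
          simp only [sub_zero] at this
          rw [this, show (2:ℝ≥0∞) = ENNReal.ofReal 2 by simp, ← ENNReal.ofReal_mul (by norm_num)]
          refine ENNReal.ofReal_le_ofReal ?_
          norm_num; linarith
  calc ‖dr ψ z‖ₑ = ENNReal.ofReal ‖dr ψ z‖ := (ofReal_norm _).symm
    _ ≤ ENNReal.ofReal (C * ((∫ x in ball (0:ℂ) (1/2), |v x|) +
          ∫ x in ball (0:ℂ) (1/2), |lp v x| * ‖x‖⁻¹)) := ENNReal.ofReal_le_ofReal h1
    _ ≤ ENNReal.ofReal C * (ENNReal.ofReal M + ENNReal.ofReal M * (nk Pn z + ENNReal.ofReal 16)) := by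
        rw [ENNReal.ofReal_mul hC.le, ENNReal.ofReal_add (by positivity) (by positivity)]
        gcongr
    _ = ENNReal.ofReal C * ENNReal.ofReal M * (ENNReal.ofReal 17 + nk Pn z) := by
        rw [show ENNReal.ofReal 17 = 1 + ENNReal.ofReal 16 by
          rw [← ENNReal.ofReal_one, ← ENNReal.ofReal_add (by norm_num) (by norm_num)]; norm_num]
        ring
    _ ≤ ENNReal.ofReal C * ENNReal.ofReal M * (ENNReal.ofReal 17 * (1 + nk Pn z)) := by
        gcongr
        rw [mul_add, mul_one]
        gcongr
        refine le_mul_of_one_le_left zero_le ?_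
        rw [ENNReal.one_le_ofReal]; norm_num
    _ = _ := by
        rw [mul_assoc C, ENNReal.ofReal_mul hC.le, ENNReal.ofReal_mul (by norm_num)]; ring

/-- The squared inverse distance on the annulus `1 ≤ r ≤ T`. -/
def annSq (T : ℝ) (r : ℝ) : ℝ≥0∞ := (Icc 1 T).indicator (fun r => ENNReal.ofReal (r ^ 2)⁻¹) r

lemma measurable_annSq (T : ℝ) : Measurable (annSq T) :=
  Measurable.indicator (by fun_prop) measurableSet_Icc

lemma lintegral_annSq {T : ℝ} (hT : 1 ≤ T) (w : ℂ) :
    ∫⁻ y, annSq T ‖w - y‖ = ENNReal.ofReal (2 * Real.pi * Real.log T) := by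
  rw [lintegral_sub_left_eq_self (fun y => annSq T ‖y‖) w, lintegral_norm_complex (measurable_annSq T),
    ENNReal.ofReal_mul (p := 2 * Real.pi) (by positivity)]
  congr 1
  have h1 : ∫⁻ r in Ioi (0:ℝ), ENNReal.ofReal r * annSq T r =
      ∫⁻ r in Icc 1 T, ENNReal.ofReal r⁻¹ := by
    rw [← lintegral_indicator measurableSet_Ioi, ← lintegral_indicator measurableSet_Icc]
    refine lintegral_congr fun r => ?_
    by_cases hr : r ∈ Icc 1 T
    · have h0 : 0 < r := by linarith [hr.1]
      rw [indicator_of_mem (mem_Ioi.2 h0), indicator_of_mem hr, annSq, indicator_of_mem hr,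
        ← ENNReal.ofReal_mul h0.le]
      congr 1
      field_simp
    · have : ENNReal.ofReal r * annSq T r = 0 := by rw [annSq, indicator_of_notMem hr, mul_zero]
      rw [indicator_of_notMem hr]
      by_cases h0 : r ∈ Ioi (0:ℝ)
      · rw [indicator_of_mem h0, this]
      · rw [indicator_of_notMem h0]
  rw [h1, ← ofReal_integral_eq_lintegral_ofReal]
  · rw [integral_Icc_eq_integral_Ioc, ← intervalIntegral.integral_of_le hT,
      integral_inv_of_pos one_pos (by linarith), div_one]
  · refine ContinuousOn.integrableOn_Icc ?_
    exact continuousOn_inv₀.mono fun r hr => ne_of_gt (by linarith [hr.1])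
  · exact (ae_restrict_iff' measurableSet_Icc).2 (Eventually.of_forall fun r hr => by
      have : 0 ≤ r := by linarith [hr.1]
      simpa using this)

lemma cauchyT_osc : ∃ C > 0, ∀ (L A : ℝ) (β : ℂ → ℂ), 2 ≤ L → 0 ≤ A → Continuous β →
    HasCompactSupport β → (∀ z, 2 * L ≤ ‖z‖ → β z = 0) →
    (∀ w, ∫⁻ z in ball w 3, ‖β z‖ₑ * ENNReal.ofReal (‖w - z‖ ^ (-1 : ℝ)) ≤ ENNReal.ofReal A) →
    ∀ w w', ‖w‖ ≤ 2 * L → ‖w - w'‖ ≤ 1 →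
      ‖cauchyT β w - cauchyT β w'‖ ≤ C * A * (1 + Real.log L) := by
  refine ⟨100, by positivity, fun L A β hL hA hβ hc hβL hβA w w' hw hww => ?_⟩
  have hβm : Measurable β := hβ.measurable
  have hbm : Measurable fun z => ‖β z‖ₑ := hβ.measurable.enorm
  have hk := measurable_kb 1
  have ham := measurable_annSq (5 * L)
  have hlogL : 0 ≤ Real.log L := Real.log_nonneg (by linarith)
  have hB2 : ∫⁻ z in (ball w 2)ᶜ, ‖β z‖ₑ * ENNReal.ofReal (‖w - z‖ ^ 2)⁻¹ ≤
      ENNReal.ofReal (8 * Real.pi * A * Real.log (5 * L)) := by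
    calc _ ≤ ∫⁻ z in (ball w 2)ᶜ, ∫⁻ y, 4 * annSq (5 * L) ‖w - y‖ * (‖β z‖ₑ * kb 1 (y - z)) := by
          refine setLIntegral_mono' measurableSet_ball.compl fun z hz => ?_
          rcases eq_or_ne (β z) 0 with h0 | h0
          · simp [h0]
          have hz1 : 2 ≤ ‖w - z‖ := by
            rwa [mem_compl_iff, mem_ball, not_lt, dist_comm, dist_eq_norm] at hz
          have hz2 : ‖z‖ < 2 * L := by by_contra! hc2; exact h0 (hβL z hc2)
          calc ‖β z‖ₑ * ENNReal.ofReal (‖w - z‖ ^ 2)⁻¹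
              ≤ ‖β z‖ₑ * ENNReal.ofReal (‖w - z‖ ^ 2)⁻¹ * ∫⁻ y, kb 1 (y - z) := by
                refine le_mul_of_one_le_right zero_le ?_
                rw [lintegral_kb (by norm_num), ENNReal.one_le_ofReal]
                have := Real.pi_gt_three
                norm_num; linarith
            _ = ∫⁻ y, ‖β z‖ₑ * ENNReal.ofReal (‖w - z‖ ^ 2)⁻¹ * kb 1 (y - z) := by
                rw [lintegral_const_mul _ (by fun_prop)]
            _ ≤ _ := by
                refine lintegral_mono fun y => ?_
                show ‖β z‖ₑ * ENNReal.ofReal (‖w - z‖ ^ 2)⁻¹ * kb 1 (y - z) ≤ 4 * annSq (5 * L) ‖w - y‖ * (‖β z‖ₑ * kb 1 (y - z))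
                rcases le_or_gt 1 ‖y - z‖ with h1 | h1
                · rw [kb_of_le h1]; simp
                have t1 := norm_sub_norm_le (w - z) (y - z)
                rw [sub_sub_sub_cancel_right] at t1
                have t2 := norm_add_le (w - z) (z - y)
                rw [sub_add_sub_cancel, norm_sub_rev z y] at t2
                have t3 := norm_sub_le w z
                have hin : ‖w - y‖ ∈ Icc 1 (5 * L) := ⟨by linarith, by linarith⟩
                rw [annSq, indicator_of_mem hin]
                have : ENNReal.ofReal (‖w - z‖ ^ 2)⁻¹ ≤ 4 * ENNReal.ofReal (‖w - y‖ ^ 2)⁻¹ := by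
                  rw [show (4:ℝ≥0∞) = ENNReal.ofReal 4 by simp, ← ENNReal.ofReal_mul (by norm_num)]
                  refine ENNReal.ofReal_le_ofReal ?_
                  have hp : 0 < ‖w - y‖ := by linarith [hin.1]
                  have hp2 : 0 < ‖w - z‖ := by linarith
                  rw [← div_eq_mul_inv, inv_eq_one_div, div_le_div_iff₀ (by positivity) (by positivity)]
                  nlinarith
                calc _ ≤ ‖β z‖ₑ * (4 * ENNReal.ofReal (‖w - y‖ ^ 2)⁻¹) * kb 1 (y - z) := by gcongr
                  _ = _ := by ring
      _ ≤ ∫⁻ z, ∫⁻ y, 4 * annSq (5 * L) ‖w - y‖ * (‖β z‖ₑ * kb 1 (y - z)) := setLIntegral_le_lintegral _ _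
      _ = ∫⁻ y, ∫⁻ z, 4 * annSq (5 * L) ‖w - y‖ * (‖β z‖ₑ * kb 1 (y - z)) :=
          lintegral_lintegral_swap (Measurable.aemeasurable (by fun_prop))
      _ ≤ ∫⁻ y, 4 * annSq (5 * L) ‖w - y‖ * ENNReal.ofReal A := by
          refine lintegral_mono fun y => ?_
          show ∫⁻ z, 4 * annSq (5 * L) ‖w - y‖ * (‖β z‖ₑ * kb 1 (y - z)) ≤ 4 * annSq (5 * L) ‖w - y‖ * ENNReal.ofReal A
          rw [lintegral_const_mul _ (by fun_prop)]
          gcongr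
          refine le_trans ?_ (hβA y)
          rw [← lintegral_indicator measurableSet_ball]
          refine lintegral_mono fun z => ?_
          show ‖β z‖ₑ * kb 1 (y - z) ≤ _
          rcases le_or_gt 1 ‖y - z‖ with h1 | h1
          · rw [kb_of_le h1]; simp
          · rw [kb_of_lt h1, indicator_of_mem]
            rw [mem_ball, dist_comm, dist_eq_norm]; linarith
      _ = _ := by
          rw [lintegral_mul_const _ (by fun_prop), lintegral_const_mul _ (by fun_prop),
            lintegral_annSq (by linarith), show (4:ℝ≥0∞) = ENNReal.ofReal 4 by simp,
            ← ENNReal.ofReal_mul (by norm_num), ← ENNReal.ofReal_mul' hA]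
          congr 1; ring
  have hdiff : cauchyT β w - cauchyT β w' =
      (Real.pi : ℂ)⁻¹ * ∫ z, ((w - z)⁻¹ * β z - (w' - z)⁻¹ * β z) := by
    rw [cauchyT_eq, cauchyT_eq, integral_sub (integrable_cauchyT hβ hc w) (integrable_cauchyT hβ hc w'),
      mul_sub]
  have hpw : ∀ z, ‖(w - z)⁻¹ * β z - (w' - z)⁻¹ * β z‖ₑ ≤
      ‖β z‖ₑ * ENNReal.ofReal (‖w - z‖ ^ (-1 : ℝ)) + ‖β z‖ₑ * ENNReal.ofReal (‖w' - z‖ ^ (-1 : ℝ)) := by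
    intro z
    have e (x : ℂ) : ENNReal.ofReal (‖x‖ ^ (-1 : ℝ)) = ‖x⁻¹‖ₑ := by
      rw [Real.rpow_neg_one, ← norm_inv, ofReal_norm]
    rw [e, e, ← enorm_mul, ← enorm_mul, mul_comm (β z), mul_comm (β z)]
    exact enorm_sub_le
  have hnear : ∫⁻ z in ball w 2, ‖(w - z)⁻¹ * β z - (w' - z)⁻¹ * β z‖ₑ ≤ ENNReal.ofReal (2 * A) := by
    calc _ ≤ ∫⁻ z in ball w 2, (‖β z‖ₑ * ENNReal.ofReal (‖w - z‖ ^ (-1 : ℝ)) +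
          ‖β z‖ₑ * ENNReal.ofReal (‖w' - z‖ ^ (-1 : ℝ))) := lintegral_mono hpw
      _ = (∫⁻ z in ball w 2, ‖β z‖ₑ * ENNReal.ofReal (‖w - z‖ ^ (-1 : ℝ))) +
          ∫⁻ z in ball w 2, ‖β z‖ₑ * ENNReal.ofReal (‖w' - z‖ ^ (-1 : ℝ)) :=
          lintegral_add_left (by fun_prop) _
      _ ≤ ENNReal.ofReal A + ENNReal.ofReal A := by
          gcongr
          · exact (lintegral_mono_set (ball_subset_ball (by norm_num))).trans (hβA w)
          · refine (lintegral_mono_set fun z hz => ?_).trans (hβA w')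
            rw [mem_ball, dist_eq_norm] at hz ⊢
            have := norm_add_le (z - w) (w - w')
            rw [sub_add_sub_cancel] at this
            linarith
      _ = _ := by rw [← ENNReal.ofReal_add hA hA]; ring_nf
  have hfar : ∫⁻ z in (ball w 2)ᶜ, ‖(w - z)⁻¹ * β z - (w' - z)⁻¹ * β z‖ₑ ≤
      ENNReal.ofReal (2 * (8 * Real.pi * A * Real.log (5 * L))) := by
    calc _ ≤ ∫⁻ z in (ball w 2)ᶜ, ENNReal.ofReal 2 * (‖β z‖ₑ * ENNReal.ofReal (‖w - z‖ ^ 2)⁻¹) := by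
          refine setLIntegral_mono (by fun_prop) fun z hz => ?_
          have hz1 : 2 ≤ ‖w - z‖ := by
            rwa [mem_compl_iff, mem_ball, not_lt, dist_comm, dist_eq_norm] at hz
          have t1 := norm_sub_norm_le (w - z) (w - w')
          rw [sub_sub_sub_cancel_left] at t1
          have hp : 0 < ‖w - z‖ := by linarith
          have hp' : 0 < ‖w' - z‖ := by linarith
          have e : (w - z)⁻¹ * β z - (w' - z)⁻¹ * β z = ((w' - w) / ((w - z) * (w' - z))) * β z := by
            have := norm_pos_iff.1 hp
            have := norm_pos_iff.1 hp'
            field_simp; ring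
          rw [e, enorm_mul, mul_comm, ← mul_assoc, mul_comm _ ‖β z‖ₑ, mul_assoc,
            ← ENNReal.ofReal_mul (by norm_num)]
          gcongr
          rw [← ofReal_norm]
          refine ENNReal.ofReal_le_ofReal ?_
          rw [norm_div, norm_mul, ← div_eq_mul_inv, div_le_div_iff₀ (by positivity) (by positivity),
            norm_sub_rev w' w]
          have h2 : ‖w - z‖ ≤ 2 * ‖w' - z‖ := by linarith
          calc ‖w - w'‖ * ‖w - z‖ ^ 2 ≤ 1 * ‖w - z‖ ^ 2 := by gcongr
            _ = ‖w - z‖ * ‖w - z‖ := by ring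
            _ ≤ ‖w - z‖ * (2 * ‖w' - z‖) := by gcongr
            _ = _ := by ring
      _ ≤ _ := by
          rw [lintegral_const_mul _ (by fun_prop), ENNReal.ofReal_mul two_pos.le]
          gcongr
  have hlog5 : Real.log (5 * L) ≤ 2 + Real.log L := by
    rw [Real.log_mul (by norm_num) (by linarith)]
    have : Real.log 5 ≤ 2 := by
      rw [Real.log_le_iff_le_exp (by norm_num)]
      have := Real.add_one_le_exp 1
      have h2 : Real.exp 2 = Real.exp 1 * Real.exp 1 := by rw [← Real.exp_add]; norm_num
      have h3 := Real.exp_one_gt_d9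
      rw [h2]; nlinarith
    linarith
  have hlog5p : 0 ≤ Real.log (5 * L) := Real.log_nonneg (by linarith)
  have hpi0 := Real.pi_pos
  have hinteg : ‖∫ z, ((w - z)⁻¹ * β z - (w' - z)⁻¹ * β z)‖ ≤
      2 * A + 2 * (8 * Real.pi * A * Real.log (5 * L)) := by
    rw [← ENNReal.ofReal_le_ofReal_iff (by positivity), ofReal_norm,
      ENNReal.ofReal_add (by positivity) (by positivity)]
    refine (enorm_integral_le_lintegral_enorm _).trans ?_
    rw [← lintegral_add_compl _ (measurableSet_ball (x := w) (ε := 2))]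
    gcongr
  rw [hdiff, norm_mul, norm_inv, Complex.norm_real, Real.norm_of_nonneg hpi0.le]
  rw [inv_mul_le_iff₀ hpi0]
  refine hinteg.trans ?_
  have h3 := Real.pi_gt_three
  have h5 : Real.pi * A * Real.log (5 * L) ≤ Real.pi * A * (2 + Real.log L) := by gcongr
  have h6 : A ≤ Real.pi * A := by nlinarith
  have h7 : 0 ≤ Real.pi * A * Real.log L := by positivity
  nlinarith

/-- The data entering the final growth argument on the annulus `1 ≤ ‖z‖ ≤ 11/10 * L`. -/
structure Cfg (C L ν m : ℝ) (f : ℂ → ℝ) (F om T : ℂ → ℂ) (O : Set ℂ) : Prop where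
  diff_f : Differentiable ℝ f
  cont_F : Continuous F
  cont_om : Continuous om
  cont_T : Continuous T
  open_O : IsOpen O
  dr_le : ∀ z, ‖z‖ ≤ 11 / 10 * L → ‖dr f z‖ ≤ 4 * ‖F z‖
  hol : ∀ z ∈ O, ‖z‖ < 11 / 10 * L → DifferentiableAt ℂ (fun z => cexp (-om z) * F z - T z) z
  T_le : ∀ z, ‖z‖ ≤ 11 / 10 * L → ‖T z‖ ≤ ν
  om_zero : om 0 = 0
  om_osc : ∀ z z', ‖z‖ ≤ 11 / 10 * L → ‖z'‖ ≤ 11 / 10 * L → ‖om z - om z'‖ ≤ C * (1 + ‖z - z'‖)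
  far : ∀ z, z ∉ O → 1 ≤ ‖z‖ → ‖z‖ ≤ 11 / 10 * L → ‖F z‖ ≤ C * |f z|
  inner_F : ∀ z, ‖z‖ = 1 → ‖F z‖ ≤ C * (m + ν)
  inner_f : ∀ z, ‖z‖ = 1 → |f z| ≤ 2 * m
  outer : ∀ z, ‖z‖ = 11 / 10 * L → ‖F z‖ ≤ C

variable {C L ν m : ℝ} {f : ℂ → ℝ} {F om T : ℂ → ℂ} {O : Set ℂ}

lemma Cfg.abs_re_sub_le (h : Cfg C L ν m f F om T O) {z z' : ℂ} (hz : ‖z‖ ≤ 11 / 10 * L)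
    (hz' : ‖z'‖ ≤ 11 / 10 * L) : |(om z).re - (om z').re| ≤ C * (1 + ‖z - z'‖) := by
  rw [← Complex.sub_re]
  exact (Complex.abs_re_le_norm _).trans (h.om_osc z z' hz hz')

lemma Cfg.abs_re_le (h : Cfg C L ν m f F om T O) (hC : 0 ≤ C) (hL : 0 ≤ L) {z : ℂ}
    (hz : ‖z‖ ≤ 11 / 10 * L) : |(om z).re| ≤ C * (1 + 11 / 10 * L) := by
  have := h.abs_re_sub_le hz (z' := 0) (by rw [norm_zero]; positivity)
  rw [h.om_zero, Complex.zero_re, sub_zero, sub_zero] at this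
  exact this.trans (by gcongr)

/-- Radial integration of the weighted gradient bound. -/
lemma Cfg.radial (h : Cfg C L ν m f F om T O) (hC : 0 ≤ C) (hL : 2 ≤ L) (hm : 0 ≤ m) {S ϑ : ℝ}
    (hS : 0 ≤ S) {k : ℕ} (hk : C < k / (11 / 10 * L))
    (hϑ : 8 * Real.exp C / (k / (11 / 10 * L) - C) ≤ ϑ)
    (hF : ∀ z, 1 ≤ ‖z‖ → ‖z‖ ≤ 11 / 10 * L → ‖F z‖ ≤ S * (Real.exp (om z).re * ‖z‖ ^ k))
    (z : ℂ) (hz1 : 1 ≤ ‖z‖) (hz : ‖z‖ ≤ 11 / 10 * L) :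
    |f z| ≤ 2 * m + ϑ * S * (Real.exp (om z).re * ‖z‖ ^ k) := by
  set ρ := ‖z‖ with hρ
  have hρ0 : 0 < ρ := by linarith
  set e : ℂ := z / ρ with he
  have hen : ‖e‖ = 1 := by
    rw [he, norm_div, Complex.norm_real, Real.norm_of_nonneg hρ0.le, ← hρ, div_self hρ0.ne']
  have hez : (ρ : ℂ) * e = z := by
    rw [he]; exact mul_div_cancel₀ _ (by exact_mod_cast hρ0.ne')
  set μ : ℝ := k / ρ with hμ
  have hμ1 : k / (11 / 10 * L) ≤ μ := by
    rw [hμ]; exact div_le_div_of_nonneg_left (by positivity) hρ0 hz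
  have hμC : 0 < μ - C := by linarith
  set D : ℝ := 8 * S * Real.exp C * (Real.exp (om z).re * ρ ^ k) with hD
  have hD0 : 0 ≤ D := by positivity
  have hline : ∀ r : ℝ, HasDerivAt (fun r : ℝ => f (r * e)) (fderiv ℝ f (r * e) e) r := by
    intro r
    have h1 : HasDerivAt (fun r : ℝ => (r : ℂ) * e) e r := by
      simpa using (Complex.ofRealCLM.hasDerivAt (x := r)).mul_const e
    exact (h.diff_f _).hasFDerivAt.comp_hasDerivAt r h1
  have hnr : ∀ r : ℝ, 0 ≤ r → ‖(r : ℂ) * e‖ = r := fun r hr => by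
    rw [norm_mul, hen, mul_one, Complex.norm_real, Real.norm_of_nonneg hr]
  have key := image_norm_le_of_norm_deriv_right_le_deriv_boundary
    (f := fun r : ℝ => f (r * e)) (f' := fun r => fderiv ℝ f (r * e) e) (a := 1) (b := ρ)
    (B := fun r => 2 * m + D / (μ - C) * Real.exp ((μ - C) * (r - ρ)))
    (B' := fun r => D * Real.exp ((μ - C) * (r - ρ)))
    (fun r _ => (hline r).continuousAt.continuousWithinAt) (fun r _ => (hline r).hasDerivWithinAt)
    (by
      have := h.inner_f ((1 : ℝ) * e) (hnr 1 zero_le_one)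
      have h2 : 0 ≤ D / (μ - C) * Real.exp ((μ - C) * (1 - ρ)) := by positivity
      rw [Real.norm_eq_abs]
      linarith)
    (fun r => by
      have h1 : HasDerivAt (fun r : ℝ => (μ - C) * (r - ρ)) (μ - C) r := by
        simpa using ((hasDerivAt_id r).sub_const ρ).const_mul (μ - C)
      have h2 := (h1.exp.const_mul (D / (μ - C))).const_add (2 * m)
      refine h2.congr_deriv ?_
      field_simp [hμC.ne'])
    (fun r hr => by
      have hr0 : 0 < r := by linarith [hr.1]
      have hrL : ‖(r : ℂ) * e‖ ≤ 11 / 10 * L := by rw [hnr r hr0.le]; linarith [hr.2]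
      have h1 := abs_fderiv_le (h.diff_f (r * e)) e
      rw [hen, mul_one] at h1
      have h2 := h.dr_le _ hrL
      have h3 := hF (r * e) (by rw [hnr r hr0.le]; exact hr.1) hrL
      rw [hnr r hr0.le] at h3
      have h4 : r ^ k ≤ ρ ^ k * Real.exp (μ * (r - ρ)) := by
        have h5 := Real.add_one_le_exp (r / ρ - 1)
        rw [sub_add_cancel] at h5
        have h6 := pow_le_pow_left₀ (by positivity) h5 k
        rw [← Real.exp_nat_mul, div_pow, div_le_iff₀ (by positivity)] at h6
        rw [mul_comm]
        refine h6.trans (le_of_eq ?_)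
        congr 2
        rw [hμ]; field_simp
      have h5 := h.abs_re_sub_le hrL (z' := z) hz
      have h6 : ‖(r : ℂ) * e - z‖ = ρ - r := by
        rw [← hez, ← sub_mul, norm_mul, hen, mul_one, ← Complex.ofReal_sub, Complex.norm_real,
          Real.norm_eq_abs, abs_sub_comm, abs_of_nonneg (by linarith [hr.2])]
      rw [h6] at h5
      have h7 : Real.exp (om (r * e)).re ≤ Real.exp (om z).re * Real.exp (C * (1 + (ρ - r))) := by
        rw [← Real.exp_add]
        exact Real.exp_le_exp.2 (by linarith [(abs_le.1 h5).2])
      rw [Real.norm_eq_abs]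
      calc |fderiv ℝ f (r * e) e| ≤ 8 * ‖F (r * e)‖ := by linarith
        _ ≤ 8 * (S * (Real.exp (om (r * e)).re * r ^ k)) := by gcongr
        _ ≤ 8 * (S * ((Real.exp (om z).re * Real.exp (C * (1 + (ρ - r)))) *
              (ρ ^ k * Real.exp (μ * (r - ρ))))) := by gcongr
        _ = 8 * S * (Real.exp (om z).re * ρ ^ k) *
              (Real.exp (C * (1 + (ρ - r))) * Real.exp (μ * (r - ρ))) := by ring
        _ = 8 * S * (Real.exp (om z).re * ρ ^ k) *
              (Real.exp C * Real.exp ((μ - C) * (r - ρ))) := by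
            rw [← Real.exp_add, ← Real.exp_add]; congr 2; ring
        _ = _ := by rw [hD]; ring)
    (right_mem_Icc.2 hz1)
  simp only [sub_self, mul_zero, Real.exp_zero, mul_one, hez, Real.norm_eq_abs] at key
  refine key.trans ?_
  have h8 : 8 * Real.exp C / (μ - C) ≤ ϑ :=
    (div_le_div_of_nonneg_left (by positivity) (by linarith) (by linarith)).trans hϑ
  have h9 : D / (μ - C) = 8 * Real.exp C / (μ - C) * S * (Real.exp (om z).re * ρ ^ k) := by
    rw [hD]; ring
  rw [h9]
  gcongr

variable {C L ν m : ℝ} {f : ℂ → ℝ} {F om T : ℂ → ℂ} {O : Set ℂ}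

/-- Maximum principle for the weighted function on the annulus. -/
lemma Cfg.weighted_le (h : Cfg C L ν m f F om T O) (hL : 2 ≤ L) {k : ℕ} {S : ℝ}
    (hfr : ∀ z, 1 ≤ ‖z‖ → ‖z‖ ≤ 11 / 10 * L → (z ∉ O ∨ ‖z‖ = 1 ∨ ‖z‖ = 11 / 10 * L) →
      ‖F z‖ ≤ S * (Real.exp (om z).re * ‖z‖ ^ k))
    (hν : 0 ≤ ν) (z : ℂ) (hz1 : 1 ≤ ‖z‖) (hz : ‖z‖ ≤ 11 / 10 * L) :
    ‖F z‖ ≤ (S + 2 * ν) * (Real.exp (om z).re * ‖z‖ ^ k) := by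
  have hwt : 0 ≤ Real.exp (om z).re * ‖z‖ ^ k := by positivity
  by_cases hzf : z ∉ O ∨ ‖z‖ = 1 ∨ ‖z‖ = 11 / 10 * L
  · refine (hfr z hz1 hz hzf).trans (by gcongr; linarith)
  push Not at hzf
  obtain ⟨hzO, hz1', hz'⟩ := hzf
  set N : Set ℂ := O ∩ {z | 1 < ‖z‖ ∧ ‖z‖ < 11 / 10 * L} with hN
  have hopen : IsOpen {z : ℂ | 1 < ‖z‖ ∧ ‖z‖ < 11 / 10 * L} :=
    (isOpen_lt continuous_const continuous_norm).inter (isOpen_lt continuous_norm continuous_const)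
  have hNo : IsOpen N := h.open_O.inter hopen
  have hcl : closure N ⊆ {z | 1 ≤ ‖z‖ ∧ ‖z‖ ≤ 11 / 10 * L} := by
    refine closure_minimal (fun x hx => ⟨hx.2.1.le, hx.2.2.le⟩) ?_
    exact (isClosed_le continuous_const continuous_norm).inter
      (isClosed_le continuous_norm continuous_const)
  have hne : ∀ z : ℂ, 1 ≤ ‖z‖ → z ≠ 0 := fun z hz h0 => by
    rw [h0, norm_zero] at hz; linarith
  have hval : ∀ z : ℂ, 1 ≤ ‖z‖ →
      ‖cexp (-om z) * F z / z ^ k‖ = ‖F z‖ / (Real.exp (om z).re * ‖z‖ ^ k) := by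
    intro z hz
    rw [norm_div, norm_mul, Complex.norm_exp, norm_pow, Complex.neg_re, Real.exp_neg]
    field_simp
  have hT : ∀ z : ℂ, 1 ≤ ‖z‖ → ‖z‖ ≤ 11 / 10 * L → ‖T z / z ^ k‖ ≤ ν := by
    intro z hz hz2
    rw [norm_div, norm_pow]
    exact (div_le_self (norm_nonneg _) (one_le_pow₀ hz)).trans (h.T_le z hz2)
  have hdc : DiffContOnCl ℂ (fun z => (cexp (-om z) * F z - T z) / z ^ k) N := by
    refine ⟨fun x hx => ?_, fun x hx => ?_⟩
    · exact ((h.hol x hx.1 hx.2.2).div (differentiableAt_pow k)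
        (pow_ne_zero _ (hne x hx.2.1.le))).differentiableWithinAt
    · refine ContinuousAt.continuousWithinAt (ContinuousAt.div ?_ (by fun_prop)
        (pow_ne_zero _ (hne x (hcl hx).1)))
      have h1 := h.cont_F.continuousAt (x := x)
      have h2 := h.cont_om.continuousAt (x := x)
      have h3 := h.cont_T.continuousAt (x := x)
      fun_prop
  have hb : Bornology.IsBounded N :=
    (isBounded_closedBall (x := (0 : ℂ)) (r := 11 / 10 * L)).subset fun x hx => by
      simpa using hx.2.2.le
  have key := Complex.norm_le_of_forall_mem_frontier_norm_le hb hdc (C := S + ν)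
    (fun x hx => by
      have hx1 := hcl (frontier_subset_closure hx)
      have hx2 : x ∉ N := by
        rw [hNo.frontier_eq] at hx; exact hx.2
      have hx3 : x ∉ O ∨ ‖x‖ = 1 ∨ ‖x‖ = 11 / 10 * L := by
        by_contra hcon
        push Not at hcon
        exact hx2 ⟨hcon.1, lt_of_le_of_ne hx1.1 (Ne.symm hcon.2.1), lt_of_le_of_ne hx1.2 hcon.2.2⟩
      have h1 := hfr x hx1.1 hx1.2 hx3
      have hpos : 0 < Real.exp (om x).re * ‖x‖ ^ k := by
        have : 0 < ‖x‖ := by linarith [hx1.1]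
        positivity
      rw [← div_le_iff₀ hpos, ← hval x hx1.1] at h1
      rw [sub_div]
      exact (norm_sub_le _ _).trans (add_le_add h1 (hT x hx1.1 hx1.2)))
    (subset_closure (show z ∈ N from ⟨hzO, lt_of_le_of_ne hz1 (Ne.symm hz1'),
      lt_of_le_of_ne hz hz'⟩))
  have hpos : 0 < Real.exp (om z).re * ‖z‖ ^ k := by
    have : 0 < ‖z‖ := by linarith
    positivity
  rw [← div_le_iff₀ hpos, ← hval z hz1]
  rw [sub_div] at key
  have h4 := norm_sub_norm_le (cexp (-om z) * F z / z ^ k) (T z / z ^ k)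
  linarith [hT z hz1 hz]

set_option maxHeartbeats 1000000 in
/-- Abstract three-circle estimate. -/
lemma Cfg.three_circles (h : Cfg C L ν m f F om T O) (hC : 1 ≤ C) (hL : 2 ≤ L) (hm : 0 ≤ m)
    (hν : 0 ≤ ν) {k : ℕ} (hk : C + 16 * C * Real.exp C ≤ k / (11 / 10 * L)) {y : ℂ}
    (hy : ‖y‖ = L / 2) (hfy : 1 / 2 ≤ |f y|) :
    1 / 2 ≤ 7 * (m + ν) * Real.exp (C * (1 + 11 / 10 * L)) ^ 2 * (L / 2) ^ k +
      Real.exp (C * (1 + 11 / 10 * L)) ^ 2 / 2 ^ k := by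
  set E := Real.exp (C * (1 + 11 / 10 * L)) with hE
  have hE1 : 1 ≤ E := Real.one_le_exp (by positivity)
  have hL0 : 0 ≤ L := by linarith
  have hC0 : 0 ≤ C := by linarith
  have hwt_lo : ∀ z, 1 ≤ ‖z‖ → ‖z‖ ≤ 11 / 10 * L → 1 / E ≤ Real.exp (om z).re * ‖z‖ ^ k := by
    intro z hz1 hz
    have h1 := (abs_le.1 (h.abs_re_le hC0 hL0 hz)).1
    rw [hE, one_div, ← Real.exp_neg]
    exact (Real.exp_le_exp.2 h1).trans (le_mul_of_one_le_right (Real.exp_pos _).le (one_le_pow₀ hz1))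
  have hcpt : IsCompact {z : ℂ | 1 ≤ ‖z‖ ∧ ‖z‖ ≤ 11 / 10 * L} := by
    refine (isCompact_closedBall (0 : ℂ) (11 / 10 * L)).of_isClosed_subset
      ((isClosed_le continuous_const continuous_norm).inter
      (isClosed_le continuous_norm continuous_const)) fun z hz => ?_
    simpa using hz.2
  have hyK : y ∈ {z : ℂ | 1 ≤ ‖z‖ ∧ ‖z‖ ≤ 11 / 10 * L} := by
    constructor <;> rw [hy] <;> linarith
  have hpos : ∀ z : ℂ, 1 ≤ ‖z‖ → 0 < Real.exp (om z).re * ‖z‖ ^ k := fun z hz => by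
    have : 0 < ‖z‖ := by linarith
    positivity
  obtain ⟨x, hx, hmax⟩ := hcpt.exists_isMaxOn ⟨y, hyK⟩
    (f := fun z => |f z| / (Real.exp (om z).re * ‖z‖ ^ k)) (by
      intro z hz
      have h1 := h.diff_f.continuous.continuousAt (x := z)
      have h2 := h.cont_om.continuousAt (x := z)
      refine ContinuousAt.continuousWithinAt (ContinuousAt.div (by fun_prop) ?_ (hpos z hz.1).ne')
      fun_prop)
  set A := |f x| / (Real.exp (om x).re * ‖x‖ ^ k) with hA
  have hA0 : 0 ≤ A := div_nonneg (abs_nonneg _) (hpos x hx.1).le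
  have hAle : ∀ z, 1 ≤ ‖z‖ → ‖z‖ ≤ 11 / 10 * L → |f z| ≤ A * (Real.exp (om z).re * ‖z‖ ^ k) := by
    intro z hz1 hz
    have := hmax (show z ∈ {z : ℂ | 1 ≤ ‖z‖ ∧ ‖z‖ ≤ 11 / 10 * L} from ⟨hz1, hz⟩)
    exact (div_le_iff₀ (hpos z hz1)).1 this
  set I := C * (m + ν) * E with hI
  set P := C * E / (11 / 10 * L) ^ k with hP
  have hI0 : 0 ≤ I := by positivity
  have hP0 : 0 ≤ P := by positivity
  have hS := h.weighted_le hL (k := k) (S := C * A + I + P) (by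
    intro z hz1 hz hc
    have hw := (hpos z hz1).le
    have e1 : (C * A + I + P) * (Real.exp (om z).re * ‖z‖ ^ k) =
      C * (A * (Real.exp (om z).re * ‖z‖ ^ k)) + I * (Real.exp (om z).re * ‖z‖ ^ k) +
        P * (Real.exp (om z).re * ‖z‖ ^ k) := by ring
    have p1 : 0 ≤ C * (A * (Real.exp (om z).re * ‖z‖ ^ k)) := by positivity
    have p2 : 0 ≤ I * (Real.exp (om z).re * ‖z‖ ^ k) := by positivity
    have p3 : 0 ≤ P * (Real.exp (om z).re * ‖z‖ ^ k) := by positivity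
    rw [e1]
    rcases hc with hc | hc | hc
    · have := h.far z hc hz1 hz
      have h2 := mul_le_mul_of_nonneg_left (hAle z hz1 hz) hC0
      linarith
    · have h1 := h.inner_F z hc
      have h2 : C * (m + ν) ≤ I * (Real.exp (om z).re * ‖z‖ ^ k) := by
        have h3 := mul_le_mul_of_nonneg_left (hwt_lo z hz1 hz) hI0
        have h4 : I * (1 / E) = C * (m + ν) := by rw [hI]; field_simp
        linarith
      linarith
    · have h1 := h.outer z hc
      have h2 : C ≤ P * (Real.exp (om z).re * ‖z‖ ^ k) := by
        have h3 : 1 / E ≤ Real.exp (om z).re := by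
          rw [hE, one_div, ← Real.exp_neg]
          exact Real.exp_le_exp.2 (abs_le.1 (h.abs_re_le hC0 hL0 hz)).1
        have h5 : P * (1 / E * ‖z‖ ^ k) = C := by
          rw [hP, hc]; field_simp
        have h6 : P * (1 / E * ‖z‖ ^ k) ≤ P * (Real.exp (om z).re * ‖z‖ ^ k) := by gcongr
        linarith
      linarith) hν
  set S := C * A + I + P + 2 * ν with hSdef
  have hS0 : 0 ≤ S := by positivity
  have hCe : 0 < 16 * C * Real.exp C := by positivity
  have hrad := h.radial hC0 hL hm hS0 (k := k) (ϑ := 1 / (2 * C)) (by linarith) (by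
    rw [div_le_div_iff₀ (by linarith) (by positivity)]
    nlinarith) hS
  have hA2 : A ≤ 2 * m * E + 1 / (2 * C) * S := by
    have h1 := hrad x hx.1 hx.2
    have h2 := hpos x hx.1
    rw [hA, div_le_iff₀ h2]
    have h3 := mul_le_mul_of_nonneg_left (hwt_lo x hx.1 hx.2) (show 0 ≤ 2 * m * E by positivity)
    have h4 : 2 * m * E * (1 / E) = 2 * m := by field_simp
    linarith
  have hS2 : 1 / (2 * C) * S ≤ 2 * m * E + (m + ν) * E + E / (11 / 10 * L) ^ k + 2 * ν := by
    have h1 := mul_le_mul_of_nonneg_left hA2 hC0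
    have h2 : C * (1 / (2 * C) * S) = S / 2 := by field_simp
    have h3 : S ≤ 2 * (C * (2 * m * E) + I + P + 2 * ν) := by
      rw [mul_add, h2] at h1; linarith
    have h4 : 1 / (2 * C) * S ≤ 1 / (2 * C) * (2 * (C * (2 * m * E) + I + P + 2 * ν)) := by gcongr
    have h5 : 1 / (2 * C) * (2 * (C * (2 * m * E) + I + P + 2 * ν)) =
        2 * m * E + (m + ν) * E + E / (11 / 10 * L) ^ k + 2 * ν / C := by
      rw [hI, hP]; field_simp
    have h6 : 2 * ν / C ≤ 2 * ν := div_le_self (by positivity) hC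
    linarith
  have hfin := hrad y hyK.1 hyK.2
  have hwy : Real.exp (om y).re * ‖y‖ ^ k ≤ E * (L / 2) ^ k := by
    rw [hy]
    gcongr
    exact Real.exp_le_exp.2 (abs_le.1 (h.abs_re_le hC0 hL0 hyK.2)).2
  have hLk : 1 ≤ (L / 2) ^ k := one_le_pow₀ (by linarith)
  have h7 : 1 / (2 * C) * S * (Real.exp (om y).re * ‖y‖ ^ k) ≤
      (2 * m * E + (m + ν) * E + E / (11 / 10 * L) ^ k + 2 * ν) * (E * (L / 2) ^ k) := by
    have := (hpos y hyK.1).le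
    gcongr
  have h8 : (E / (11 / 10 * L) ^ k) * (E * (L / 2) ^ k) ≤ E ^ 2 / 2 ^ k := by
    have e1 : (E / (11 / 10 * L) ^ k) * (E * (L / 2) ^ k) = E ^ 2 * ((L / 2) / (11 / 10 * L)) ^ k := by
      rw [div_pow (L / 2) (11 / 10 * L)]
      generalize (L / 2) ^ k = X
      generalize (11 / 10 * L) ^ k = Y
      ring
    have e2 : E ^ 2 / 2 ^ k = E ^ 2 * (1 / 2) ^ k := by rw [one_div, inv_pow]; rfl
    rw [e1, e2]
    refine mul_le_mul_of_nonneg_left (pow_le_pow_left₀ (by positivity) ?_ k) (by positivity)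
    rw [div_le_iff₀ (by positivity)]; linarith
  have h9 : (2 * m * E + (m + ν) * E + 2 * ν) * (E * (L / 2) ^ k) ≤
      5 * (m + ν) * E ^ 2 * (L / 2) ^ k := by
    have e1 : 5 * (m + ν) * E ^ 2 * (L / 2) ^ k = (5 * (m + ν) * E) * (E * (L / 2) ^ k) := by ring
    rw [e1]
    have hE0 : 0 ≤ E := zero_le_one.trans hE1
    have hE2 : 0 ≤ E - 1 := sub_nonneg.2 hE1
    gcongr
    linarith [mul_nonneg hm hE0, mul_nonneg hν hE2, mul_nonneg hν hE0]
  have h10 : 2 * m ≤ 2 * (m + ν) * E ^ 2 * (L / 2) ^ k := by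
    have : 1 ≤ E ^ 2 * (L / 2) ^ k := one_le_mul_of_one_le_of_one_le (one_le_pow₀ hE1) hLk
    have h11 := mul_nonneg (add_nonneg hm hν) (sub_nonneg.2 this)
    linarith
  have h12 : (2 * m * E + (m + ν) * E + E / (11 / 10 * L) ^ k + 2 * ν) * (E * (L / 2) ^ k) =
      (2 * m * E + (m + ν) * E + 2 * ν) * (E * (L / 2) ^ k) +
        (E / (11 / 10 * L) ^ k) * (E * (L / 2) ^ k) := by ring
  linarith

/-- Lower bound on the inner circle in terms of `L`. -/
lemma Cfg.lower_bound {C : ℝ} (hC : 1 ≤ C) : ∃ C' : ℝ, 0 < C' ∧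
    ∀ (L ν m : ℝ) (f : ℂ → ℝ) (F om T : ℂ → ℂ) (O : Set ℂ) (y : ℂ),
      2 ≤ L → 0 ≤ m → 0 ≤ ν → Cfg C L ν m f F om T O → ‖y‖ = L / 2 → 1 / 2 ≤ |f y| →
      Real.exp (-C' * (L * Real.log L)) ≤ m + ν := by
  set K : ℝ := 2 * C + 32 * C * Real.exp C + 20 * C with hK
  have hK1 : 1 ≤ K := by have := Real.exp_pos C; nlinarith
  refine ⟨4 + 8 * C + 2 * K, by positivity, ?_⟩
  intro L ν m f F om T O y hL hm hν h hy hfy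
  set k := ⌈K * L⌉₊ with hk
  have hk1 : K * L ≤ k := Nat.le_ceil _
  have hk2 : (k : ℝ) ≤ 2 * K * L := by
    have := Nat.ceil_lt_add_one (show 0 ≤ K * L by positivity)
    nlinarith
  have key := h.three_circles hC hL hm hν (k := k) (by
    rw [le_div_iff₀ (by positivity)]
    have : (C + 16 * C * Real.exp C) * (11 / 10 * L) ≤ K * L := by
      have e1 : 0 ≤ C * Real.exp C * L := by positivity
      have e2 : 0 ≤ C * L := by positivity
      rw [hK]; nlinarith
    linarith) hy hfy
  rw [← Real.exp_nat_mul] at key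
  set e := ((2 : ℕ) : ℝ) * (C * (1 + 11 / 10 * L)) with he
  have he4 : e ≤ 4 * C * L := by
    rw [he]; push_cast; nlinarith
  have hlog2 : 0.69 < Real.log 2 := by linarith [Real.log_two_gt_d9]
  have h2k : Real.exp e / 2 ^ k ≤ 1 / 4 := by
    rw [div_le_div_iff₀ (by positivity) (by norm_num)]
    have h1 : (2 : ℝ) ^ k = Real.exp (k * Real.log 2) := by
      rw [Real.exp_nat_mul, Real.exp_log two_pos]
    have h4 : (4 : ℝ) ≤ Real.exp 3 := by linarith [Real.add_one_le_exp (3 : ℝ)]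
    rw [one_mul, h1]
    calc Real.exp e * 4 ≤ Real.exp e * Real.exp 3 := by gcongr
      _ = Real.exp (e + 3) := (Real.exp_add _ _).symm
      _ ≤ _ := by
        apply Real.exp_le_exp.2
        have h5 : K * L * 0.69 ≤ k * Real.log 2 := by
          apply mul_le_mul hk1 hlog2.le (by norm_num) (by positivity)
        have h6 : 20 * C * L ≤ K * L := by
          have : 0 ≤ C * Real.exp C := by positivity
          gcongr; rw [hK]; linarith
        nlinarith
  have hlogL : 0.69 < Real.log L := hlog2.trans_le (Real.log_le_log two_pos hL)
  have hLk : (L / 2) ^ k ≤ Real.exp (2 * K * L * Real.log L) := by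
    calc (L / 2) ^ k ≤ L ^ k := by gcongr; linarith
      _ = Real.exp (k * Real.log L) := by rw [Real.exp_nat_mul, Real.exp_log (by linarith)]
      _ ≤ _ := by gcongr
  have h28 : (28 : ℝ) ≤ Real.exp 4 := by
    have h1 : (2.7 : ℝ) ≤ Real.exp 1 := by linarith [Real.exp_one_gt_d9]
    have h2 : Real.exp 4 = Real.exp 1 ^ 4 := by rw [← Real.exp_nat_mul]; norm_num
    rw [h2]
    have : (2.7 : ℝ) ^ 4 ≤ Real.exp 1 ^ 4 := by gcongr
    norm_num at this ⊢
    linarith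
  have h5 : 1 ≤ (m + ν) * (Real.exp 4 * (Real.exp e * (L / 2) ^ k)) := by
    have h6 : 0 ≤ (m + ν) * (Real.exp e * (L / 2) ^ k) := by positivity
    nlinarith
  have h7 : Real.exp 4 * (Real.exp e * (L / 2) ^ k) ≤
      Real.exp ((4 + 8 * C + 2 * K) * (L * Real.log L)) := by
    calc _ ≤ Real.exp 4 * (Real.exp e * Real.exp (2 * K * L * Real.log L)) := by gcongr
      _ = Real.exp (4 + e + 2 * K * L * Real.log L) := by
        rw [← Real.exp_add, ← Real.exp_add]; congr 1; ring
      _ ≤ _ := by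
        apply Real.exp_le_exp.2
        have h8 : 1 ≤ L * Real.log L := by nlinarith
        have h9 : L ≤ 2 * (L * Real.log L) := by nlinarith
        have h10 : C * L ≤ C * (2 * (L * Real.log L)) := by gcongr
        nlinarith
  have h8 : 1 ≤ (m + ν) * Real.exp ((4 + 8 * C + 2 * K) * (L * Real.log L)) :=
    h5.trans (by gcongr)
  rw [neg_mul, Real.exp_neg, inv_le_iff_one_le_mul₀ (Real.exp_pos _)]
  exact h8

/-- Chaining a unit-scale oscillation bound. -/
lemma norm_sub_le_of_osc {g : ℂ → ℂ} {D R : ℝ} (hD : 0 ≤ D)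
    (h : ∀ w w', ‖w‖ ≤ R → ‖w - w'‖ ≤ 1 → ‖g w - g w'‖ ≤ D) (w w' : ℂ) (hw : ‖w‖ ≤ R)
    (hw' : ‖w'‖ ≤ R) : ‖g w - g w'‖ ≤ D * (1 + ‖w - w'‖) := by
  have key : ∀ n : ℕ, ∀ w, ‖w‖ ≤ R → ‖w - w'‖ ≤ n → ‖g w - g w'‖ ≤ n * D := by
    intro n
    induction n with
    | zero =>
      intro w _ hd
      have : w = w' := by simpa [sub_eq_zero] using hd
      simp [this]
    | succ n ih =>
      intro w hw hd
      push_cast at hd ⊢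
      have hn : (0 : ℝ) < n + 1 := by positivity
      set t : ℝ := n / (n + 1) with ht
      have ht0 : 0 ≤ t := by positivity
      have ht1 : 1 - t = 1 / (n + 1) := by rw [ht]; field_simp; ring
      have ht2 : 0 ≤ 1 - t := by rw [ht1]; positivity
      set v : ℂ := t * w + (1 - t : ℝ) * w' with hv
      have hvn : ‖v‖ ≤ R := by
        calc ‖v‖ ≤ ‖(t : ℂ) * w‖ + ‖((1 - t : ℝ) : ℂ) * w'‖ := norm_add_le _ _
          _ = t * ‖w‖ + (1 - t) * ‖w'‖ := by
            rw [norm_mul, norm_mul, Complex.norm_real, Complex.norm_real, Real.norm_of_nonneg ht0,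
              Real.norm_of_nonneg ht2]
          _ ≤ t * R + (1 - t) * R := by gcongr
          _ = R := by ring
      have h1 : v - w' = t * (w - w') := by rw [hv]; push_cast; ring
      have h2 : w - v = ((1 - t : ℝ) : ℂ) * (w - w') := by rw [hv]; push_cast; ring
      have h3 : ‖v - w'‖ ≤ n := by
        rw [h1, norm_mul, Complex.norm_real, Real.norm_of_nonneg ht0]
        calc t * ‖w - w'‖ ≤ t * (n + 1) := by gcongr
          _ = n := by rw [ht]; field_simp
      have h4 : ‖w - v‖ ≤ 1 := by
        rw [h2, norm_mul, Complex.norm_real, Real.norm_of_nonneg ht2, ht1]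
        rw [one_div, inv_mul_le_iff₀ hn]; linarith
      have h5 := ih v hvn h3
      have h6 := h w v hw h4
      calc ‖g w - g w'‖ = ‖(g w - g v) + (g v - g w')‖ := by congr 1; ring
        _ ≤ ‖g w - g v‖ + ‖g v - g w'‖ := norm_add_le _ _
        _ ≤ (n + 1) * D := by linarith
  refine (key ⌈‖w - w'‖⌉₊ w hw (Nat.le_ceil _)).trans ?_
  rw [mul_comm]
  have := Nat.ceil_lt_add_one (norm_nonneg (w - w'))
  gcongr
  linarith

/-- Interior gradient bound at unit scale. -/
lemma norm_dr_le_of_abs_le : ∃ C > 0, ∀ (u : ℂ → ℝ) (a : ℝ) (z : ℂ), ContDiff ℝ ∞ u → 0 ≤ a →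
    (∀ y ∈ ball z (1 / 2), |u y| ≤ a) → (∀ y ∈ ball z (1 / 2), |lp u y| ≤ a) →
    ‖dr u z‖ ≤ C * a := by
  obtain ⟨C, hC, h⟩ := norm_dr_le_of_bound
  refine ⟨2 * C, by positivity, fun u a z hu ha h1 h2 => ?_⟩
  have hmem : ∀ y ∈ ball (0 : ℂ) (1 / 2), z + (1 : ℝ) * y ∈ ball z (1 / 2) := by
    intro y hy
    rw [mem_ball_zero_iff] at hy
    rw [mem_ball, dist_eq_norm]; simpa using hy
  have key := h (fun x : ℂ => u (z + (1 : ℝ) * x)) a (hu.comp (contDiff_affine z 1)) ha (by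
    intro y hy
    rw [lp_comp_affine hu, one_pow, one_mul]
    exact h2 _ (hmem y hy))
  rw [dr_comp_affine hu] at key
  simp only [Complex.ofReal_one, mul_zero, add_zero, one_mul] at key
  have h3 : ∫ y in ball (0 : ℂ) (1 / 2), |u (z + y)| ≤ a := by
    have h4 := norm_setIntegral_le_of_norm_le_const (μ := volume) (s := ball (0 : ℂ) (1 / 2))
      (f := fun y => |u (z + y)|) (C := a) (by
        rw [Complex.volume_ball]; exact ENNReal.mul_lt_top (by simp) (by simp)) (by
        intro y hy
        have := h1 _ (hmem y hy)
        simpa using this)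
    have h5 : (volume : Measure ℂ).real (ball (0 : ℂ) (1 / 2)) ≤ 1 := by
      rw [Measure.real, Complex.volume_ball]
      simp only [ENNReal.toReal_mul, ENNReal.toReal_pow, ENNReal.coe_toReal, NNReal.coe_real_pi]
      rw [ENNReal.toReal_ofReal (by norm_num)]
      linarith [Real.pi_lt_d2]
    calc _ ≤ ‖∫ y in ball (0 : ℂ) (1 / 2), |u (z + y)|‖ := Real.le_norm_self _
      _ ≤ a * (volume : Measure ℂ).real (ball (0 : ℂ) (1 / 2)) := h4
      _ ≤ a * 1 := by gcongr
      _ = a := mul_one a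
  calc ‖dr u z‖ ≤ C * ((∫ y in ball (0 : ℂ) (1 / 2), |u (z + y)|) + a) := key
    _ ≤ C * (a + a) := by gcongr
    _ = 2 * C * a := by ring

/-- A gradient bound gives a Lipschitz bound. -/
lemma abs_sub_le_of_norm_dr_le {u : ℂ → ℝ} (hu : Differentiable ℝ u) {z x : ℂ} {r G : ℝ}
    (h : ∀ y ∈ ball z r, ‖dr u y‖ ≤ G) (hx : x ∈ ball z r) : |u x - u z| ≤ 2 * G * ‖x - z‖ := by
  have hr : 0 < r := pos_of_mem_ball hx
  have := (convex_ball z r).norm_image_sub_le_of_norm_fderiv_le (𝕜 := ℝ) (f := u) (C := 2 * G)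
    (fun y _ => hu y) (fun y hy => (norm_fderiv_le (hu y)).trans (by linarith [h y hy]))
    (mem_ball_self hr) hx
  simpa using this

section quotient

/-- The complex gradient field attached to the quotient `u / (1 + ψ)`. -/
def gradField (u ψ : ℂ → ℝ) (z : ℂ) : ℂ := ((1 + ψ z : ℝ) : ℂ) * dr u z - (u z : ℂ) * dr ψ z

variable {u ψ : ℂ → ℝ}

lemma contDiff_gradField (hu : ContDiff ℝ ∞ u) (hψ : ContDiff ℝ ∞ ψ) :
    ContDiff ℝ ∞ (gradField u ψ) :=
  ((contDiff_ofReal (contDiff_const.add hψ)).mul (contDiff_dr hu)).sub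
    ((contDiff_ofReal hu).mul (contDiff_dr hψ))

lemma dr_one_add (hψ : Differentiable ℝ ψ) (z : ℂ) : dr (fun z => 1 + ψ z) z = dr ψ z := by
  have h1 : Differentiable ℝ (fun z => 1 + ψ z) := (differentiable_const (1 : ℝ)).add hψ
  rw [dr_eq (h1 z), dr_eq (hψ z), fderiv_const_add]

lemma dr_div (hu : Differentiable ℝ u) (hψ : Differentiable ℝ ψ) (h : ∀ z, |ψ z| ≤ 1 / 2) (z : ℂ) :
    dr (fun z => u z / (1 + ψ z)) z = gradField u ψ z / ((1 + ψ z : ℝ) : ℂ) ^ 2 := by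
  have h1 : ∀ z, 1 + ψ z ≠ 0 := fun z => by have := (abs_le.1 (h z)).1; linarith
  have hφ : Differentiable ℝ (fun z => 1 + ψ z) := (differentiable_const (1 : ℝ)).add hψ
  have hq : Differentiable ℝ (fun z => u z / (1 + ψ z)) := by
    simp only [div_eq_mul_inv]
    exact hu.mul (hφ.inv h1)
  have e := dz_mul (f := fun z => ((u z / (1 + ψ z) : ℝ) : ℂ)) (g := fun z => ((1 + ψ z : ℝ) : ℂ))
    (z := z) (Complex.ofRealCLM.differentiableAt.comp z (hq z))
    (Complex.ofRealCLM.differentiableAt.comp z (hφ z))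
  have e2 : (fun w => ((u w / (1 + ψ w) : ℝ) : ℂ) * ((1 + ψ w : ℝ) : ℂ)) = fun w => (u w : ℂ) := by
    funext w
    rw [← Complex.ofReal_mul, div_mul_cancel₀ _ (h1 w)]
  rw [e2] at e
  change dr u z = _ * dr (fun z => 1 + ψ z) z + dr (fun z => u z / (1 + ψ z)) z * _ at e
  rw [dr_one_add hψ] at e
  have h2 : ((1 + ψ z : ℝ) : ℂ) ≠ 0 := by exact_mod_cast h1 z
  rw [eq_div_iff (pow_ne_zero 2 h2), gradField, e]
  push_cast at h2 ⊢
  field_simp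
  ring

lemma db_gradField (hu : ContDiff ℝ ∞ u) (hψ : ContDiff ℝ ∞ ψ) (h : ∀ z, |ψ z| ≤ 1 / 2) (z : ℂ) :
    db (gradField u ψ) z =
      ((starRingEnd ℂ) (dr ψ z) * gradField u ψ z - dr ψ z * (starRingEnd ℂ) (gradField u ψ z)) /
        ((1 + ψ z : ℝ) : ℂ) + (((1 + ψ z) * lp u z - u z * lp ψ z : ℝ) : ℂ) / 4 := by
  have h1 : 1 + ψ z ≠ 0 := by have := (abs_le.1 (h z)).1; linarith
  have hdu := hu.differentiable (by simp)
  have hdψ := hψ.differentiable (by simp)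
  have hφ : Differentiable ℝ (fun z => 1 + ψ z) := (differentiable_const (1 : ℝ)).add hdψ
  have d1 : DifferentiableAt ℝ (fun z => ((1 + ψ z : ℝ) : ℂ)) z :=
    Complex.ofRealCLM.differentiableAt.comp z (hφ z)
  have d2 : DifferentiableAt ℝ (fun z => (u z : ℂ)) z :=
    Complex.ofRealCLM.differentiableAt.comp z (hdu z)
  have d3 := (contDiff_dr hu).differentiable (by simp) z
  have d4 := (contDiff_dr hψ).differentiable (by simp) z
  have e : db (gradField u ψ) z = _ := db_sub (d1.mul d3) (d2.mul d4)
  rw [e, db_mul d1 d3, db_mul d2 d4, db_ofReal (hφ z), db_ofReal (hdu z), db_dr hu, db_dr hψ,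
    dr_one_add hdψ, gradField]
  have h2 : ((1 + ψ z : ℝ) : ℂ) ≠ 0 := by exact_mod_cast h1
  simp only [map_sub, map_mul, Complex.conj_ofReal]
  push_cast at h2 ⊢
  field_simp
  ring

/-- A regularised coefficient with `∂F/∂(conj z) ≈ beta * F`. -/
def beta (u ψ : ℂ → ℝ) (r : ℝ) (z : ℂ) : ℂ :=
  ((starRingEnd ℂ) (dr ψ z) - dr ψ z * (starRingEnd ℂ) (gradField u ψ z) ^ 2 /
    ((‖gradField u ψ z‖ ^ 2 + r ^ 2 : ℝ) : ℂ)) / ((1 + ψ z : ℝ) : ℂ)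

lemma contDiff_beta (hu : ContDiff ℝ ∞ u) (hψ : ContDiff ℝ ∞ ψ) (h : ∀ z, |ψ z| ≤ 1 / 2) {r : ℝ}
    (hr : 0 < r) : ContDiff ℝ ∞ (beta u ψ r) := by
  have hF := contDiff_gradField hu hψ
  have c1 : ContDiff ℝ ∞ fun z => (starRingEnd ℂ) (dr ψ z) :=
    Complex.conjCLE.contDiff.comp (contDiff_dr hψ)
  have c2 : ContDiff ℝ ∞ fun z => (starRingEnd ℂ) (gradField u ψ z) :=
    Complex.conjCLE.contDiff.comp hF
  have c3 : ContDiff ℝ ∞ fun z => ((‖gradField u ψ z‖ ^ 2 + r ^ 2 : ℝ) : ℂ) :=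
    contDiff_ofReal ((hF.norm_sq ℝ).add contDiff_const)
  have c4 : ContDiff ℝ ∞ fun z => ((1 + ψ z : ℝ) : ℂ) := contDiff_ofReal (contDiff_const.add hψ)
  unfold beta
  simp only [div_eq_mul_inv]
  refine (c1.sub (((contDiff_dr hψ).mul (c2.pow 2)).mul (c3.inv fun z => ?_))).mul
    (c4.inv fun z => ?_)
  · have : (0 : ℝ) < ‖gradField u ψ z‖ ^ 2 + r ^ 2 := by positivity
    exact_mod_cast this.ne'
  · have : 1 + ψ z ≠ 0 := by have := (abs_le.1 (h z)).1; linarith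
    exact_mod_cast this

lemma norm_beta_le (h : ∀ z, |ψ z| ≤ 1 / 2) {r : ℝ} (hr : 0 < r) (z : ℂ) :
    ‖beta u ψ r z‖ ≤ 4 * ‖dr ψ z‖ := by
  have h1 : 1 / 2 ≤ 1 + ψ z := by have := (abs_le.1 (h z)).1; linarith
  have hp : (0 : ℝ) < ‖gradField u ψ z‖ ^ 2 + r ^ 2 := by positivity
  rw [beta, norm_div, Complex.norm_real, Real.norm_of_nonneg (by linarith), div_le_iff₀ (by linarith)]
  have h2 : ‖dr ψ z * (starRingEnd ℂ) (gradField u ψ z) ^ 2 /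
      ((‖gradField u ψ z‖ ^ 2 + r ^ 2 : ℝ) : ℂ)‖ ≤ ‖dr ψ z‖ := by
    rw [norm_div, norm_mul, norm_pow, RCLike.norm_conj, Complex.norm_real, Real.norm_of_nonneg hp.le,
      div_le_iff₀ hp]
    gcongr
    linarith [sq_nonneg r]
  have h3 := norm_sub_le ((starRingEnd ℂ) (dr ψ z)) (dr ψ z * (starRingEnd ℂ) (gradField u ψ z) ^ 2 /
      ((‖gradField u ψ z‖ ^ 2 + r ^ 2 : ℝ) : ℂ))
  rw [RCLike.norm_conj] at h3
  nlinarith [norm_nonneg (dr ψ z)]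

lemma norm_db_gradField_sub_le (hu : ContDiff ℝ ∞ u) (hψ : ContDiff ℝ ∞ ψ)
    (h : ∀ z, |ψ z| ≤ 1 / 2) {r : ℝ} (hr : 0 < r) (z : ℂ) :
    ‖db (gradField u ψ) z - beta u ψ r z * gradField u ψ z‖ ≤
      r * ‖dr ψ z‖ + |(1 + ψ z) * lp u z - u z * lp ψ z| / 4 := by
  have h1 : 1 / 2 ≤ 1 + ψ z := by have := (abs_le.1 (h z)).1; linarith
  have h2 : ((1 + ψ z : ℝ) : ℂ) ≠ 0 := by exact_mod_cast (by linarith : 1 + ψ z ≠ 0)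
  have hp : (0 : ℝ) < ‖gradField u ψ z‖ ^ 2 + r ^ 2 := by positivity
  have hp2 : ((‖gradField u ψ z‖ ^ 2 + r ^ 2 : ℝ) : ℂ) ≠ 0 := by exact_mod_cast hp.ne'
  rw [db_gradField hu hψ h, beta]
  set F := gradField u ψ z
  set G := (((1 + ψ z) * lp u z - u z * lp ψ z : ℝ) : ℂ)
  set c := ((1 + ψ z : ℝ) : ℂ)
  have hFF : (starRingEnd ℂ) F * F = ((‖F‖ ^ 2 : ℝ) : ℂ) := by
    rw [mul_comm, Complex.mul_conj, Complex.normSq_eq_norm_sq]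
  have e : ((starRingEnd ℂ) (dr ψ z) * F - dr ψ z * (starRingEnd ℂ) F) / c + G / 4 -
      ((starRingEnd ℂ) (dr ψ z) - dr ψ z * (starRingEnd ℂ) F ^ 2 / ((‖F‖ ^ 2 + r ^ 2 : ℝ) : ℂ)) / c *
        F = -(dr ψ z * ((starRingEnd ℂ) F * ((r ^ 2 : ℝ) : ℂ)) / ((‖F‖ ^ 2 + r ^ 2 : ℝ) : ℂ) / c) +
          G / 4 := by
    have e1 : (starRingEnd ℂ) F ^ 2 * F = (starRingEnd ℂ) F * (((‖F‖ ^ 2 + r ^ 2 : ℝ) : ℂ) -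
        ((r ^ 2 : ℝ) : ℂ)) := by
      rw [← Complex.ofReal_sub, add_sub_cancel_right, ← hFF]; ring
    field_simp
    linear_combination (4 * dr ψ z) * e1
  rw [e]
  refine (norm_add_le _ _).trans (add_le_add ?_ (le_of_eq ?_))
  · rw [norm_neg, norm_div, norm_div, norm_mul, norm_mul, RCLike.norm_conj, Complex.norm_real,
      Complex.norm_real, Complex.norm_real, Real.norm_of_nonneg (by positivity : 0 ≤ r ^ 2),
      Real.norm_of_nonneg hp.le, Real.norm_of_nonneg (by linarith : 0 ≤ 1 + ψ z),
      div_le_iff₀ (by linarith), div_le_iff₀ hp]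
    have h3 : ‖F‖ * r ^ 2 ≤ r * (1 / 2) * (‖F‖ ^ 2 + r ^ 2) := by
      nlinarith [mul_nonneg hr.le (sq_nonneg (‖F‖ - r))]
    have h4 : r * (1 / 2) * (‖F‖ ^ 2 + r ^ 2) ≤ r * (1 + ψ z) * (‖F‖ ^ 2 + r ^ 2) := by gcongr
    calc _ ≤ ‖dr ψ z‖ * (r * (1 + ψ z) * (‖F‖ ^ 2 + r ^ 2)) :=
          mul_le_mul_of_nonneg_left (h3.trans h4) (norm_nonneg _)
      _ = _ := by ring
  · rw [norm_div, Complex.norm_real, Real.norm_eq_abs]; norm_num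

end quotient

/-- An approximate solution together with its charge and multiplier. -/
structure Setup (K κ L δ θ : ℝ) (n : ℕ) (U u w ψ Pn Pf : ℂ → ℝ) : Prop where
  hK : 1 ≤ K
  κ_nonneg : 0 ≤ κ
  κ_le : κ ≤ K
  hL : 80 ≤ L
  δ_pos : 0 < δ
  δ_le : δ ≤ 1
  hn : 4 ≤ n
  θ_pos : 0 < θ
  θ_le : θ ≤ 1 / n
  U_le : ∀ z, |U z| ≤ 1
  cont : ContinuousOn U (ball 0 (3 / 2 * L))
  ap : Approx L δ θ U u w
  ch : Charge L U n Pn Pf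
  smooth_ψ : ContDiff ℝ ∞ ψ
  ψ_half : ∀ z, |ψ z| ≤ 1 / 2
  ψ_le : ∀ z, |ψ z| ≤ K * δ
  lp_ψ : ∀ z, |lp ψ z| ≤ K * δ * (Pn z + Pf z + 1)
  res : ∀ z ∈ ball (0 : ℂ) (7 / 5 * L),
    |lp ψ z + w z * (1 + ψ z) - κ * (Pn z + Pf z) * ψ z| ≤ 1 / n

namespace Setup

variable {K κ L δ θ : ℝ} {n : ℕ} {U u w ψ Pn Pf : ℂ → ℝ}

lemma n_pos (h : Setup K κ L δ θ n U u w ψ Pn Pf) : (4 : ℝ) ≤ n := by exact_mod_cast h.hn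

lemma θ_quarter (h : Setup K κ L δ θ n U u w ψ Pn Pf) : θ ≤ 1 / 4 :=
  h.θ_le.trans (one_div_le_one_div_of_le (by norm_num) h.n_pos)

lemma φ_pos (h : Setup K κ L δ θ n U u w ψ Pn Pf) (z : ℂ) : 1 / 2 ≤ 1 + ψ z ∧ 1 + ψ z ≤ 3 / 2 := by
  have := abs_le.1 (h.ψ_half z)
  constructor <;> linarith

lemma diff_u (h : Setup K κ L δ θ n U u w ψ Pn Pf) : Differentiable ℝ u :=
  h.ap.smooth.differentiable (by simp)

lemma abs_u_le (h : Setup K κ L δ θ n U u w ψ Pn Pf) {z : ℂ} (hz : ‖z‖ < 29 / 20 * L) {a : ℝ}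
    (ha : ∀ y ∈ ball z 1, |U y| ≤ a) : |u z| ≤ a :=
  (h.ap.bd z (mem_ball_zero_iff.2 hz) a fun y hy =>
    ha y (ball_subset_ball (by linarith [h.θ_quarter]) hy)).1

end Setup

lemma ball_norm_lt {z y : ℂ} {s r t : ℝ} (hz : ‖z‖ < s) (hy : y ∈ ball z r) (h : s + r ≤ t) :
    ‖y‖ < t := by
  rw [mem_ball, dist_eq_norm] at hy
  have := norm_add_le (y - z) z
  rw [sub_add_cancel] at this
  linarith

/-- Gradient bound for the approximate solution. -/
lemma Setup.exists_norm_dr_u_le : ∃ C > 0, ∀ {K κ L δ θ : ℝ} {n : ℕ} {U u w ψ Pn Pf : ℂ → ℝ},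
    Setup K κ L δ θ n U u w ψ Pn Pf → ∀ z a, ‖z‖ < 7 / 5 * L → 0 ≤ a → (∀ y ∈ ball z 1, |U y| ≤ a) →
      ‖dr u z‖ ≤ C * a := by
  obtain ⟨C, hC, hd⟩ := norm_dr_le_of_abs_le
  refine ⟨C, hC, fun h z a hz ha hU => ?_⟩
  rename_i K κ L δ θ n U u w ψ Pn Pf
  have hb : ∀ y ∈ ball z (1 / 2), |u y| ≤ a ∧ |lp u y| ≤ δ * a := by
    intro y hy
    refine h.ap.bd y (mem_ball_zero_iff.2 (ball_norm_lt hz hy (by linarith [h.hL]))) a ?_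
    intro x hx
    refine hU x ?_
    rw [mem_ball] at *
    linarith [dist_triangle x y z, h.θ_quarter]
  refine hd u a z h.ap.smooth ha (fun y hy => (hb y hy).1) fun y hy => (hb y hy).2.trans ?_
  exact mul_le_of_le_one_left ha h.δ_le

lemma Setup.exists_abs_sub_le : ∃ C > 0, ∀ {K κ L δ θ : ℝ} {n : ℕ} {U u w ψ Pn Pf : ℂ → ℝ},
    Setup K κ L δ θ n U u w ψ Pn Pf → ∀ z a, ‖z‖ < 27 / 20 * L → 0 ≤ a →
      (∀ y ∈ ball z 2, |U y| ≤ a) → ∀ x ∈ ball z 1, |u x - u z| ≤ C * a * ‖x - z‖ := by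
  obtain ⟨C, hC, hd⟩ := Setup.exists_norm_dr_u_le
  refine ⟨2 * C, by positivity, fun h z a hz ha hU x hx => ?_⟩
  rw [mul_assoc 2 C]
  refine abs_sub_le_of_norm_dr_le h.diff_u (r := 1) (fun y hy => ?_) hx
  refine hd h y a (ball_norm_lt hz hy (by linarith [h.hL])) ha fun t ht => hU t ?_
  rw [mem_ball] at *
  linarith [dist_triangle t y z]

/-- The solution is small where the near charge lives. -/
lemma Setup.exists_abs_u_le_of_charge : ∃ C > 0, ∀ {K κ L δ θ : ℝ} {n : ℕ}
    {U u w ψ Pn Pf : ℂ → ℝ}, Setup K κ L δ θ n U u w ψ Pn Pf → ∀ z, ‖z‖ < 27 / 20 * L →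
      |u z| * Pn z ≤ C / n * Pn z := by
  obtain ⟨C, hC, hd⟩ := Setup.exists_abs_sub_le
  refine ⟨C + 1, by positivity, fun h z hz => ?_⟩
  rename_i K κ L δ θ n U u w ψ Pn Pf
  by_cases hP : Pn z = 0
  · simp [hP]
  refine mul_le_mul_of_nonneg_right ?_ (h.ch.nonneg_n z)
  obtain ⟨ζ, hζ, hζL, hζz⟩ := h.ch.near z hP
  have hn := h.n_pos
  have h1 : (1 : ℝ) / n ≤ 1 := by rw [div_le_one (by linarith)]; linarith
  have h2 := hd h z 1 hz zero_le_one (fun y _ => h.U_le y) ζ (by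
    rw [mem_ball, dist_eq_norm, norm_sub_rev]; linarith)
  have h3 := h.ap.close ζ (mem_ball_zero_iff.2 hζL)
  rw [hζ, sub_zero] at h3
  rw [norm_sub_rev, mul_one] at h2
  have h4 : C * ‖z - ζ‖ ≤ C * (1 / n) := by gcongr
  have h5 : (C + 1) / n = C * (1 / n) + 1 / n := by ring
  have h6 := abs_sub_abs_le_abs_sub (u z) (u ζ)
  rw [abs_sub_comm] at h6
  linarith [h.θ_le]

/-- The Beltrami-type residual of the gradient field near the zero set. -/
lemma Setup.exists_residual_le {K : ℝ} : ∃ C > 0, ∀ {κ L δ θ : ℝ} {n : ℕ}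
    {U u w ψ Pn Pf : ℂ → ℝ}, Setup K κ L δ θ n U u w ψ Pn Pf → ∀ z ζ, ‖z‖ < 27 / 20 * L →
      U ζ = 0 → ‖ζ‖ ≤ 7 / 5 * L → ‖z - ζ‖ < 3 → ∀ r > 0, r * ‖dr ψ z‖ ≤ 1 / n →
      ‖db (gradField u ψ) z - beta u ψ r z * gradField u ψ z‖ ≤ C / n * (Pn z + 1) := by
  obtain ⟨C, hC, hd⟩ := Setup.exists_abs_u_le_of_charge
  refine ⟨2 + |K| * C, by positivity, fun h z ζ hz hζ hζL hζz r hr hrψ => ?_⟩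
  rename_i κ L δ θ n U u w ψ Pn Pf
  have hn := h.n_pos
  have hL := h.hL
  have hPf : Pf z = 0 := by
    by_contra hne
    linarith [h.ch.far z hne ζ hζ hζL]
  refine (norm_db_gradField_sub_le h.ap.smooth h.smooth_ψ h.ψ_half hr z).trans ?_
  have h1 := h.res z (mem_ball_zero_iff.2 (by linarith))
  have h2 := h.ap.eq z (mem_ball_zero_iff.2 (by linarith))
  have h3 := hd h z hz
  have hφ := h.φ_pos z
  have hu1 := h.ap.le_one z
  rw [hPf, add_zero] at h1
  have hP := h.ch.nonneg_n z
  have e : (1 + ψ z) * lp u z - u z * lp ψ z = (1 + ψ z) * (lp u z + w z * u z) -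
    u z * (lp ψ z + w z * (1 + ψ z) - κ * Pn z * ψ z) - κ * ψ z * (u z * Pn z) := by ring
  have b1 : |(1 + ψ z) * (lp u z + w z * u z)| ≤ 3 / 2 * (1 / n) := by
    rw [abs_mul, abs_of_nonneg (by linarith : 0 ≤ 1 + ψ z)]
    exact mul_le_mul hφ.2 (h2.trans h.θ_le) (abs_nonneg _) (by norm_num)
  have b2 : |u z * (lp ψ z + w z * (1 + ψ z) - κ * Pn z * ψ z)| ≤ 1 * (1 / n) := by
    rw [abs_mul]
    exact mul_le_mul hu1 h1 (abs_nonneg _) zero_le_one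
  have b3 : |κ * ψ z * (u z * Pn z)| ≤ |K| * (1 / 2) * (C / n * Pn z) := by
    rw [abs_mul, abs_mul, abs_mul (u z), abs_of_nonneg hP, abs_of_nonneg h.κ_nonneg]
    exact mul_le_mul (mul_le_mul (h.κ_le.trans (le_abs_self K)) (h.ψ_half z) (abs_nonneg _)
      (abs_nonneg _)) h3 (by positivity) (by positivity)
  have b4 : |(1 + ψ z) * lp u z - u z * lp ψ z| ≤ 3 / 2 * (1 / n) + 1 * (1 / n) +
      |K| * (1 / 2) * (C / n * Pn z) := by
    rw [e]
    exact (abs_sub _ _).trans (add_le_add ((abs_sub _ _).trans (add_le_add b1 b2)) b3)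
  have e2 : (2 + |K| * C) / n * (Pn z + 1) = 2 * (1 / n) + 2 * (1 / n * Pn z) +
      |K| * (C / n * Pn z) + |K| * (C / n) := by ring
  have p1 : 0 ≤ 1 / (n : ℝ) * Pn z := by positivity
  have p2 : 0 ≤ |K| * (C / n * Pn z) := by positivity
  have p3 : 0 ≤ |K| * (C / n) := by positivity
  have p4 : 0 ≤ 1 / (n : ℝ) := by positivity
  rw [e2]
  linarith

lemma Setup.exists_enorm_dr_ψ_le {K : ℝ} : ∃ C > 0, ∀ {κ L δ θ : ℝ} {n : ℕ}
    {U u w ψ Pn Pf : ℂ → ℝ}, Setup K κ L δ θ n U u w ψ Pn Pf → ∀ z,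
      ‖dr ψ z‖ₑ ≤ ENNReal.ofReal (C * δ) * (1 + nk Pn z) := by
  obtain ⟨C, hC, hd⟩ := enorm_dr_le_nk
  refine ⟨C * (|K| + 1), by positivity, fun h z => ?_⟩
  rename_i κ L δ θ n U u w ψ Pn Pf
  have hK := h.hK
  have hδ := h.δ_pos
  refine (hd ψ Pn Pf (K * δ) h.smooth_ψ h.ch.smooth_n.continuous (by positivity) h.ch.nonneg_n
    h.ch.le_one_f h.ψ_le h.lp_ψ z).trans ?_
  have e : C * (K * δ) ≤ C * (|K| + 1) * δ := by
    rw [mul_assoc C]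
    have := le_abs_self K
    gcongr
    linarith
  exact mul_le_mul' (ENNReal.ofReal_le_ofReal e) le_rfl

lemma kb_one_le (x z : ℂ) : kb 1 (z - x) ≤ (ball z 1).indicator
    (fun x => ENNReal.ofReal (‖z - x‖ ^ (-1 : ℝ))) x := by
  by_cases hx : x ∈ ball z 1
  · rw [indicator_of_mem hx, kb_of_lt]
    rwa [mem_ball, dist_comm, dist_eq_norm] at hx
  · rw [kb_of_le]
    · exact zero_le
    · rw [mem_ball, dist_comm, dist_eq_norm, not_lt] at hx; exact hx

lemma nk_le_setLIntegral {P : ℂ → ℝ} (hP : ∀ z, 0 ≤ P z) (z : ℂ) :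
    nk P z ≤ ∫⁻ x in ball z 1, ENNReal.ofReal (P x * ‖z - x‖ ^ (-1 : ℝ)) := by
  rw [← lintegral_indicator measurableSet_ball]
  refine lintegral_mono fun x => ?_
  refine (mul_le_mul_right (kb_one_le x z) _).trans ?_
  by_cases hx : x ∈ ball z 1
  · rw [indicator_of_mem hx, indicator_of_mem hx, ENNReal.ofReal_mul (hP x)]
  · simp [hx]

/-- Pointwise bound for the gradient field in terms of the size of the solution nearby. -/
lemma Setup.exists_norm_gradField_le {K : ℝ} : ∃ C > 0, ∀ {κ L δ θ : ℝ} {n : ℕ}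
    {U u w ψ Pn Pf : ℂ → ℝ}, Setup K κ L δ θ n U u w ψ Pn Pf → ∀ z a, ‖z‖ < 5 / 4 * L → 0 ≤ a →
      (∀ y ∈ ball z 2, |U y| ≤ a) → ‖gradField u ψ z‖ ≤ C * (a + 1 / √n) := by
  obtain ⟨C1, hC1, hd1⟩ := Setup.exists_norm_dr_u_le
  obtain ⟨C2, hC2, hd2⟩ := Setup.exists_abs_sub_le
  obtain ⟨C3, hC3, hd3⟩ := Setup.exists_abs_u_le_of_charge
  obtain ⟨C4, hC4, hd4⟩ := Setup.exists_enorm_dr_ψ_le (K := K)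
  have hCP : (0 : ℝ) < CP := by norm_num [CP]
  refine ⟨2 * C1 + C4 * (1 + C3 * CP + C2 * CP), by positivity, fun h z a hz ha hU => ?_⟩
  rename_i κ L δ θ n U u w ψ Pn Pf
  have hn := h.n_pos
  have hL := h.hL
  have hU1 : ∀ y ∈ ball z 1, |U y| ≤ a := fun y hy => hU y (ball_subset_ball (by norm_num) hy)
  have hu := h.abs_u_le (by linarith) hU1
  have g1 := hd1 h z a (by linarith) ha hU1
  have g2 : ENNReal.ofReal |u z| * nk Pn z ≤ ENNReal.ofReal (C3 * CP * (1 / √n) + C2 * a * CP) := by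
    have s1 : ENNReal.ofReal |u z| * nk Pn z ≤ ∫⁻ x in ball z 1,
        (ENNReal.ofReal (C3 / n) * ENNReal.ofReal (Pn x * ‖z - x‖ ^ (-1 : ℝ)) +
          ENNReal.ofReal (C2 * a) * ENNReal.ofReal (Pn x * ‖z - x‖ ^ (-(1/2) : ℝ))) := by
      refine (mul_le_mul_right (nk_le_setLIntegral h.ch.nonneg_n z) _).trans ?_
      rw [← lintegral_const_mul' _ _ ENNReal.ofReal_ne_top]
      refine setLIntegral_mono' measurableSet_ball fun x hx => ?_
      have hP := h.ch.nonneg_n x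
      rw [← ENNReal.ofReal_mul (abs_nonneg _), ← ENNReal.ofReal_mul (by positivity),
        ← ENNReal.ofReal_mul (by positivity), ← ENNReal.ofReal_add (by positivity) (by positivity)]
      refine ENNReal.ofReal_le_ofReal ?_
      rcases eq_or_ne z x with rfl | hne
      · rw [sub_self, norm_zero, Real.zero_rpow (by norm_num), Real.zero_rpow (by norm_num)]; simp
      have hd : 0 < ‖z - x‖ := norm_pos_iff.2 (sub_ne_zero.2 hne)
      have hd1 : ‖z - x‖ < 1 := by rwa [mem_ball, dist_comm, dist_eq_norm] at hx
      have t1 := hd2 h z a (by linarith) ha hU x hx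
      have t2 := hd3 h x (ball_norm_lt hz hx (by linarith))
      have t3 : |u z| ≤ |u x| + C2 * a * ‖z - x‖ := by
        have := abs_sub_abs_le_abs_sub (u z) (u x)
        rw [abs_sub_comm] at this
        rw [norm_sub_rev] at t1
        linarith
      have t4 : 1 ≤ ‖z - x‖ ^ (-(1/2) : ℝ) :=
        Real.one_le_rpow_of_pos_of_le_one_of_nonpos hd hd1.le (by norm_num)
      calc |u z| * (Pn x * ‖z - x‖ ^ (-1 : ℝ))
          ≤ (|u x| + C2 * a * ‖z - x‖) * (Pn x * ‖z - x‖ ^ (-1 : ℝ)) := by gcongr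
        _ = (|u x| * Pn x) * ‖z - x‖ ^ (-1 : ℝ) + C2 * a * (Pn x * 1) := by
            rw [Real.rpow_neg_one]
            linear_combination (C2 * a * Pn x) * mul_inv_cancel₀ hd.ne'
        _ ≤ (C3 / n * Pn x) * ‖z - x‖ ^ (-1 : ℝ) + C2 * a * (Pn x * ‖z - x‖ ^ (-(1/2) : ℝ)) := by
            gcongr
        _ = _ := by ring
    refine s1.trans ?_
    have hPm : Measurable Pn := h.ch.smooth_n.continuous.measurable
    rw [lintegral_add_left (by fun_prop), lintegral_const_mul' _ _ ENNReal.ofReal_ne_top,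
      lintegral_const_mul' _ _ ENNReal.ofReal_ne_top]
    have s2 := (lintegral_mono_set (ball_subset_ball (by norm_num : (1:ℝ) ≤ 20))).trans (h.ch.one z)
    have s3 := (lintegral_mono_set (ball_subset_ball (by norm_num : (1:ℝ) ≤ 20))).trans (h.ch.half z)
    refine (add_le_add (mul_le_mul_right s2 _) (mul_le_mul_right s3 _)).trans ?_
    rw [← ENNReal.ofReal_mul (by positivity), ← ENNReal.ofReal_mul (by positivity),
      ← ENNReal.ofReal_add (by positivity) (by positivity)]
    refine ENNReal.ofReal_le_ofReal (le_of_eq ?_)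
    have hs : √(n : ℝ) * √n = n := Real.mul_self_sqrt (by linarith)
    have hs0 : 0 < √(n : ℝ) := Real.sqrt_pos.2 (by linarith)
    have : C3 / n * (CP * √n) = C3 * CP * (1 / √n) := by
      have e : C3 / n * (CP * √n) = C3 / (√(n : ℝ) * √n) * (CP * √n) := by rw [hs]
      rw [e]
      field_simp
    rw [this]
  have hs0 : 0 < √(n : ℝ) := Real.sqrt_pos.2 (by linarith)
  have hδ := h.δ_pos
  have g3 : |u z| * ‖dr ψ z‖ ≤ C4 * (a + (C3 * CP * (1 / √n) + C2 * a * CP)) := by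
    have s1 : ENNReal.ofReal (|u z| * ‖dr ψ z‖) ≤
        ENNReal.ofReal (C4 * δ) * (ENNReal.ofReal |u z| + ENNReal.ofReal |u z| * nk Pn z) := by
      rw [ENNReal.ofReal_mul (abs_nonneg _), ofReal_norm_eq_enorm]
      refine (mul_le_mul_right (hd4 h z) _).trans (le_of_eq (by ring))
    have s2 : ENNReal.ofReal (|u z| * ‖dr ψ z‖) ≤
        ENNReal.ofReal (C4 * δ * (a + (C3 * CP * (1 / √n) + C2 * a * CP))) := by
      refine s1.trans ?_
      rw [ENNReal.ofReal_mul (p := C4 * δ) (by positivity), ENNReal.ofReal_add ha (by positivity)]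
      gcongr
    rw [ENNReal.ofReal_le_ofReal_iff (by positivity)] at s2
    refine s2.trans ?_
    have : C4 * δ ≤ C4 := mul_le_of_le_one_right hC4.le h.δ_le
    gcongr
  have hφ := h.φ_pos z
  have g4 : ‖gradField u ψ z‖ ≤ 3 / 2 * (C1 * a) + |u z| * ‖dr ψ z‖ := by
    rw [gradField]
    refine (norm_sub_le _ _).trans ?_
    rw [norm_mul, norm_mul, Complex.norm_real, Complex.norm_real, Real.norm_of_nonneg (by linarith),
      Real.norm_eq_abs]
    gcongr
    exact hφ.2
  set q := 1 / √(n : ℝ) with hq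
  have hq0 : 0 ≤ q := by positivity
  have e : (2 * C1 + C4 * (1 + C3 * CP + C2 * CP)) * (a + q) = 2 * (C1 * a) + 2 * (C1 * q) +
    C4 * (a + (C3 * CP * q + C2 * a * CP)) + C4 * q + C4 * C3 * CP * a + C4 * C2 * CP * q := by ring
  rw [e]
  have p1 : 0 ≤ C1 * a := by positivity
  have p2 : 0 ≤ C1 * q := by positivity
  have p3 : 0 ≤ C4 * q := by positivity
  have p4 : 0 ≤ C4 * C3 * CP * a := by positivity
  have p5 : 0 ≤ C4 * C2 * CP * q := by positivity
  linarith

lemma dr_neg {u : ℂ → ℝ} (hu : Differentiable ℝ u) (z : ℂ) : dr (fun z => -u z) z = -dr u z := by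
  have h1 : Differentiable ℝ (fun z => -u z) := hu.neg
  rw [dr_eq (h1 z), dr_eq (hu z), fderiv_fun_neg]
  simp only [ContinuousLinearMap.neg_apply, Complex.ofReal_neg]
  ring

/-- Away from the zero set the gradient field is controlled by the quotient itself. -/
lemma Setup.exists_far {K : ℝ} : ∃ C > 0, ∃ δ₁ > 0, ∀ {κ L δ θ : ℝ} {n : ℕ}
    {U u w ψ Pn Pf : ℂ → ℝ}, Setup K κ L δ θ n U u w ψ Pn Pf → δ ≤ δ₁ → ∀ z, ‖z‖ ≤ 11 / 10 * L →
      (∀ ζ, U ζ = 0 → ‖ζ‖ ≤ 7 / 5 * L → 5 / 2 ≤ ‖z - ζ‖) →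
        ‖gradField u ψ z‖ ≤ C * |u z / (1 + ψ z)| := by
  obtain ⟨C1, hC1, δ₁, hδ₁, hd1⟩ := norm_dr_le_of_pos
  obtain ⟨C2, hC2, hd2⟩ := Setup.exists_enorm_dr_ψ_le (K := K)
  refine ⟨3 / 2 * (3 / 2 * C1 + C2), by positivity, δ₁, hδ₁, fun h hδ z hz hfar => ?_⟩
  rename_i κ L δ θ n U u w ψ Pn Pf
  have hL := h.hL
  have hn := h.n_pos
  have hθ := h.θ_quarter
  have hne : ∀ y ∈ ball z 2, U y ≠ 0 := by
    intro y hy h0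
    have h1 := ball_norm_lt (t := 7 / 5 * L) (s := 11 / 10 * L + 1) (by linarith) hy (by linarith)
    have h2 := hfar y h0 h1.le
    rw [mem_ball, dist_comm, dist_eq_norm] at hy
    linarith
  have hcont : ContinuousOn U (ball z 2) := h.cont.mono fun y hy => mem_ball_zero_iff.2
    (ball_norm_lt (s := 11 / 10 * L + 1) (by linarith) hy (by linarith))
  have hivt : ∀ a ∈ ball z 2, ∀ b ∈ ball z 2, U a < 0 → ¬ 0 < U b := by
    intro a ha b hb h1 h2
    obtain ⟨c, hc, hc0⟩ := (convex_ball z 2).isPreconnected.intermediate_value ha hb hcont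
      (show (0 : ℝ) ∈ Icc (U a) (U b) from ⟨h1.le, h2.le⟩)
    exact hne c hc hc0
  have hz2 : z ∈ ball z 2 := mem_ball_self (by norm_num)
  have hsub : ∀ y ∈ closedBall z 1, ball y θ ⊆ ball z 2 := by
    intro y hy t ht
    rw [mem_closedBall] at hy
    rw [mem_ball] at *
    linarith [dist_triangle t y z]
  have hyL : ∀ y ∈ closedBall z 1, y ∈ ball (0 : ℂ) (29 / 20 * L) := by
    intro y hy
    exact mem_ball_zero_iff.2 (ball_norm_lt (s := 11 / 10 * L + 1) (r := 2) (z := z) (by linarith)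
      (closedBall_subset_ball (by norm_num) hy) (by linarith))
  have hu : ‖dr u z‖ ≤ C1 * |u z| := by
    rcases lt_or_gt_of_ne (hne z hz2) with hneg | hpos
    · have hs : ∀ y ∈ closedBall z 1, u y < 0 ∧ |lp u y| ≤ δ * (-u y) := fun y hy =>
        h.ap.neg y (hyL y hy) fun t ht => lt_of_le_of_ne
          (not_lt.1 (hivt z hz2 t (hsub y hy ht) hneg)) (hne t (hsub y hy ht))
      have := hd1 (fun z => -u z) z h.ap.smooth.neg (fun y hy => by linarith [(hs y hy).1])
        (fun y hy => by
          have e : lp (fun z => -u z) y = -lp u y := lp_neg h.ap.smooth y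
          rw [e, abs_neg]
          exact (hs y hy).2.trans (mul_le_mul_of_nonneg_right hδ (by linarith [(hs y hy).1])))
      rw [dr_neg h.diff_u, norm_neg] at this
      rwa [abs_of_neg (hs z (mem_closedBall_self zero_le_one)).1]
    · have hs : ∀ y ∈ closedBall z 1, 0 < u y ∧ |lp u y| ≤ δ * u y := fun y hy =>
        h.ap.pos y (hyL y hy) fun t ht => lt_of_le_of_ne
          (not_lt.1 fun hlt => hivt t (hsub y hy ht) z hz2 hlt hpos) (hne t (hsub y hy ht)).symm
      have := hd1 u z h.ap.smooth (fun y hy => (hs y hy).1)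
        (fun y hy => (hs y hy).2.trans (mul_le_mul_of_nonneg_right hδ (hs y hy).1.le))
      rwa [abs_of_pos (hs z (mem_closedBall_self zero_le_one)).1]
  have hnk : nk Pn z = 0 := by
    rw [nk]
    refine (lintegral_congr fun x => ?_).trans lintegral_zero
    rcases le_or_gt 1 ‖z - x‖ with hx | hx
    · rw [kb_of_le hx, mul_zero]
    have : Pn x = 0 := by
      by_contra hP
      obtain ⟨ζ, hζ, -, hζx⟩ := h.ch.near x hP
      have h1 : (1 : ℝ) / n ≤ 1 / 4 := one_div_le_one_div_of_le (by norm_num) hn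
      have h2 : ‖z - ζ‖ < 2 := by
        have := norm_add_le (z - x) (x - ζ)
        rw [sub_add_sub_cancel] at this
        linarith
      exact hne ζ (by rwa [mem_ball, dist_comm, dist_eq_norm]) hζ
    simp [this]
  have hψ : ‖dr ψ z‖ ≤ C2 := by
    have := hd2 h z
    rw [hnk, add_zero, mul_one, ← ofReal_norm_eq_enorm,
      ENNReal.ofReal_le_ofReal_iff (mul_nonneg hC2.le h.δ_pos.le)] at this
    exact this.trans (mul_le_of_le_one_right hC2.le h.δ_le)
  have hφ := h.φ_pos z
  have e1 : |u z| ≤ 3 / 2 * |u z / (1 + ψ z)| := by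
    rw [abs_div, abs_of_pos (by linarith : 0 < 1 + ψ z), mul_div_assoc', le_div_iff₀ (by linarith),
      mul_comm]
    exact mul_le_mul_of_nonneg_right hφ.2 (abs_nonneg _)
  rw [gradField]
  refine (norm_sub_le _ _).trans ?_
  rw [norm_mul, norm_mul, Complex.norm_real, Complex.norm_real, Real.norm_of_nonneg (by linarith),
    Real.norm_eq_abs]
  calc (1 + ψ z) * ‖dr u z‖ + |u z| * ‖dr ψ z‖ ≤ 3 / 2 * (C1 * |u z|) + |u z| * C2 := by
        gcongr; exact hφ.2
    _ = (3 / 2 * C1 + C2) * |u z| := by ring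
    _ ≤ (3 / 2 * C1 + C2) * (3 / 2 * |u z / (1 + ψ z)|) := by gcongr
    _ = _ := by ring

/-- Local potential bound for the coefficient `beta`. -/
lemma Setup.exists_lintegral_beta_le {K : ℝ} : ∃ C > 0, ∀ {κ L δ θ : ℝ} {n : ℕ}
    {U u w ψ Pn Pf : ℂ → ℝ}, Setup K κ L δ θ n U u w ψ Pn Pf → ∀ (r : ℝ) (χ : ℂ → ℝ), 0 < r →
      (∀ z, 0 ≤ χ z) → (∀ z, χ z ≤ 1) → ∀ v : ℂ,
      ∫⁻ z in ball v 3, ‖(χ z : ℂ) * beta u ψ r z‖ₑ * ENNReal.ofReal (‖v - z‖ ^ (-1 : ℝ)) ≤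
        ENNReal.ofReal (C * δ) := by
  obtain ⟨C, hC, hd⟩ := Setup.exists_enorm_dr_ψ_le (K := K)
  have hCP : (0 : ℝ) < CP := by norm_num [CP]
  refine ⟨4 * C * (6 * Real.pi + 100 * CP), by positivity, fun h r χ hr hχ0 hχ1 v => ?_⟩
  rename_i κ L δ θ n U u w ψ Pn Pf
  have hδ := h.δ_pos
  have h1 : ∀ z, ‖(χ z : ℂ) * beta u ψ r z‖ₑ ≤ ENNReal.ofReal (4 * (C * δ)) * (1 + nk Pn z) := by
    intro z
    have e1 : ‖(χ z : ℂ) * beta u ψ r z‖ ≤ 4 * ‖dr ψ z‖ := by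
      rw [norm_mul, Complex.norm_real, Real.norm_of_nonneg (hχ0 z)]
      exact (mul_le_of_le_one_left (norm_nonneg _) (hχ1 z)).trans (norm_beta_le h.ψ_half hr z)
    rw [← ofReal_norm_eq_enorm]
    refine (ENNReal.ofReal_le_ofReal e1).trans ?_
    rw [ENNReal.ofReal_mul (by norm_num), ofReal_norm_eq_enorm, ENNReal.ofReal_mul (p := 4)
      (by norm_num), mul_assoc]
    exact mul_le_mul_right (hd h z) _
  calc ∫⁻ z in ball v 3, ‖(χ z : ℂ) * beta u ψ r z‖ₑ * ENNReal.ofReal (‖v - z‖ ^ (-1 : ℝ))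
      ≤ ∫⁻ z in ball v 3, ENNReal.ofReal (4 * (C * δ)) * (ENNReal.ofReal (‖v - z‖ ^ (-1 : ℝ)) +
          nk Pn z * ENNReal.ofReal (‖v - z‖ ^ (-1 : ℝ))) := by
        refine lintegral_mono fun z => (mul_le_mul_left (h1 z) _).trans (le_of_eq ?_)
        ring
    _ = ENNReal.ofReal (4 * (C * δ)) * ((∫⁻ z in ball v 3, ENNReal.ofReal (‖v - z‖ ^ (-1 : ℝ))) +
          ∫⁻ z in ball v 3, nk Pn z * ENNReal.ofReal (‖v - z‖ ^ (-1 : ℝ))) := by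
        rw [lintegral_const_mul' _ _ ENNReal.ofReal_ne_top, lintegral_add_left (by fun_prop)]
    _ ≤ ENNReal.ofReal (4 * (C * δ)) * (ENNReal.ofReal (6 * Real.pi) +
          ENNReal.ofReal (100 * CP)) := by
        refine mul_le_mul_right (add_le_add (le_of_eq ?_) (h.ch.lintegral_nk_le v)) _
        rw [lintegral_ball_norm_sub_rpow (by norm_num) (by norm_num)]
        congr 1
        norm_num
        ring
    _ = _ := by
        rw [← ENNReal.ofReal_add (by positivity) (by positivity), ← ENNReal.ofReal_mul (by positivity)]
        congr 1
        ring

/-- Bound for the Cauchy transform of a residual dominated by the near charge. -/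
lemma exists_norm_cauchyT_le : ∃ C > 0, ∀ (L : ℝ) (U : ℂ → ℝ) (n : ℕ) (Pn Pf : ℂ → ℝ) (B : ℝ)
    (G : ℂ → ℂ), Charge L U n Pn Pf → 1 ≤ L → 1 ≤ n → 0 ≤ B →
    (∀ z, 13 / 10 * L ≤ ‖z‖ → G z = 0) → (∀ z, ‖G z‖ ≤ B / n * (Pn z + 1)) →
    ∀ v, ‖v‖ ≤ 11 / 10 * L → ‖cauchyT G v‖ ≤ C * (B * L ^ 2 / √n) := by
  have hCP : (0 : ℝ) < CP := by norm_num [CP]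
  refine ⟨CP + 100 + 24 / 5 * Real.pi, by positivity, ?_⟩
  intro L U n Pn Pf B G h hL hn hB hG0 hG v hv
  have hn1 : (1 : ℝ) ≤ n := by exact_mod_cast hn
  have hP := h.nonneg_n
  have hPm : Measurable Pn := h.smooth_n.continuous.measurable
  have hPint : Integrable Pn := h.smooth_n.continuous.integrable_of_hasCompactSupport h.cpt_n
  have s1 : ∫⁻ z, ENNReal.ofReal (Pn z * ‖v - z‖ ^ (-1 : ℝ)) ≤
      ENNReal.ofReal (CP * √n) + ENNReal.ofReal (100 * L ^ 2) := by
    calc ∫⁻ z, ENNReal.ofReal (Pn z * ‖v - z‖ ^ (-1 : ℝ))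
        ≤ ∫⁻ z, ((ball v 20).indicator (fun z => ENNReal.ofReal (Pn z * ‖v - z‖ ^ (-1 : ℝ))) z +
            ENNReal.ofReal (Pn z)) := by
          refine lintegral_mono fun z => ?_
          by_cases hz : z ∈ ball v 20
          · rw [indicator_of_mem hz]; exact le_self_add
          · rw [indicator_of_notMem hz, zero_add]
            rw [mem_ball, dist_comm, dist_eq_norm, not_lt] at hz
            refine ENNReal.ofReal_le_ofReal (mul_le_of_le_one_right (hP z) ?_)
            exact Real.rpow_le_one_of_one_le_of_nonpos (by linarith) (by norm_num)
      _ = (∫⁻ z in ball v 20, ENNReal.ofReal (Pn z * ‖v - z‖ ^ (-1 : ℝ))) +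
            ENNReal.ofReal (∫ z, Pn z) := by
          rw [lintegral_add_right _ (by fun_prop), lintegral_indicator measurableSet_ball,
            ofReal_integral_eq_lintegral_ofReal hPint (ae_of_all _ hP)]
      _ ≤ _ := add_le_add (h.one v) (ENNReal.ofReal_le_ofReal h.mass)
  have s2 : ‖∫ z, (v - z)⁻¹ * G z‖ₑ ≤ ENNReal.ofReal (B / n) * ((ENNReal.ofReal (CP * √n) +
      ENNReal.ofReal (100 * L ^ 2)) + ENNReal.ofReal (24 / 5 * Real.pi * L)) := by
    calc ‖∫ z, (v - z)⁻¹ * G z‖ₑ ≤ ∫⁻ z, ‖(v - z)⁻¹ * G z‖ₑ := enorm_integral_le_lintegral_enorm _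
      _ ≤ ∫⁻ z, ENNReal.ofReal (B / n) * (ENNReal.ofReal (Pn z * ‖v - z‖ ^ (-1 : ℝ)) +
            (ball v (12 / 5 * L)).indicator (fun z => ENNReal.ofReal (‖v - z‖ ^ (-1 : ℝ))) z) := by
          refine lintegral_mono fun z => ?_
          by_cases hz : z ∈ ball v (12 / 5 * L)
          · rw [indicator_of_mem hz, ← ENNReal.ofReal_add (mul_nonneg (hP z) (by positivity))
              (by positivity), ← ENNReal.ofReal_mul (by positivity), ← ofReal_norm_eq_enorm]
            refine ENNReal.ofReal_le_ofReal ?_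
            rw [norm_mul, norm_inv, Real.rpow_neg_one]
            calc ‖v - z‖⁻¹ * ‖G z‖ ≤ ‖v - z‖⁻¹ * (B / n * (Pn z + 1)) := by gcongr; exact hG z
              _ = _ := by ring
          · have : G z = 0 := by
              refine hG0 z ?_
              rw [mem_ball, dist_eq_norm, not_lt] at hz
              linarith [norm_sub_le z v]
            simp [this]
      _ ≤ _ := by
          rw [lintegral_const_mul' _ _ ENNReal.ofReal_ne_top, lintegral_add_left (by fun_prop),
            lintegral_indicator measurableSet_ball,
            lintegral_ball_norm_sub_rpow (by norm_num) (by positivity)]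
          refine mul_le_mul_right (add_le_add s1 (le_of_eq ?_)) _
          congr 1
          norm_num
          ring
  have hs : √(n : ℝ) * √n = n := Real.mul_self_sqrt (by linarith)
  have hs1 : 1 ≤ √(n : ℝ) := Real.one_le_sqrt.2 hn1
  rw [← ENNReal.ofReal_add (by positivity) (by positivity), ← ENNReal.ofReal_add (by positivity)
    (by positivity), ← ENNReal.ofReal_mul (by positivity), ← ofReal_norm_eq_enorm,
    ENNReal.ofReal_le_ofReal_iff (by positivity)] at s2
  rw [cauchyT_eq, norm_mul]
  have s3 : ‖((Real.pi : ℂ))⁻¹‖ ≤ 1 := by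
    rw [norm_inv, Complex.norm_real, Real.norm_of_nonneg Real.pi_pos.le]
    exact inv_le_one_of_one_le₀ (by linarith [Real.pi_gt_three])
  calc _ ≤ 1 * ‖∫ z, (v - z)⁻¹ * G z‖ := by gcongr
    _ ≤ B / n * (CP * √n + 100 * L ^ 2 + 24 / 5 * Real.pi * L) := by rw [one_mul]; exact s2
    _ ≤ B / n * (CP * (√n * L ^ 2) + 100 * (√n * L ^ 2) + 24 / 5 * Real.pi * (√n * L ^ 2)) := by
        have e1 : 1 ≤ L ^ 2 := one_le_pow₀ hL
        have e2 : √(n : ℝ) ≤ √n * L ^ 2 := le_mul_of_one_le_right (by positivity) e1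
        have e3 : L ^ 2 ≤ √n * L ^ 2 := le_mul_of_one_le_left (by positivity) hs1
        have e4 : L ≤ √n * L ^ 2 := le_trans (by nlinarith) e3
        gcongr
    _ = B / (√(n : ℝ) * √n) * (CP * (√n * L ^ 2) + 100 * (√n * L ^ 2) +
          24 / 5 * Real.pi * (√n * L ^ 2)) := by rw [hs]
    _ = _ := by field_simp

set_option maxHeartbeats 1000000 in
/-- The growth data produced by an approximate solution. -/
lemma Setup.exists_cfg (K : ℝ) : ∃ C ≥ 1, ∃ δ₀ > 0, ∀ {κ L δ θ : ℝ} {n : ℕ}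
    {U u w ψ Pn Pf : ℂ → ℝ}, Setup K κ L δ θ n U u w ψ Pn Pf → δ * (1 + Real.log L) ≤ δ₀ →
      ∀ m, (∀ y ∈ closedBall (0 : ℂ) 6, |U y| ≤ m) → ∃ F om T O,
        Cfg C L (C * Real.exp (C * L) * L ^ 2 / √n) m (fun z => u z / (1 + ψ z)) F om T O := by
  obtain ⟨Cf, hCf, δ₁, hδ₁, hfar⟩ := Setup.exists_far (K := K)
  obtain ⟨Cb, hCb, hbeta⟩ := Setup.exists_lintegral_beta_le (K := K)
  obtain ⟨Ct, hCt, hT⟩ := exists_norm_cauchyT_le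
  obtain ⟨Cr, hCr, hres⟩ := Setup.exists_residual_le (K := K)
  obtain ⟨Cg, hCg, hgrad⟩ := Setup.exists_norm_gradField_le (K := K)
  obtain ⟨Co, hCo, hosc⟩ := cauchyT_osc
  set D : ℝ := Co * Cb * δ₁ with hD
  have hD0 : 0 < D := by positivity
  set C : ℝ := 1 + 3 * D + Ct * Cr + Cf + 2 * Cg with hC
  have hC1 : 1 ≤ C := by
    have : 0 < Ct * Cr := by positivity
    linarith
  have hCD : 3 * D ≤ C := by
    have : 0 < Ct * Cr := by positivity
    linarith
  have hCtr : Ct * Cr ≤ C := by linarith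
  have hCfC : Cf ≤ C := by
    have : 0 < Ct * Cr := by positivity
    linarith
  have hCgC : 2 * Cg ≤ C := by
    have : 0 < Ct * Cr := by positivity
    linarith
  refine ⟨C, hC1, δ₁, hδ₁, fun h hδ m hm => ?_⟩
  rename_i κ L δ θ n U u w ψ Pn Pf
  have hL := h.hL
  have hL1 : 1 ≤ L := by linarith
  have hn := h.n_pos
  have hδ0 := h.δ_pos
  have hlog : 0 ≤ Real.log L := Real.log_nonneg hL1
  have hm0 : 0 ≤ m := (abs_nonneg _).trans (hm 0 (by simp))
  have hδδ : δ ≤ δ₁ := (le_mul_of_one_le_right hδ0.le (by linarith)).trans hδ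
  have hs1 : 1 ≤ √(n : ℝ) := Real.one_le_sqrt.2 (by linarith)
  set F := gradField u ψ with hF
  have hFs : ContDiff ℝ ∞ F := contDiff_gradField h.ap.smooth h.smooth_ψ
  obtain ⟨χ, hχs, hχ0, hχ1, hχA, hχB⟩ := exists_smooth_cutoff
    (A := (ball (0 : ℂ) (13 / 10 * L))ᶜ) (B := closedBall (0 : ℂ) (6 / 5 * L))
    isOpen_ball.isClosed_compl isClosed_closedBall
    (disjoint_compl_left_iff_subset.2 (closedBall_subset_ball (by linarith)))
  set Z : Set ℂ := {ζ | U ζ = 0 ∧ ‖ζ‖ ≤ 7 / 5 * L} with hZ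
  obtain ⟨p, hps, hp0, hp1, hpA, hpB⟩ := exists_smooth_cutoff
    (A := (thickening (29 / 10) Z)ᶜ) (B := cthickening (5 / 2) Z)
    isOpen_thickening.isClosed_compl isClosed_cthickening
    (disjoint_compl_left_iff_subset.2 (cthickening_subset_thickening' (by norm_num) (by norm_num) Z))
  obtain ⟨Dψ, hDψ⟩ := (isCompact_closedBall (0 : ℂ) (13 / 10 * L)).exists_bound_of_continuousOn
    (contDiff_dr h.smooth_ψ).continuous.continuousOn
  set r : ℝ := 1 / (n * (|Dψ| + 1)) with hr
  have hr0 : 0 < r := by positivity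
  have hrψ : ∀ z, ‖z‖ ≤ 13 / 10 * L → r * ‖dr ψ z‖ ≤ 1 / n := by
    intro z hz
    have h1 := (hDψ z (by simpa using hz)).trans (le_abs_self Dψ)
    rw [hr, div_mul_eq_mul_div, div_le_div_iff₀ (by positivity) (by positivity)]
    have : (n : ℝ) * ‖dr ψ z‖ ≤ n * (|Dψ| + 1) := by gcongr; linarith
    linarith
  set b : ℂ → ℂ := fun z => (χ z : ℂ) * beta u ψ r z with hb
  have hbs : ContDiff ℝ ∞ b :=
    (contDiff_ofReal hχs).mul (contDiff_beta h.ap.smooth h.smooth_ψ h.ψ_half hr0)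
  have hχout : ∀ z, 13 / 10 * L ≤ ‖z‖ → χ z = 0 := fun z hz => hχA z (by
    rw [mem_compl_iff, mem_ball_zero_iff, not_lt]; exact hz)
  have hcpt : ∀ g : ℂ → ℂ, (∀ z, 13 / 10 * L ≤ ‖z‖ → g z = 0) → HasCompactSupport g := by
    intro g hg
    refine HasCompactSupport.intro (isCompact_closedBall (0 : ℂ) (13 / 10 * L)) fun z hz => ?_
    rw [mem_closedBall_zero_iff, not_le] at hz
    exact hg z hz.le
  have hb0 : ∀ z, 13 / 10 * L ≤ ‖z‖ → b z = 0 := fun z hz => by simp [hb, hχout z hz]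
  have hbc := hcpt b hb0
  have hosc1 := hosc L (Cb * δ) b (by linarith) (by positivity) hbs.continuous hbc
    (fun z hz => hb0 z (by linarith)) (hbeta h r χ hr0 hχ0 hχ1)
  have hosc2 : ∀ v v', ‖v‖ ≤ 2 * L → ‖v'‖ ≤ 2 * L →
      ‖cauchyT b v - cauchyT b v'‖ ≤ D * (1 + ‖v - v'‖) := by
    intro v v' hv hv'
    refine norm_sub_le_of_osc hD0.le (R := 2 * L) (fun x x' hx hx' => ?_) v v' hv hv'
    refine (hosc1 x x' hx hx').trans ?_
    calc Co * (Cb * δ) * (1 + Real.log L) = Co * Cb * (δ * (1 + Real.log L)) := by ring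
      _ ≤ Co * Cb * δ₁ := by gcongr
  set om : ℂ → ℂ := fun z => cauchyT b z - cauchyT b 0 with hom
  have homs : ContDiff ℝ ∞ om := (contDiff_cauchyT hbs hbc).sub contDiff_const
  have hom_le : ∀ z, ‖z‖ ≤ 2 * L → ‖om z‖ ≤ 3 * D * L := by
    intro z hz
    have := hosc2 z 0 hz (by rw [norm_zero]; linarith)
    rw [sub_zero] at this
    refine this.trans ?_
    have h1 : D * (1 + ‖z‖) ≤ D * (3 * L) := by gcongr; linarith
    linarith
  have hdiff : ∀ {g : ℂ → ℂ}, ContDiff ℝ ∞ g → Differentiable ℝ g := fun hg =>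
    hg.differentiable (by simp)
  have hdb_om : ∀ z, db om z = b z := by
    intro z
    have e : db om z = _ := db_sub (f := cauchyT b) (g := fun _ => cauchyT b 0) (z := z)
      (hdiff (contDiff_cauchyT hbs hbc) z) (differentiableAt_const _)
    rw [e, db_cauchyT hbs hbc]
    simp [db]
  have hexp : ContDiff ℝ ∞ fun z => cexp (-om z) := homs.neg.cexp
  set G : ℂ → ℂ := fun z => ((p z : ℂ) * (χ z : ℂ)) *
    (cexp (-om z) * (db F z - beta u ψ r z * F z)) with hG
  have hGs : ContDiff ℝ ∞ G := ((contDiff_ofReal hps).mul (contDiff_ofReal hχs)).mul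
    (hexp.mul ((contDiff_db hFs).sub
      ((contDiff_beta h.ap.smooth h.smooth_ψ h.ψ_half hr0).mul hFs)))
  have hG0 : ∀ z, 13 / 10 * L ≤ ‖z‖ → G z = 0 := fun z hz => by simp [hG, hχout z hz]
  have hGc := hcpt G hG0
  have hGle : ∀ z, ‖G z‖ ≤ Real.exp (3 * D * L) * Cr / n * (Pn z + 1) := by
    intro z
    have hP := h.ch.nonneg_n z
    have hpos : 0 ≤ Real.exp (3 * D * L) * Cr / n * (Pn z + 1) := by positivity
    by_cases hz : 13 / 10 * L ≤ ‖z‖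
    · rw [hG0 z hz, norm_zero]; exact hpos
    push Not at hz
    by_cases hzt : z ∈ thickening (29 / 10) Z
    · obtain ⟨ζ, ⟨hζ, hζL⟩, hζz⟩ := mem_thickening_iff.1 hzt
      rw [dist_eq_norm] at hζz
      have h1 := hres h z ζ (by linarith) hζ hζL (by linarith) r hr0 (hrψ z hz.le)
      have h2 : ‖(p z : ℂ) * (χ z : ℂ)‖ ≤ 1 := by
        rw [norm_mul, Complex.norm_real, Complex.norm_real, Real.norm_of_nonneg (hp0 z),
          Real.norm_of_nonneg (hχ0 z)]
        exact mul_le_one₀ (hp1 z) (hχ0 z) (hχ1 z)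
      have h3 : ‖cexp (-om z)‖ ≤ Real.exp (3 * D * L) := by
        rw [Complex.norm_exp]
        refine Real.exp_le_exp.2 ((Complex.re_le_norm _).trans ?_)
        rw [norm_neg]
        exact hom_le z (by linarith)
      calc ‖G z‖ = ‖(p z : ℂ) * (χ z : ℂ)‖ *
            (‖cexp (-om z)‖ * ‖db F z - beta u ψ r z * F z‖) := by rw [hG, norm_mul, norm_mul (cexp _)]
        _ ≤ 1 * (Real.exp (3 * D * L) * (Cr / n * (Pn z + 1))) := by gcongr
        _ = _ := by ring
    · have : p z = 0 := hpA z hzt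
      simp only [hG, this]
      simpa using hpos
  have hT1 := hT L U n Pn Pf (Real.exp (3 * D * L) * Cr) G h.ch hL1 (by linarith [h.hn])
    (by positivity) hG0 hGle
  set ν : ℝ := C * Real.exp (C * L) * L ^ 2 / √n with hν
  have hν1 : 1 / √(n : ℝ) ≤ ν := by
    rw [hν]
    gcongr
    have e1 : 1 ≤ Real.exp (C * L) := Real.one_le_exp (by positivity)
    have e2 : 1 ≤ L ^ 2 := one_le_pow₀ hL1
    exact one_le_mul_of_one_le_of_one_le (one_le_mul_of_one_le_of_one_le hC1 e1) e2
  have hL2 : ∀ z : ℂ, ‖z‖ ≤ 11 / 10 * L → ‖z‖ ≤ 2 * L := fun z hz => by linarith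
  refine ⟨F, om, cauchyT G, thickening (5 / 2) Z, ?_⟩
  have hdψ : Differentiable ℝ ψ := h.smooth_ψ.differentiable (by simp)
  constructor
  · have hφ : Differentiable ℝ (fun z => 1 + ψ z) := (differentiable_const (1 : ℝ)).add hdψ
    simp only [div_eq_mul_inv]
    exact h.diff_u.mul (hφ.inv fun z => by linarith [(h.φ_pos z).1])
  · exact hFs.continuous
  · exact homs.continuous
  · exact (contDiff_cauchyT hGs hGc).continuous
  · exact isOpen_thickening
  · intro z _
    rw [dr_div h.diff_u hdψ h.ψ_half, norm_div, norm_pow, Complex.norm_real,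
      Real.norm_of_nonneg (by linarith [(h.φ_pos z).1]), div_le_iff₀ (by
        have := (h.φ_pos z).1; positivity)]
    have h1 : 1 ≤ 4 * (1 + ψ z) ^ 2 := by nlinarith [(h.φ_pos z).1]
    have := mul_le_mul_of_nonneg_left h1 (norm_nonneg (F z))
    linarith
  · intro z hzO hz
    have hχz : χ z = 1 := hχB z (by rw [mem_closedBall_zero_iff]; linarith)
    have hpz : p z = 1 := hpB z (thickening_subset_cthickening _ _ hzO)
    have d1 := (hdiff hexp) z
    have d2 := (hdiff hFs) z
    have d3 := (hdiff (contDiff_cauchyT hGs hGc)) z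
    refine differentiableAt_of_db_eq_zero ((d1.mul d2).sub d3) ?_
    have e : db (fun z => cexp (-om z) * F z - cauchyT G z) z = _ := db_sub (d1.mul d2) d3
    rw [e, db_mul d1 d2, db_cexp_neg ((hdiff homs) z), hdb_om, db_cauchyT hGs hGc]
    simp only [hG, hb, hχz, hpz]
    push_cast
    ring
  · intro z hz
    refine (hT1 z hz).trans ?_
    rw [hν]
    have e1 : Real.exp (3 * D * L) ≤ Real.exp (C * L) := Real.exp_le_exp.2 (by gcongr)
    calc Ct * (Real.exp (3 * D * L) * Cr * L ^ 2 / √n)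
        = (Ct * Cr) * Real.exp (3 * D * L) * L ^ 2 / √n := by ring
      _ ≤ C * Real.exp (C * L) * L ^ 2 / √n := by gcongr
  · simp [hom]
  · intro z z' hz hz'
    have e : om z - om z' = cauchyT b z - cauchyT b z' := by simp [hom]
    rw [e]
    refine (hosc2 z z' (hL2 z hz) (hL2 z' hz')).trans ?_
    gcongr
    linarith
  · intro z hzO _ hz
    refine (hfar h hδδ z hz fun ζ hζ hζL => ?_).trans (by gcongr)
    by_contra hlt
    push Not at hlt
    exact hzO (mem_thickening_iff.2 ⟨ζ, ⟨hζ, hζL⟩, by rwa [dist_eq_norm]⟩)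
  · intro z hz
    refine (hgrad h z m (by linarith) hm0 fun y hy => hm y ?_).trans ?_
    · rw [mem_closedBall_zero_iff]
      exact (ball_norm_lt (s := 2) (t := 4) (by linarith) hy (by norm_num)).le.trans (by norm_num)
    · have : 0 ≤ 1 / √(n : ℝ) := by positivity
      gcongr
      linarith
  · intro z hz
    have hu := h.abs_u_le (z := z) (a := m) (by linarith) fun y hy => hm y (by
      rw [mem_closedBall_zero_iff]
      exact (ball_norm_lt (s := 2) (t := 3) (by linarith) hy (by norm_num)).le.trans (by norm_num))
    have hφ := (h.φ_pos z).1
    rw [abs_div, abs_of_pos (by linarith : 0 < 1 + ψ z), div_le_iff₀ (by linarith)]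
    nlinarith
  · intro z hz
    refine (hgrad h z 1 (by linarith) zero_le_one fun y _ => h.U_le y).trans ?_
    have : 1 / √(n : ℝ) ≤ 1 := by rw [div_le_one (by positivity)]; exact hs1
    have h2 : Cg * (1 + 1 / √(n : ℝ)) ≤ Cg * 2 := by gcongr; linarith
    linarith

lemma tendsto_const_div_sqrt (c : ℝ) : Tendsto (fun n : ℕ => c / √(n : ℝ)) atTop (𝓝 0) :=
  Tendsto.div_atTop tendsto_const_nhds (Real.tendsto_sqrt_atTop.comp tendsto_natCast_atTop_atTop)

/-- The quantitative lower bound for normalized solutions with a small potential. -/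
theorem Sol.lower_bound : ∃ C : ℝ, 0 < C ∧ ∃ δ₀ : ℝ, 0 < δ₀ ∧
    ∀ (L δ m : ℝ) (U W : ℂ → ℝ) (y : ℂ), 80 ≤ L → 0 < δ → δ * (1 + Real.log L) ≤ δ₀ →
      Sol L δ U W → ‖y‖ = L / 2 → |U y| = 1 → (∀ z ∈ closedBall (0:ℂ) 6, |U z| ≤ m) →
      Real.exp (-C * (L * Real.log L)) ≤ m := by
  obtain ⟨κ, hκ, δ₁, hδ₁, C₁, hC₁, hmul⟩ := exists_multiplier
  set K := max 1 (max κ C₁) with hK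
  have hK1 : 1 ≤ K := le_max_left _ _
  have hKκ : κ ≤ K := (le_max_left _ _).trans (le_max_right _ _)
  have hKC : C₁ ≤ K := (le_max_right _ _).trans (le_max_right _ _)
  obtain ⟨C, hC, δ₂, hδ₂, hcfg⟩ := Setup.exists_cfg K
  obtain ⟨C', hC', hlow⟩ := Cfg.lower_bound hC
  refine ⟨C', hC', min (min 1 δ₁) δ₂, by positivity, ?_⟩
  intro L δ m U W y hL hδ hδL hs hy hUy hm
  have hlog : 0 ≤ Real.log L := Real.log_nonneg (by linarith)
  have hδ' : δ ≤ min (min 1 δ₁) δ₂ := by nlinarith [mul_nonneg hδ.le hlog]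
  have hδ1 : δ ≤ 1 := hδ'.trans ((min_le_left _ _).trans (min_le_left _ _))
  have hδδ₁ : δ ≤ δ₁ := hδ'.trans ((min_le_left _ _).trans (min_le_right _ _))
  have hm0 : 0 ≤ m := (abs_nonneg _).trans (hm 0 (by simp))
  have hlim : Tendsto (fun n : ℕ => m + C * Real.exp (C * L) * L ^ 2 / √(n : ℝ)) atTop (𝓝 (m + 0)) :=
    (tendsto_const_div_sqrt _).const_add m
  rw [add_zero] at hlim
  refine ge_of_tendsto hlim ?_
  have hsmall : ∀ᶠ n : ℕ in atTop, 1 / (n : ℝ) < δ :=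
    tendsto_one_div_atTop_nhds_zero_nat.eventually_lt_const hδ
  filter_upwards [hsmall, eventually_ge_atTop 4] with n hnδ hn
  have hn0 : (0:ℝ) < n := by exact_mod_cast (by omega : 0 < n)
  have hn1 : 0 < 1 / (n : ℝ) := by positivity
  have hn4 : 1 / (n : ℝ) ≤ 1 / 4 := one_div_le_one_div_of_le (by norm_num) (by exact_mod_cast hn)
  obtain ⟨Pn, Pf, hch⟩ := hs.exists_charge (n := n) hL hδ1 (by omega)
  obtain ⟨u, w, hap⟩ := hs.exists_approx hL hn1
  obtain ⟨ψ, hψs, hψ1, hψ2, hψ3, hψ4⟩ := hmul L U n Pn Pf hch (by linarith) δ w hδ hδδ₁ hap.smooth_w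
    hap.hw (1 / n) hn1 hnδ.le
  have hP : ∀ z, 0 ≤ Pn z + Pf z + 1 := fun z => by
    by_contra hneg
    have h := (abs_nonneg _).trans (hψ3 z)
    have : C₁ * δ * (Pn z + Pf z + 1) < 0 := mul_neg_of_pos_of_neg (by positivity) (by linarith)
    linarith
  have hset : Setup K κ L δ (1 / n) n U u w ψ Pn Pf := ⟨hK1, hκ.le, hKκ, hL, hδ, hδ1, hn, hn1, le_rfl,
    hs.hU, hs.cont, hap, hch, hψs, hψ2, fun z => (hψ1 z).trans (by gcongr),
    fun z => (hψ3 z).trans (mul_le_mul_of_nonneg_right (by gcongr) (hP z)), hψ4⟩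
  obtain ⟨F, om, T, O, hF⟩ := hcfg hset (hδL.trans (min_le_right _ _)) m hm
  refine hlow L _ m _ F om T O y (by linarith) hm0 (by positivity) hF hy ?_
  obtain ⟨h1, h2⟩ := hset.φ_pos y
  have hcl := hap.close y (by rw [mem_ball_zero_iff, hy]; linarith)
  have hu : 3 / 4 ≤ |u y| := by
    have := abs_sub_abs_le_abs_sub (U y) (u y)
    rw [abs_sub_comm] at this
    linarith
  rw [abs_div, abs_of_pos (by linarith : 0 < 1 + ψ y), le_div_iff₀ (by linarith)]
  linarith

/-- The standard isometry between the complex plane and the Euclidean plane. -/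
def planeIso : ℂ ≃ₗᵢ[ℝ] E2 := Complex.orthonormalBasisOneI.repr

lemma planeIso_one : planeIso 1 = EuclideanSpace.single 0 1 := by
  have := Complex.orthonormalBasisOneI.repr_self 0
  simpa [planeIso] using this

lemma planeIso_I : planeIso I = EuclideanSpace.single 1 1 := by
  have := Complex.orthonormalBasisOneI.repr_self 1
  simpa [planeIso] using this

/-- The similarity of ratio `ε` sending the origin to `x₀`. -/
def simil (x₀ : E2) {ε : ℝ} (hε : ε ≠ 0) : ℂ ≃ₜ E2 :=
  (planeIso.toHomeomorph.trans (Homeomorph.smulOfNeZero ε hε)).trans (Homeomorph.addLeft x₀)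

section
variable (x₀ : E2) {ε : ℝ} (hε : ε ≠ 0)

lemma simil_apply (z : ℂ) : simil x₀ hε z = x₀ + ε • planeIso z := rfl

lemma simil_symm_apply (x : E2) : (simil x₀ hε).symm x = planeIso.symm (ε⁻¹ • (x - x₀)) := by
  rw [Homeomorph.symm_apply_eq, simil_apply, LinearIsometryEquiv.apply_symm_apply,
    smul_inv_smul₀ hε, add_sub_cancel]

lemma contDiff_simil_symm : ContDiff ℝ ∞ (simil x₀ hε).symm := by
  have : ((simil x₀ hε).symm : E2 → ℂ) = fun x => planeIso.symm (ε⁻¹ • (x - x₀)) :=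
    funext (simil_symm_apply x₀ hε)
  rw [this]
  exact planeIso.symm.contDiff.comp ((contDiff_id.sub contDiff_const).const_smul ε⁻¹)

lemma dist_simil (z : ℂ) : dist (simil x₀ hε z) x₀ = |ε| * ‖z‖ := by
  rw [simil_apply, dist_eq_norm, add_sub_cancel_left, norm_smul, Real.norm_eq_abs,
    LinearIsometryEquiv.norm_map]

lemma fderiv_comp_simil {g : E2 → ℝ} (hg : Differentiable ℝ g) (z v : ℂ) :
    fderiv ℝ (fun w => g (simil x₀ hε w)) z v = ε * fderiv ℝ g (simil x₀ hε z) (planeIso v) := by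
  have h1 : HasFDerivAt (fun w : ℂ => x₀ + ε • planeIso w)
      (ε • (planeIso.toContinuousLinearEquiv : ℂ →L[ℝ] E2)) z :=
    (((planeIso.toContinuousLinearEquiv : ℂ →L[ℝ] E2).hasFDerivAt (x := z)).const_smul ε).const_add x₀
  have h2 := (hg (simil x₀ hε z)).hasFDerivAt.comp z h1
  have h3 : fderiv ℝ (fun w => g (simil x₀ hε w)) z = _ := h2.fderiv
  rw [h3]
  simp

lemma lp_comp_simil {g : E2 → ℝ} (hg : ContDiff ℝ ∞ g) (z : ℂ) :
    lp (fun w => g (simil x₀ hε w)) z = ε ^ 2 * lap g (simil x₀ hε z) := by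
  have hd (v : E2) : Differentiable ℝ (fun y => fderiv ℝ g y v) :=
    ((hg.fderiv_right (m := ∞) (by simp)).clm_apply contDiff_const).differentiable (by simp)
  have h1 (v : ℂ) : fderiv ℝ (fun w => fderiv ℝ (fun w => g (simil x₀ hε w)) w v) z v =
      ε ^ 2 * fderiv ℝ (fun y => fderiv ℝ g y (planeIso v)) (simil x₀ hε z) (planeIso v) := by
    have : (fun w => fderiv ℝ (fun w => g (simil x₀ hε w)) w v) =
        fun w => (fun y => ε * fderiv ℝ g y (planeIso v)) (simil x₀ hε w) :=
      funext fun w => fderiv_comp_simil x₀ hε (hg.differentiable (by simp)) w v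
    rw [this, fderiv_comp_simil x₀ hε ((hd _).const_mul ε), fderiv_const_mul (hd _ _)]
    simp
    ring
  rw [lp, h1, h1, lap, Fin.sum_univ_two, planeIso_one, planeIso_I]
  ring

lemma integral_comp_simil (g : E2 → ℝ) :
    ∫ z, g (simil x₀ hε z) = (ε ^ 2)⁻¹ * ∫ x, g x := by
  have h1 : ∫ z, g (simil x₀ hε z) = ∫ x : E2, g (x₀ + ε • x) :=
    planeIso.measurePreserving.integral_comp planeIso.toHomeomorph.measurableEmbedding
      (fun x => g (x₀ + ε • x))
  have h2 := Measure.integral_comp_smul (volume : Measure E2) (fun x => g (x₀ + x)) ε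
  rw [h1, h2, integral_add_left_eq_self g x₀]
  simp [abs_of_nonneg]

lemma ae_simil {p : E2 → Prop} (h : ∀ᵐ x, p x) : ∀ᵐ z, p (simil x₀ hε z) := by
  have h1 : ∀ᵐ x : E2, p (x₀ + x) := (measurePreserving_add_left volume x₀).quasiMeasurePreserving.ae h
  have h2 : ∀ᵐ x : E2, p (x₀ + ε • x) := by
    rw [ae_iff] at h1 ⊢
    have := Measure.addHaar_preimage_smul (volume : Measure E2) hε {x | ¬ p (x₀ + x)}
    rw [h1, mul_zero] at this
    exact this
  exact planeIso.measurePreserving.quasiMeasurePreserving.ae h2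

end

lemma lp_eq_zero {h : ℂ → ℝ} {z : ℂ} (hz : z ∉ tsupport h) : lp h z = 0 := by
  have h1 := notMem_tsupport_iff_eventuallyEq.1 hz
  have h2 (v : ℂ) : (fun w => fderiv ℝ h w v) =ᶠ[𝓝 z] fun _ => 0 := by
    filter_upwards [h1.fderiv (𝕜 := ℝ)] with w hw
    rw [hw]; simp
  rw [lp, (h2 1).fderiv_eq, (h2 I).fderiv_eq]
  simp

open Classical in
/-- Rescaling a weak solution by a similarity produces a normalized solution on a large disc with a
small potential. -/
lemma sol_of_isWeakSol {R ε : ℝ} {V u : E2 → ℝ} {x₀ : E2} (hR : 0 < R) (hε : 0 < ε) (hV : Measurable V)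
    (hV1 : ∀ᵐ x ∂(volume.restrict (ball (0 : E2) (2 * R))), |V x| ≤ 1)
    (hu : ContinuousOn u (ball (0 : E2) (2 * R))) (hw : IsWeakSol (ball (0 : E2) (2 * R)) V u)
    (hu1 : ∀ x ∈ ball (0 : E2) (2 * R), |u x| ≤ 1) (hx₀ : ‖x₀‖ = R / 2) :
    Sol (R / ε) (ε ^ 2)
      ((ball (0:ℂ) (3 / 2 * (R / ε))).indicator fun z => u (simil x₀ hε.ne' z))
      (fun z => if |V (simil x₀ hε.ne' z)| ≤ 1 then ε ^ 2 * V (simil x₀ hε.ne' z) else 0) := by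
  set A := simil x₀ hε.ne' with hA
  set B := ball (0:ℂ) (3 / 2 * (R / ε)) with hB
  have hAB : MapsTo A B (ball 0 (2 * R)) := fun z hz => by
    have h1 := dist_simil x₀ hε.ne' z
    have h2 := dist_triangle (A z) x₀ 0
    rw [hB, mem_ball_zero_iff] at hz
    have h3 : ε * ‖z‖ < ε * (3 / 2 * (R / ε)) := by gcongr
    have h4 : ε * (3 / 2 * (R / ε)) = 3 / 2 * R := by field_simp
    rw [abs_of_pos hε] at h1
    rw [dist_zero_right x₀, hx₀] at h2
    rw [mem_ball]
    rw [← hA] at h1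
    linarith
  have hVA : Measurable fun z => V (A z) := hV.comp A.measurable
  have hcont : ContinuousOn (fun z => u (A z)) B := hu.comp A.continuous.continuousOn hAB
  refine ⟨?_, ?_, ?_, ?_, ?_, ?_⟩
  · rw [← piecewise_eq_indicator]
    exact hcont.measurable_piecewise continuous_zero.continuousOn measurableSet_ball
  · exact Measurable.ite (measurableSet_le hVA.abs measurable_const) (hVA.const_mul _) measurable_const
  · intro z
    by_cases hz : z ∈ B
    · rw [indicator_of_mem hz]; exact hu1 _ (hAB hz)
    · simp [indicator_of_notMem hz]
  · intro z
    split_ifs with h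
    · rw [abs_mul, abs_of_pos (by positivity)]
      exact mul_le_of_le_one_right (by positivity) h
    · simp; positivity
  · exact hcont.congr fun z hz => indicator_of_mem hz _
  · intro h hh hc hsupp
    set g : E2 → ℝ := fun x => h (A.symm x) with hg
    have hgs : ContDiff ℝ ∞ g := hh.comp (contDiff_simil_symm x₀ hε.ne')
    have hgA : (fun z => g (A z)) = h := by ext z; simp [hg]
    have htg : tsupport g = A.symm ⁻¹' tsupport h := tsupport_comp_eq_preimage h A.symm
    have hgt : tsupport g ⊆ ball 0 (2 * R) := by
      rw [htg]
      intro x hx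
      have := hAB (hsupp hx)
      rwa [A.apply_symm_apply] at this
    have key := hw g ⟨hgs, hc.comp_homeomorph A.symm, hgt⟩
    have hlap (z : ℂ) : lp h z = ε ^ 2 * lap g (A z) := by
      rw [← hgA]; exact lp_comp_simil x₀ hε.ne' hgs z
    have hout (z : ℂ) (hz : z ∉ B) : h z = 0 := image_eq_zero_of_notMem_tsupport fun h' => hz (hsupp h')
    have hlpout (z : ℂ) (hz : z ∉ B) : lp h z = 0 := lp_eq_zero fun h' => hz (hsupp h')
    rw [← integral_indicator measurableSet_ball, ← integral_indicator measurableSet_ball] at key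
    have hε2 : (ε ^ 2)⁻¹ ≠ 0 := by positivity
    have key2 := congrArg (fun t => ε ^ 2 * ((ε ^ 2)⁻¹ * t)) key
    rw [mul_add, mul_add, mul_zero, mul_zero, ← integral_comp_simil x₀ hε.ne', ← integral_comp_simil x₀ hε.ne',
      ← integral_const_mul, ← integral_const_mul] at key2
    rw [← key2]
    congr 1
    · refine integral_congr_ae (.of_forall fun z => ?_)
      dsimp only
      by_cases hz : z ∈ B
      · rw [indicator_of_mem hz, indicator_of_mem (hAB hz), hlap z]; ring
      · rw [indicator_of_notMem hz, zero_mul]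
        have h0 : lap g (A z) = 0 := by
          have := (hlap z).symm.trans (hlpout z hz)
          exact (mul_eq_zero.1 this).resolve_left (by positivity)
        rw [indicator_apply]
        split_ifs
        · rw [← hA, h0]; simp
        · simp
    · have hae := ae_simil x₀ hε.ne' ((ae_restrict_iff' measurableSet_ball).1 hV1)
      refine integral_congr_ae ?_
      filter_upwards [hae] with z hzV
      by_cases hz : z ∈ B
      · have hgz : g (A z) = h z := congrFun hgA z
        rw [indicator_of_mem hz, indicator_of_mem (hAB hz), if_pos (hzV (hAB hz)), hgz]; ring
      · have hgz : g (A z) = 0 := (congrFun hgA z).trans (hout z hz)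
        rw [hout z hz, mul_zero, indicator_apply]
        split_ifs
        · rw [← hA, hgz]; simp
        · simp

lemma rescaled_exponent {C R c l e L : ℝ} (hC : 0 < C) (hc : 0 < c) (hR : 0 < R) (hl : 1 ≤ l)
    (hlR : l = Real.log R) (he : e = c / √l) (hL : L = R / e) :
    L * Real.log L ≤ (2 + 1 / c) / c * (R * l ^ (3 / 2 : ℝ)) ∧ Real.log L ≤ (2 + 1 / c) * l := by
  have hl0 : 0 < l := by linarith
  have hs : 0 < √l := Real.sqrt_pos.2 hl0
  have hLe : L = R * √l / c := by rw [hL, he]; field_simp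
  have hlog : Real.log L ≤ (2 + 1 / c) * l := by
    have h1 : Real.log L = l + Real.log √l + Real.log (1 / c) := by
      rw [hLe, div_eq_mul_one_div, Real.log_mul (mul_pos hR hs).ne' (one_div_pos.2 hc).ne',
        Real.log_mul hR.ne' hs.ne', ← hlR]
    have h2 : Real.log √l ≤ l := by
      rw [Real.log_sqrt hl0.le]
      have := Real.log_le_self hl0.le
      have := Real.log_nonneg hl
      linarith
    have h3 : Real.log (1 / c) ≤ 1 / c := Real.log_le_self (by positivity)
    have h4 : 1 / c ≤ 1 / c * l := le_mul_of_one_le_right (by positivity) hl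
    rw [h1]; linarith
  refine ⟨?_, hlog⟩
  have hpow : l ^ (3 / 2 : ℝ) = l * √l := by
    rw [show (3 / 2 : ℝ) = 1 + 1 / 2 by norm_num, Real.rpow_add hl0, Real.rpow_one, Real.sqrt_eq_rpow]
  calc L * Real.log L ≤ L * ((2 + 1 / c) * l) := by
        gcongr
        rw [hLe]; positivity
    _ = _ := by rw [hLe, hpow]; field_simp

end Landis

/-- **Theorem 2 (local version of Landis' conjecture).** -/
theorem landis_local :
    ∃ C : ℝ, 0 < C ∧
      ∀ (R : ℝ) (V u : E2 → ℝ), 4 < R → Measurable V →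
        (∀ᵐ x ∂(volume.restrict (ball (0 : E2) (2 * R))), |V x| ≤ 1) →
        LocallyIntegrableOn u (ball (0 : E2) (2 * R)) volume →
        ContinuousOn u (ball (0 : E2) (2 * R)) →
        IsWeakSol (ball (0 : E2) (2 * R)) V u →
        |u 0| = 1 → supAbs u (ball (0 : E2) (2 * R)) = 1 →
        ∀ x₀ : E2, ‖x₀‖ = R / 2 →
          Real.exp (-(C * R * Real.log R ^ (3 / 2 : ℝ))) ≤ supAbs u (ball x₀ 1) := by
  obtain ⟨C, hC, δ₀, hδ₀, hlow⟩ := Landis.Sol.lower_bound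
  set c := min (1 / 80) (δ₀ / 4) with hc
  have hc0 : 0 < c := by positivity
  have hc1 : c ≤ 1 / 80 := min_le_left _ _
  have hc2 : c ≤ δ₀ / 4 := min_le_right _ _
  refine ⟨C * ((2 + 1 / c) / c), by positivity, ?_⟩
  intro R V u hR hV hV1 _ hu hw hu0 hsup x₀ hx₀
  have hR0 : 0 < R := by linarith
  set l := Real.log R with hl
  have hl1 : 1 ≤ l := by
    rw [hl, Real.le_log_iff_exp_le hR0]
    linarith [Real.exp_one_lt_d9]
  have hs1 : 1 ≤ √l := Real.one_le_sqrt.2 hl1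
  set ε := c / √l with hε
  have hε0 : 0 < ε := by positivity
  have hεc : ε ≤ c := div_le_self hc0.le hs1
  have hbdd : BddAbove ((fun z => |u z|) '' ball (0 : E2) (2 * R)) := by
    by_contra hb
    rw [supAbs, Real.sSup_of_not_bddAbove hb] at hsup
    norm_num at hsup
  have hu1 : ∀ x ∈ ball (0 : E2) (2 * R), |u x| ≤ 1 := fun x hx =>
    (le_csSup hbdd (mem_image_of_mem _ hx)).trans hsup.le
  have hsub : ball x₀ 1 ⊆ ball (0 : E2) (2 * R) := by
    refine ball_subset_ball' ?_
    rw [dist_zero_right, hx₀]; linarith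
  have hub : ∀ x ∈ ball x₀ 1, |u x| ≤ supAbs u (ball x₀ 1) := fun x hx =>
    le_csSup (hbdd.mono (image_mono hsub)) (mem_image_of_mem _ hx)
  have hm0 : 0 ≤ supAbs u (ball x₀ 1) := (abs_nonneg _).trans (hub x₀ (mem_ball_self one_pos))
  obtain ⟨hexp, hlogL⟩ := Landis.rescaled_exponent (L := R / ε) hC hc0 hR0 hl1 hl hε rfl
  have hsol := Landis.sol_of_isWeakSol hR0 hε0 hV hV1 hu hw hu1 hx₀
  have hL : 80 ≤ R / ε := by
    rw [le_div_iff₀ hε0]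
    linarith
  have hδ : ε ^ 2 * (1 + Real.log (R / ε)) ≤ δ₀ := by
    have h1 : ε ^ 2 = c ^ 2 / l := by rw [hε, div_pow, Real.sq_sqrt (by linarith)]
    calc ε ^ 2 * (1 + Real.log (R / ε)) ≤ c ^ 2 / l * (l + (2 + 1 / c) * l) := by
          rw [h1]; gcongr
      _ = 3 * c ^ 2 + c := by
          have : l ≠ 0 := by linarith
          field_simp; ring
      _ ≤ δ₀ := by nlinarith
  set y := (Landis.simil x₀ hε0.ne').symm 0 with hy
  have hAy : Landis.simil x₀ hε0.ne' y = 0 := by rw [hy, Homeomorph.apply_symm_apply]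
  have hyn : ‖y‖ = R / ε / 2 := by
    have h1 := Landis.dist_simil x₀ hε0.ne' y
    rw [hAy, dist_zero_left, hx₀, abs_of_pos hε0] at h1
    field_simp
    linarith
  have hmain := hlow (R / ε) (ε ^ 2) (supAbs u (ball x₀ 1)) _ _ y hL (by positivity) hδ hsol hyn ?_ ?_
  · refine le_trans (Real.exp_le_exp.2 ?_) hmain
    have := mul_le_mul_of_nonneg_left hexp hC.le
    nlinarith
  · rw [indicator_of_mem, hAy, hu0]
    rw [mem_ball_zero_iff, hyn]
    linarith
  · intro z hz
    rw [mem_closedBall_zero_iff] at hz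
    by_cases hzB : z ∈ ball (0:ℂ) (3 / 2 * (R / ε))
    · rw [indicator_of_mem hzB]
      refine hub _ ?_
      rw [mem_ball, Landis.dist_simil, abs_of_pos hε0]
      nlinarith [norm_nonneg z]
    · rw [indicator_of_notMem hzB, abs_zero]
      exact hm0
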